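/- Let p be a prime, K a p-adic number field with ring of integers 𝒪_K, and m, n positive integers. Let 𝒪 be an integral domain of characteristic zero with fraction field 𝒦, and suppose there exists a finite injective ring homomorphism 𝒪_K[[X_1,…,X_m]] → 𝒪. Let F be a number field and ρ : Gal(F̄/F) → GL_n(𝒪) a group homomorphism that is continuous with respect to the profinite topology on Gal(F̄/F) and the maximal-ideal-adic topology on 𝒪, and such that the representation ρ ⊗ 𝒦̄ (the action of Gal(F̄/F) on 𝒦̄^n through ρ, where 𝒦̄ is an algebraic closure of 𝒦) is semisimple. Then the set of nonzero primes of 𝒪_F at which ρ is ramified has density zero. -/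

import Mathlib

set_option synthInstance.maxHeartbeats 1000000
set_option maxHeartbeats 2000000

open scoped Topology

/-- The ring of integers of a nonarchimedean normed field: the closed unit ball. -/
def unitBall (K : Type*) [NormedField K] [IsUltrametricDist K] : Subring K where
  carrier := {x : K | ‖x‖ ≤ 1}
  mul_mem' {a b} ha hb := by
    simp only [Set.mem_setOf_eq, norm_mul] at *
    exact mul_le_one₀ ha (norm_nonneg _) hb
  one_mem' := by simp
  add_mem' {a b} ha hb :=
    le_trans (IsUltrametricDist.norm_add_le_max a b) (max_le ha hb)
  zero_mem' := by simp
  neg_mem' {a} ha := by simpa using ha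

/-- The representation of `G` on `Lⁿ` obtained from `ρ : G →* GLₙ(𝒪)` by applying a ring
homomorphism `f : 𝒪 →+* L` entrywise. -/
noncomputable def matrixRep {𝒪 L G : Type*} [CommRing 𝒪] [CommRing L] [Group G] {n : ℕ}
    (f : 𝒪 →+* L) (ρ : G →* Matrix.GeneralLinearGroup (Fin n) 𝒪) :
    Representation L G (Fin n → L) :=
  (Matrix.toLinAlgEquiv' (R := L) (n := Fin n)).toAlgHom.toRingHom.toMonoidHom.comp
    ((Units.coeHom (Matrix (Fin n) (Fin n) L)).comp
      ((Matrix.GeneralLinearGroup.map f).comp ρ))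

/-- A representation `ρ` of the absolute Galois group `Gal(F̄/F)` of a number field `F` is
ramified at a nonzero prime `v` of `𝒪_F` if the inertia subgroup at some prime `Q` of the
integral closure of `𝒪_F` in `F̄` lying above `v` is not contained in the kernel of `ρ`;
here `σ` belongs to the inertia subgroup at `Q` iff `σ x ≡ x (mod Q)` for all `x` integral
over `𝒪_F`. -/
def IsRamifiedAt (F : Type) [Field F] [NumberField F] {𝒪 : Type*} [CommRing 𝒪] {n : ℕ}
    (ρ : (AlgebraicClosure F ≃ₐ[F] AlgebraicClosure F) →*
      Matrix.GeneralLinearGroup (Fin n) 𝒪)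
    (v : IsDedekindDomain.HeightOneSpectrum (NumberField.RingOfIntegers F)) : Prop :=
  ∃ Q : Ideal (integralClosure (NumberField.RingOfIntegers F) (AlgebraicClosure F)),
    Q.IsPrime ∧
    Ideal.comap (algebraMap (NumberField.RingOfIntegers F)
      (integralClosure (NumberField.RingOfIntegers F) (AlgebraicClosure F))) Q =
        v.asIdeal ∧
    ∃ σ : AlgebraicClosure F ≃ₐ[F] AlgebraicClosure F,
      (∀ x : integralClosure (NumberField.RingOfIntegers F) (AlgebraicClosure F),
        ∃ y ∈ Q, (y : AlgebraicClosure F) = σ (x : AlgebraicClosure F) - x) ∧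
      ρ σ ≠ 1

open scoped Topology

open Finset in
/-- Counting data for an arithmetical semigroup: finitely many elements of bounded norm. -/
structure ArithSemigroup (M : Type*) [AddCommMonoid M] where
  norm : M → ℕ
  norm_pos : ∀ f, 0 < norm f
  norm_zero : norm 0 = 1
  norm_add : ∀ f g, norm (f + g) = norm f * norm g
  finite_le : ∀ x : ℝ, {f | (norm f : ℝ) ≤ x}.Finite

namespace ArithSemigroup

open Finset

variable {M : Type*} [AddCommMonoid M] (𝒮 : ArithSemigroup M)

/-- The elements of norm at most `x`. -/
noncomputable def ball (x : ℝ) : Finset M := (𝒮.finite_le x).toFinset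

@[simp] lemma mem_ball {x : ℝ} {f : M} : f ∈ 𝒮.ball x ↔ (𝒮.norm f : ℝ) ≤ x := by
  simp [ball]

lemma one_le_norm (f : M) : (1 : ℝ) ≤ 𝒮.norm f := by exact_mod_cast 𝒮.norm_pos f

lemma norm_pos' (f : M) : (0 : ℝ) < 𝒮.norm f := by exact_mod_cast 𝒮.norm_pos f

lemma ball_mono {x y : ℝ} (h : x ≤ y) : 𝒮.ball x ⊆ 𝒮.ball y := by
  intro f; simp only [mem_ball]; intro hf; linarith

lemma one_le_div_norm {x : ℝ} {f : M} (hf : f ∈ 𝒮.ball x) : 1 ≤ x / 𝒮.norm f := by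
  rw [le_div_iff₀ (𝒮.norm_pos' f), one_mul]; simpa using hf

/-- The convolution action of an arithmetic function on functions of a real variable. -/
noncomputable def act (a : M → ℝ) (F : ℝ → ℝ) (x : ℝ) : ℝ :=
  ∑ f ∈ 𝒮.ball x, a f * F (x / 𝒮.norm f)

/-- The counting function. -/
noncomputable def count (x : ℝ) : ℝ := #(𝒮.ball x)

lemma act_congr {a : M → ℝ} {F G : ℝ → ℝ} (h : ∀ x, 1 ≤ x → F x = G x) (x : ℝ) :
    𝒮.act a F x = 𝒮.act a G x :=
  sum_congr rfl fun f hf => by rw [h _ (𝒮.one_le_div_norm hf)]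

lemma act_add_right (a : M → ℝ) (F G : ℝ → ℝ) (x : ℝ) :
    𝒮.act a (fun y => F y + G y) x = 𝒮.act a F x + 𝒮.act a G x := by
  simp [act, mul_add, sum_add_distrib]

lemma act_sub_right (a : M → ℝ) (F G : ℝ → ℝ) (x : ℝ) :
    𝒮.act a (fun y => F y - G y) x = 𝒮.act a F x - 𝒮.act a G x := by
  simp [act, mul_sub, sum_sub_distrib]

lemma act_const_mul (a : M → ℝ) (F : ℝ → ℝ) (c x : ℝ) :
    𝒮.act a (fun y => c * F y) x = c * 𝒮.act a F x := by
  simp only [act, mul_sum]; exact sum_congr rfl fun _ _ => by ring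

lemma abs_act_le (a : M → ℝ) (F : ℝ → ℝ) (x : ℝ) :
    |𝒮.act a F x| ≤ 𝒮.act (fun f => |a f|) (fun y => |F y|) x := by
  refine (abs_sum_le_sum_abs _ _).trans_eq (sum_congr rfl fun f _ => abs_mul _ _)

lemma act_le_act {a : M → ℝ} {b : M → ℝ} {F G : ℝ → ℝ} (hb : ∀ f, 0 ≤ b f)
    (hab : ∀ f, a f ≤ b f) (hF : ∀ x, 1 ≤ x → 0 ≤ F x)
    (h : ∀ x, 1 ≤ x → F x ≤ G x) (x : ℝ) : 𝒮.act a F x ≤ 𝒮.act b G x := by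
  refine sum_le_sum fun f hf => ?_
  have := 𝒮.one_le_div_norm hf
  exact mul_le_mul (hab f) (h _ this) (hF _ this) (hb f)

lemma act_act [HasAntidiagonal M] (a b : M → ℝ) (F : ℝ → ℝ) (x : ℝ) :
    𝒮.act a (𝒮.act b F) x =
      𝒮.act (fun h => ∑ q ∈ HasAntidiagonal.antidiagonal h, a q.1 * b q.2) F x := by
  classical
  simp only [act, mul_sum, sum_mul]
  rw [sum_sigma', sum_sigma']
  refine sum_bij' (fun q _ => ⟨q.1 + q.2, (q.1, q.2)⟩) (fun q _ => ⟨q.2.1, q.2.2⟩) ?_ ?_ ?_ ?_ ?_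
  · rintro ⟨f, g⟩ h
    simp only [mem_sigma, mem_ball, HasAntidiagonal.mem_antidiagonal, and_true] at h ⊢
    rw [𝒮.norm_add, Nat.cast_mul]
    have := (le_div_iff₀ (𝒮.norm_pos' f)).1 h.2
    linarith [mul_comm (𝒮.norm f : ℝ) (𝒮.norm g)]
  · rintro ⟨h, ⟨f, g⟩⟩ hh
    simp only [mem_sigma, mem_ball, HasAntidiagonal.mem_antidiagonal] at hh ⊢
    obtain ⟨h1, rfl⟩ := hh
    rw [𝒮.norm_add, Nat.cast_mul] at h1
    constructor
    · nlinarith [𝒮.one_le_norm g, 𝒮.norm_pos' f]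
    · rw [le_div_iff₀ (𝒮.norm_pos' f)]; linarith [mul_comm (𝒮.norm f : ℝ) (𝒮.norm g)]
  · rintro ⟨f, g⟩ h; rfl
  · rintro ⟨h, ⟨f, g⟩⟩ hh
    simp only [mem_sigma, mem_ball, HasAntidiagonal.mem_antidiagonal] at hh
    obtain ⟨h1, rfl⟩ := hh
    rfl
  · rintro ⟨f, g⟩ h
    simp only [𝒮.norm_add, Nat.cast_mul, div_div]; ring

lemma act_eq_self [DecidableEq M] (F : ℝ → ℝ) {x : ℝ} (hx : 1 ≤ x) :
    𝒮.act (fun f => if f = 0 then 1 else 0) F x = F x := by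
  simp [act, 𝒮.norm_zero, hx]

/-- Partial summation against the counting function. -/
lemma sum_eq_sub_integral (h h' : ℝ → ℝ) {x : ℝ} (hx : 1 ≤ x)
    (hd : ∀ t ∈ Set.Icc 1 x, HasDerivAt h (h' t) t)
    (hc : ContinuousOn h' (Set.Icc 1 x)) :
    ∑ f ∈ 𝒮.ball x, h (𝒮.norm f) =
      h x * 𝒮.count x - ∫ t in Set.Ioc 1 x, h' t * 𝒮.count t := by
  classical
  set c : ℕ → ℝ := fun k => #{f ∈ 𝒮.ball k | 𝒮.norm f = k} with hcdef
  have key : ∀ (F : ℕ → ℝ) (t : ℝ), 0 ≤ t →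
      ∑ k ∈ Icc 0 ⌊t⌋₊, F k * c k = ∑ f ∈ 𝒮.ball t, F (𝒮.norm f) := by
    intro F t ht
    rw [← sum_fiberwise_of_maps_to (s := 𝒮.ball t) (t := Icc 0 ⌊t⌋₊) (g := 𝒮.norm)]
    · refine sum_congr rfl fun k hk => ?_
      have hk' : k ≤ ⌊t⌋₊ := by simpa using hk
      have : {f ∈ 𝒮.ball t | 𝒮.norm f = k} = {f ∈ 𝒮.ball k | 𝒮.norm f = k} := by
        ext f
        simp only [mem_filter, mem_ball]
        constructor
        · rintro ⟨_, h⟩; exact ⟨by rw [h], h⟩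
        · rintro ⟨_, h⟩; exact ⟨by rw [h]; exact (Nat.le_floor_iff ht).1 hk', h⟩
      rw [this, sum_congr rfl (g := fun _ => F k)]
      · simp [hcdef, mul_comm]
      · intro f hf; rw [(mem_filter.1 hf).2]
    · intro f hf
      simp only [mem_Icc, zero_le, true_and]
      exact (Nat.le_floor_iff ht).2 (by simpa using hf)
  have hcount : ∀ t : ℝ, 0 ≤ t → ∑ k ∈ Icc 0 ⌊t⌋₊, c k = 𝒮.count t := by
    intro t ht
    have := key (fun _ => 1) t ht
    simpa [count] using this
  have hint : MeasureTheory.IntegrableOn (deriv h) (Set.Icc 1 x) := by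
    refine MeasureTheory.IntegrableOn.congr_fun (hc.integrableOn_Icc) ?_ measurableSet_Icc
    intro t ht; exact ((hd t ht).deriv).symm
  have abel := sum_mul_eq_sub_sub_integral_mul c (f := h) zero_le_one hx
    (fun t ht => (hd t ht).differentiableAt) hint
  have h1 : ∑ k ∈ Icc 0 ⌊x⌋₊, h k * c k =
      h 1 * 𝒮.count 1 + ∑ k ∈ Ioc ⌊(1:ℝ)⌋₊ ⌊x⌋₊, h k * c k := by
    have h2 := key (fun k => h k) 1 zero_le_one
    have h3 : ∑ f ∈ 𝒮.ball 1, h (𝒮.norm f) = h 1 * 𝒮.count 1 := by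
      rw [count, sum_congr rfl (g := fun _ => h 1)]
      · simp [mul_comm]
      · intro f hf
        have : 𝒮.norm f = 1 := by
          have h4 : 𝒮.norm f ≤ 1 := by exact_mod_cast 𝒮.mem_ball.1 hf
          have := 𝒮.norm_pos f; omega
        simp [this]
    rw [← h3, ← h2]
    have hfl : (1:ℕ) ≤ ⌊x⌋₊ := Nat.one_le_floor_iff _ |>.2 hx
    rw [Nat.floor_one, ← Finset.sum_union]
    · congr 1
      ext k; simp only [mem_union, mem_Icc, mem_Ioc]; omega
    · rw [Finset.disjoint_left]; intro k; simp only [mem_Icc, mem_Ioc]; omega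
  rw [← key (fun k => h k) x (by linarith), h1, abel, hcount x (by linarith),
    hcount 1 (by norm_num)]
  have : ∫ t in Set.Ioc 1 x, deriv h t * ∑ k ∈ Icc 0 ⌊t⌋₊, c k =
      ∫ t in Set.Ioc 1 x, h' t * 𝒮.count t := by
    refine MeasureTheory.setIntegral_congr_fun measurableSet_Ioc fun t ht => ?_
    rw [(hd t ⟨ht.1.le, ht.2⟩).deriv, hcount t (by linarith [ht.1])]
  rw [this]; ring

end ArithSemigroup

namespace ArithSemigroup

open Finset

variable {M : Type*} [AddCommMonoid M] (𝒮 : ArithSemigroup M)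

lemma measurable_count : Measurable 𝒮.count := by
  have : Monotone 𝒮.count := fun x y h => by
    unfold count; exact_mod_cast card_le_card (𝒮.ball_mono h)
  exact this.measurable

lemma count_nonneg (x : ℝ) : 0 ≤ 𝒮.count x := by unfold count; positivity

lemma act_rpow_le (a : M → ℝ) (ha : ∀ f, 0 ≤ a f) {B s : ℝ} (hB0 : 0 ≤ B)
    (hs : s < 1) (hs0 : 0 ≤ s)
    (hB : ∀ x, 1 ≤ x → ∑ f ∈ 𝒮.ball x, a f ≤ B * x) :
    ∃ B', 0 ≤ B' ∧ ∀ x, 1 ≤ x → 𝒮.act a (fun y => y ^ s) x ≤ B' * x := by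
  classical
  set r : ℝ := 2 ^ (s - 1) with hr
  have hr0 : 0 < r := by positivity
  have hr1 : r < 1 := Real.rpow_lt_one_of_one_lt_of_neg one_lt_two (by linarith)
  refine ⟨B * (2 * (1 - r)⁻¹), by have : 0 < 1 - r := by linarith
                                  positivity, fun x hx => ?_⟩
  set k₀ : ℕ := ⌊x⌋₊ with hk₀
  -- pointwise bound
  have hpt : ∀ f ∈ 𝒮.ball x, a f * (x / 𝒮.norm f) ^ s ≤
      ∑ k ∈ range (k₀ + 1), if f ∈ 𝒮.ball (x / 2 ^ k) then a f * 2 ^ ((k + 1) * s) else 0 := by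
    intro f hf
    have hy := 𝒮.one_le_div_norm hf
    obtain ⟨k, hk1, hk2⟩ := exists_nat_pow_near hy one_lt_two
    have hkf : f ∈ 𝒮.ball (x / 2 ^ k) := by
      rw [mem_ball, le_div_iff₀ (by positivity)]
      rw [le_div_iff₀ (𝒮.norm_pos' f)] at hk1; linarith
    have hkk : k ∈ range (k₀ + 1) := by
      rw [mem_range, Nat.lt_succ_iff, Nat.le_floor_iff (by linarith)]
      have h1 : (k : ℝ) ≤ 2 ^ k := by exact_mod_cast (Nat.lt_two_pow_self).le
      have h2 : x / 𝒮.norm f ≤ x := div_le_self (by linarith) (𝒮.one_le_norm f)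
      linarith
    refine le_trans ?_ (single_le_sum (f := fun k : ℕ => if f ∈ 𝒮.ball (x / 2 ^ k) then
      a f * (2:ℝ) ^ (((k:ℝ) + 1) * s) else 0) (fun k _ => ?_) hkk)
    · rw [if_pos hkf]
      refine mul_le_mul_of_nonneg_left ?_ (ha f)
      rw [Real.rpow_mul (by norm_num)]
      refine Real.rpow_le_rpow (by linarith) ?_ hs0
      have : ((2:ℝ) ^ ((k:ℝ) + 1)) = 2 ^ (k + 1) := by
        rw [← Real.rpow_natCast]; push_cast; rfl
      rw [this]; exact hk2.le
    · split_ifs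
      · exact mul_nonneg (ha f) (by positivity)
      · exact le_rfl
  calc 𝒮.act a (fun y => y ^ s) x ≤ ∑ f ∈ 𝒮.ball x, ∑ k ∈ range (k₀ + 1),
        (if f ∈ 𝒮.ball (x / 2 ^ k) then a f * (2:ℝ) ^ (((k:ℝ) + 1) * s) else 0) := sum_le_sum hpt
    _ = ∑ k ∈ range (k₀ + 1), ∑ f ∈ 𝒮.ball x,
        (if f ∈ 𝒮.ball (x / 2 ^ k) then a f * (2:ℝ) ^ (((k:ℝ) + 1) * s) else 0) := sum_comm
    _ ≤ ∑ k ∈ range (k₀ + 1), B * x * 2 * r ^ k := by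
        refine sum_le_sum fun k _ => ?_
        rw [← sum_filter]
        have hsub : {f ∈ 𝒮.ball x | f ∈ 𝒮.ball (x / 2 ^ k)} = 𝒮.ball (x / 2 ^ k) := by
          ext f; simp only [mem_filter, and_iff_right_iff_imp]
          intro h
          refine 𝒮.ball_mono ?_ h
          exact div_le_self (by linarith) (one_le_pow₀ (by norm_num))
        rw [hsub, ← sum_mul]
        have hB' : ∑ f ∈ 𝒮.ball (x / 2 ^ k), a f ≤ B * (x / 2 ^ k) := by
          by_cases h : 1 ≤ x / 2 ^ k
          · exact hB _ h
          · have : 𝒮.ball (x / 2 ^ k) = ∅ := by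
              ext f; simp only [mem_ball, notMem_empty, iff_false, not_le]
              have := 𝒮.one_le_norm f; linarith
            rw [this, sum_empty]; positivity
        refine (mul_le_mul_of_nonneg_right hB' (by positivity)).trans ?_
        have e1 : (2:ℝ) ^ (((k:ℝ) + 1) * s) = 2 ^ s * (2 ^ k * r ^ k) := by
          have : (2:ℝ) ^ k * r ^ k = (2 ^ s) ^ k := by
            rw [← mul_pow, hr, Real.rpow_sub (by norm_num), Real.rpow_one]; congr 1; field_simp
          rw [this, ← Real.rpow_natCast, ← Real.rpow_mul (by norm_num),
            ← Real.rpow_add (by norm_num)]; congr 1; ring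
        have e2 : (2:ℝ) ^ s ≤ 2 := by
          calc (2:ℝ) ^ s ≤ 2 ^ (1:ℝ) := Real.rpow_le_rpow_of_exponent_le (by norm_num) hs.le
            _ = 2 := Real.rpow_one _
        rw [e1]
        have : B * (x / 2 ^ k) * (2 ^ s * (2 ^ k * r ^ k)) = B * x * 2 ^ s * r ^ k := by
          field_simp
        rw [this]
        gcongr
    _ = B * x * 2 * ∑ k ∈ range (k₀ + 1), r ^ k := by rw [mul_sum]
    _ ≤ B * x * 2 * (1 - r)⁻¹ := by
        gcongr
        rw [← tsum_geometric_of_lt_one hr0.le hr1]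
        exact (summable_geometric_of_lt_one hr0.le hr1).sum_le_tsum _ (fun _ _ => by positivity)
    _ = _ := by ring

variable {κ δ C : ℝ}

lemma sum_inv_norm (hδ : 0 < δ)
    (hcount : ∀ x, 1 ≤ x → |𝒮.count x - κ * x| ≤ C * x ^ (1 - δ)) :
    ∃ c C', ∀ x, 1 ≤ x → |∑ f ∈ 𝒮.ball x, (𝒮.norm f : ℝ)⁻¹ - (κ * Real.log x + c)| ≤
      C' * x ^ (-δ) := by
  set R : ℝ → ℝ := fun t => (𝒮.count t - κ * t) / t ^ 2 with hR
  have hRb : ∀ t, 1 ≤ t → |R t| ≤ C * t ^ (-δ - 1) := by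
    intro t ht
    have ht0 : 0 < t := by linarith
    rw [hR, abs_div, abs_of_pos (by positivity : (0:ℝ) < t ^ 2), div_le_iff₀ (by positivity)]
    refine (hcount t ht).trans_eq ?_
    rw [mul_assoc, ← Real.rpow_natCast t 2, ← Real.rpow_add ht0]; congr 2; push_cast; ring
  have hmeas : Measurable R := by
    exact (𝒮.measurable_count.sub (measurable_const.mul measurable_id)).div
      (measurable_id.pow_const 2)
  have hint : ∀ x, 1 ≤ x → MeasureTheory.IntegrableOn R (Set.Ioi x) := by
    intro x hx
    refine MeasureTheory.Integrable.mono'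
      ((integrableOn_Ioi_rpow_of_lt (by linarith : -δ - 1 < -1) (by linarith : (0:ℝ) < x)).const_mul C)
      hmeas.aestronglyMeasurable ?_
    refine (MeasureTheory.ae_restrict_iff' measurableSet_Ioi).2 (Filter.Eventually.of_forall ?_)
    intro t ht
    exact hRb t (hx.trans (le_of_lt ht))
  refine ⟨κ + ∫ t in Set.Ioi 1, R t, C + C / δ, fun x hx => ?_⟩
  have hx0 : 0 < x := by linarith
  have h1 := 𝒮.sum_eq_sub_integral (fun t => t⁻¹) (fun t => -(t ^ 2)⁻¹) hx
    (fun t ht => hasDerivAt_inv (by linarith [ht.1]))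
    (by refine ContinuousOn.neg (ContinuousOn.inv₀ (by fun_prop) ?_)
        intro t ht; have := ht.1; positivity)
  rw [h1]
  have hRint1 : MeasureTheory.IntegrableOn R (Set.Ioc 1 x) :=
    (hint 1 le_rfl).mono_set Set.Ioc_subset_Ioi_self
  have hlogint : MeasureTheory.IntegrableOn (fun t : ℝ => κ * t⁻¹) (Set.Ioc 1 x) := by
    refine (ContinuousOn.integrableOn_Icc ?_).mono_set Set.Ioc_subset_Icc_self
    refine ContinuousOn.mul continuousOn_const (ContinuousOn.inv₀ continuousOn_id ?_)
    intro t ht; have := ht.1; positivity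
  have h2 : ∫ t in Set.Ioc 1 x, -(t ^ 2)⁻¹ * 𝒮.count t =
      -((∫ t in Set.Ioc 1 x, R t) + κ * Real.log x) := by
    have : ∫ t in Set.Ioc 1 x, κ * t⁻¹ = κ * Real.log x := by
      rw [← intervalIntegral.integral_of_le hx, intervalIntegral.integral_const_mul,
        integral_inv_of_pos one_pos hx0, div_one]
    rw [← this, ← MeasureTheory.integral_add hRint1 hlogint, ← MeasureTheory.integral_neg]
    refine MeasureTheory.setIntegral_congr_fun measurableSet_Ioc fun t ht => ?_
    have : t ≠ 0 := by have := ht.1; positivity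
    simp only [hR]; field_simp; ring
  have h3 : ∫ t in Set.Ioi 1, R t = (∫ t in Set.Ioc 1 x, R t) + ∫ t in Set.Ioi x, R t := by
    rw [← MeasureTheory.setIntegral_union (Set.Ioc_disjoint_Ioi le_rfl) measurableSet_Ioi
      hRint1 (hint x hx), Set.Ioc_union_Ioi_eq_Ioi hx]
  have h4 : |∫ t in Set.Ioi x, R t| ≤ C / δ * x ^ (-δ) := by
    have h5 : ∫ t in Set.Ioi x, C * t ^ (-δ - 1) = C / δ * x ^ (-δ) := by
      rw [MeasureTheory.integral_const_mul, integral_Ioi_rpow_of_lt (by linarith) hx0]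
      have : -δ - 1 + 1 = -δ := by ring
      rw [this, neg_div_neg_eq]; ring
    rw [← h5]
    rw [← Real.norm_eq_abs]
    refine MeasureTheory.norm_integral_le_of_norm_le
      ((integrableOn_Ioi_rpow_of_lt (by linarith : -δ - 1 < -1) hx0).const_mul C) ?_
    refine (MeasureTheory.ae_restrict_iff' measurableSet_Ioi).2 (Filter.Eventually.of_forall ?_)
    intro t ht
    exact hRb t (hx.trans (le_of_lt ht))
  have h5 : |x⁻¹ * 𝒮.count x - κ| ≤ C * x ^ (-δ) := by
    have : x⁻¹ * 𝒮.count x - κ = x⁻¹ * (𝒮.count x - κ * x) := by field_simp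
    rw [this, abs_mul, abs_of_pos (by positivity : (0:ℝ) < x⁻¹)]
    calc x⁻¹ * _ ≤ x⁻¹ * (C * x ^ (1 - δ)) := by gcongr; exact hcount x hx
      _ = C * x ^ (-δ) := by
        rw [← Real.rpow_neg_one, mul_left_comm, ← Real.rpow_add hx0]; congr 2; ring
  rw [h2, h3]
  have e : x⁻¹ * 𝒮.count x - -((∫ t in Set.Ioc 1 x, R t) + κ * Real.log x) -
      (κ * Real.log x + (κ + ((∫ t in Set.Ioc 1 x, R t) + ∫ t in Set.Ioi x, R t))) =
      (x⁻¹ * 𝒮.count x - κ) - ∫ t in Set.Ioi x, R t := by ring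
  rw [e, add_mul]
  exact (abs_sub _ _).trans (add_le_add h5 h4)

lemma sum_log_norm (hδ : 0 < δ) (hδ1 : δ < 1) (hC : 0 ≤ C)
    (hcount : ∀ x, 1 ≤ x → |𝒮.count x - κ * x| ≤ C * x ^ (1 - δ)) :
    ∃ C', ∀ x, 1 ≤ x → |∑ f ∈ 𝒮.ball x, Real.log (𝒮.norm f) - (κ * x * Real.log x - κ * x)| ≤
      C' * x ^ (1 - δ / 2) := by
  set R : ℝ → ℝ := fun t => (𝒮.count t - κ * t) / t with hR
  have hRb : ∀ t, 1 ≤ t → |R t| ≤ C * t ^ (-δ) := by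
    intro t ht
    have ht0 : 0 < t := by linarith
    rw [hR, abs_div, abs_of_pos ht0, div_le_iff₀ ht0]
    refine (hcount t ht).trans_eq ?_
    rw [mul_assoc]; nth_rewrite 3 [← Real.rpow_one t]
    rw [← Real.rpow_add ht0]; congr 2; ring
  have hmeas : Measurable R :=
    (𝒮.measurable_count.sub (measurable_const.mul measurable_id)).div measurable_id
  refine ⟨C * (2 / δ) + C / (1 - δ) + |κ|, fun x hx => ?_⟩
  have hx0 : 0 < x := by linarith
  have hpint : MeasureTheory.IntegrableOn (fun t : ℝ => C * t ^ (-δ)) (Set.Ioc 1 x) := by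
    refine (ContinuousOn.integrableOn_Icc ?_).mono_set Set.Ioc_subset_Icc_self
    refine ContinuousOn.mul continuousOn_const (ContinuousOn.rpow_const continuousOn_id ?_)
    intro t ht; have := ht.1; left; positivity
  have hRint : MeasureTheory.IntegrableOn R (Set.Ioc 1 x) := by
    refine MeasureTheory.Integrable.mono' hpint hmeas.aestronglyMeasurable ?_
    refine (MeasureTheory.ae_restrict_iff' measurableSet_Ioc).2 (Filter.Eventually.of_forall ?_)
    intro t ht
    exact hRb t ht.1.le
  have h1 := 𝒮.sum_eq_sub_integral Real.log (fun t => t⁻¹) hx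
    (fun t ht => Real.hasDerivAt_log (by linarith [ht.1]))
    (by refine ContinuousOn.inv₀ continuousOn_id ?_
        intro t ht; have := ht.1; positivity)
  rw [h1]
  have h2 : ∫ t in Set.Ioc 1 x, t⁻¹ * 𝒮.count t = (∫ t in Set.Ioc 1 x, R t) + κ * (x - 1) := by
    have : ∫ t in Set.Ioc 1 x, κ = κ * (x - 1) := by
      rw [← intervalIntegral.integral_of_le hx, intervalIntegral.integral_const, smul_eq_mul,
        mul_comm]
    rw [← this, ← MeasureTheory.integral_add hRint (by simp)]
    refine MeasureTheory.setIntegral_congr_fun measurableSet_Ioc fun t ht => ?_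
    have : t ≠ 0 := by have := ht.1; positivity
    simp only [hR]; field_simp; ring
  have hxp : x ^ (1 - δ) ≤ x ^ (1 - δ / 2) := Real.rpow_le_rpow_of_exponent_le hx (by linarith)
  have h4 : |∫ t in Set.Ioc 1 x, R t| ≤ C / (1 - δ) * x ^ (1 - δ / 2) := by
    have h5 : ∫ t in Set.Ioc 1 x, C * t ^ (-δ) ≤ C / (1 - δ) * x ^ (1 - δ / 2) := by
      rw [MeasureTheory.integral_const_mul, ← intervalIntegral.integral_of_le hx,
        integral_rpow (Or.inl (by linarith))]
      have : -δ + 1 = 1 - δ := by ring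
      rw [this, Real.one_rpow, div_mul_eq_mul_div, mul_div_assoc]
      have : 0 < 1 - δ := by linarith
      gcongr
      linarith
    rw [← Real.norm_eq_abs]
    refine le_trans (MeasureTheory.norm_integral_le_of_norm_le hpint ?_) h5
    refine (MeasureTheory.ae_restrict_iff' measurableSet_Ioc).2 (Filter.Eventually.of_forall ?_)
    intro t ht
    exact hRb t ht.1.le
  have h5 : |Real.log x * (𝒮.count x - κ * x)| ≤ C * (2 / δ) * x ^ (1 - δ / 2) := by
    have hl : Real.log x ≤ x ^ (δ / 2) / (δ / 2) := Real.log_le_rpow_div hx0.le (by positivity)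
    rw [abs_mul, abs_of_nonneg (Real.log_nonneg hx)]
    calc Real.log x * |𝒮.count x - κ * x| ≤ x ^ (δ / 2) / (δ / 2) * (C * x ^ (1 - δ)) := by
          gcongr; exact hcount x hx
      _ = C * (2 / δ) * (x ^ (δ / 2) * x ^ (1 - δ)) := by field_simp
      _ = _ := by rw [← Real.rpow_add hx0]; congr 2; ring
  have h6 : |κ| ≤ |κ| * x ^ (1 - δ / 2) :=
    le_mul_of_one_le_right (abs_nonneg _) (Real.one_le_rpow hx (by linarith))
  rw [h2]
  have e : Real.log x * 𝒮.count x - ((∫ t in Set.Ioc 1 x, R t) + κ * (x - 1)) -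
      (κ * x * Real.log x - κ * x) =
      Real.log x * (𝒮.count x - κ * x) - (∫ t in Set.Ioc 1 x, R t) + κ := by ring
  rw [e, add_mul, add_mul]
  refine (abs_add_le _ _).trans (add_le_add ((abs_sub _ _).trans (add_le_add h5 h4)) h6)

end ArithSemigroup

namespace ArithSemigroup

open Finset

variable {M : Type*} [AddCommMonoid M] (𝒮 : ArithSemigroup M)
variable {κ δ C : ℝ}

lemma act_one_one (x : ℝ) : 𝒮.act 1 1 x = 𝒮.count x := by simp [act, count]

lemma sum_one_le (hδ : 0 < δ) (hC : 0 ≤ C)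
    (hcount : ∀ x, 1 ≤ x → |𝒮.count x - κ * x| ≤ C * x ^ (1 - δ)) {x : ℝ} (hx : 1 ≤ x) :
    𝒮.count x ≤ (|κ| + C) * x := by
  have h := (abs_le.1 (hcount x hx)).2
  have h2 : x ^ (1 - δ) ≤ x := by
    calc x ^ (1 - δ) ≤ x ^ (1:ℝ) := Real.rpow_le_rpow_of_exponent_le hx (by linarith)
      _ = x := Real.rpow_one x
  have h3 : κ * x ≤ |κ| * x := by gcongr; exact le_abs_self κ
  nlinarith

section

set_option linter.unusedSectionVars false

variable [DecidableEq M] [HasAntidiagonal M] (μ Λ : M → ℝ)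
  (hμ : ∀ f, ∑ q ∈ HasAntidiagonal.antidiagonal f, μ q.1 = if f = 0 then 1 else 0)
  (hμ1 : ∀ f, |μ f| ≤ 1)
  (hΛ0 : ∀ f, 0 ≤ Λ f)
  (hΛ : ∀ f, ∑ q ∈ HasAntidiagonal.antidiagonal f, Λ q.1 = Real.log (𝒮.norm f))

include hμ in
lemma act_mu_act_one (F : ℝ → ℝ) {x : ℝ} (hx : 1 ≤ x) : 𝒮.act μ (𝒮.act 1 F) x = F x := by
  rw [act_act]
  simp only [Pi.one_apply, mul_one, hμ]
  exact 𝒮.act_eq_self F hx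

include hΛ in
lemma act_Lambda_act_one (F : ℝ → ℝ) (x : ℝ) :
    𝒮.act Λ (𝒮.act 1 F) x = 𝒮.act (fun f => Real.log (𝒮.norm f)) F x := by
  rw [act_act]
  simp only [Pi.one_apply, mul_one, hΛ]

include hΛ in
lemma act_one_act_Lambda (F : ℝ → ℝ) (x : ℝ) :
    𝒮.act 1 (𝒮.act Λ F) x = 𝒮.act (fun f => Real.log (𝒮.norm f)) F x := by
  rw [act_act]
  congr 1
  funext f
  rw [← hΛ f]
  refine sum_nbij' Prod.swap Prod.swap ?_ ?_ ?_ ?_ ?_ <;> simp [HasAntidiagonal.mem_antidiagonal, add_comm]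

include hμ1 in
lemma abs_le_of_act_one (hδ : 0 < δ) (hC : 0 ≤ C)
    (hcount : ∀ x, 1 ≤ x → |𝒮.count x - κ * x| ≤ C * x ^ (1 - δ))
    (w F : ℝ → ℝ) {s B : ℝ} (hs : s < 1) (hs0 : 0 ≤ s) (hB : 0 ≤ B)
    (hw : ∀ x, 1 ≤ x → |w x * 𝒮.act 1 F x| ≤ B * x ^ s) :
    ∃ B', ∀ x, 1 ≤ x → |𝒮.act μ (fun y => w y * 𝒮.act 1 F y) x| ≤ B' * x := by
  obtain ⟨B', hB', h⟩ := 𝒮.act_rpow_le 1 (fun _ => by simp) (by positivity : 0 ≤ |κ| + C) hs hs0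
    (fun x hx => by simpa [count] using 𝒮.sum_one_le hδ hC hcount hx)
  refine ⟨B * B', fun x hx => ?_⟩
  refine (𝒮.abs_act_le _ _ x).trans ?_
  refine (𝒮.act_le_act (b := 1) (G := fun y => B * y ^ s) (fun _ => by simp)
    (fun f => hμ1 f) (fun _ _ => abs_nonneg _) hw x).trans ?_
  rw [act_const_mul, mul_assoc]
  exact mul_le_mul_of_nonneg_left (h x hx) hB

/-- The Chebyshev function. -/
noncomputable def psi (x : ℝ) : ℝ := ∑ f ∈ 𝒮.ball x, Λ f

lemma act_Lambda_one (x : ℝ) : 𝒮.act Λ 1 x = 𝒮.psi Λ x := by simp [act, psi]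

include hμ hμ1 hΛ0 hΛ in
/-- Chebyshev and Mertens estimates, and the upper bound coming from Selberg's formula. -/
theorem psi_bounds (hκ : 0 < κ) (hδ : 0 < δ) (hδ1 : δ < 1) (hC : 0 ≤ C)
    (hcount : ∀ x, 1 ≤ x → |𝒮.count x - κ * x| ≤ C * x ^ (1 - δ)) :
    (∃ B, ∀ x, 1 ≤ x → |∑ f ∈ 𝒮.ball x, Λ f / 𝒮.norm f - Real.log x| ≤ B) ∧
    (∃ B, ∀ x, 1 ≤ x → 𝒮.psi Λ x * Real.log x ≤ 2 * x * Real.log x + B * x) := by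
  obtain ⟨c, C₁, h₁⟩ := 𝒮.sum_inv_norm hδ hcount
  obtain ⟨C₂, h₂⟩ := 𝒮.sum_log_norm hδ hδ1 hC hcount
  set D : ℝ := -1 - c / κ with hD
  set F : ℝ → ℝ := fun x => 𝒮.psi Λ x - x - D with hF
  -- the transform of `F` is small
  have hG : ∀ x, 𝒮.act 1 F x = ∑ f ∈ 𝒮.ball x, Real.log (𝒮.norm f)
      - x * ∑ f ∈ 𝒮.ball x, (𝒮.norm f : ℝ)⁻¹ - D * 𝒮.count x := by
    intro x
    have e1 : 𝒮.act 1 (𝒮.psi Λ) x = ∑ f ∈ 𝒮.ball x, Real.log (𝒮.norm f) := by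
      have : 𝒮.psi Λ = 𝒮.act Λ 1 := funext fun x => (𝒮.act_Lambda_one Λ x).symm
      rw [this, 𝒮.act_one_act_Lambda Λ hΛ]; simp [act]
    have e2 : 𝒮.act 1 (fun x => x) x = x * ∑ f ∈ 𝒮.ball x, (𝒮.norm f : ℝ)⁻¹ := by
      simp [act, mul_sum, div_eq_mul_inv]
    have e3 : 𝒮.act 1 (fun _ => D) x = D * 𝒮.count x := by simp [act, count, mul_comm]
    rw [hF]
    rw [𝒮.act_sub_right 1 (fun x => 𝒮.psi Λ x - x) (fun _ => D),
      𝒮.act_sub_right 1 (fun x => 𝒮.psi Λ x) (fun x => x), e1, e2, e3]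
  set C₃ : ℝ := |C₂| + |C₁| + |D| * C with hC₃
  have hC₃0 : 0 ≤ C₃ := by positivity
  have hGs : ∀ x, 1 ≤ x → |𝒮.act 1 F x| ≤ C₃ * x ^ (1 - δ / 2) := by
    intro x hx
    have hx0 : 0 < x := by linarith
    have hp : x ^ (1 - δ) ≤ x ^ (1 - δ / 2) := Real.rpow_le_rpow_of_exponent_le hx (by linarith)
    have hp0 : 0 < x ^ (1 - δ / 2) := by positivity
    have a2 := h₂ x hx
    have a1 : |x * ∑ f ∈ 𝒮.ball x, (𝒮.norm f : ℝ)⁻¹ - x * (κ * Real.log x + c)| ≤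
        |C₁| * x ^ (1 - δ / 2) := by
      rw [← mul_sub, abs_mul, abs_of_pos hx0]
      calc x * _ ≤ x * (|C₁| * x ^ (-δ)) := by
            gcongr; exact (h₁ x hx).trans (by gcongr; exact le_abs_self _)
        _ = |C₁| * x ^ (1 - δ) := by
            rw [mul_left_comm]; nth_rewrite 1 [← Real.rpow_one x]
            rw [← Real.rpow_add hx0]; congr 2
        _ ≤ _ := by gcongr
    have a3 : |D * 𝒮.count x - D * (κ * x)| ≤ |D| * C * x ^ (1 - δ / 2) := by
      rw [← mul_sub, abs_mul, mul_assoc]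
      gcongr
      exact (hcount x hx).trans (by gcongr)
    have a2' : C₂ * x ^ (1 - δ / 2) ≤ |C₂| * x ^ (1 - δ / 2) := by
      gcongr; exact le_abs_self _
    have hmain : κ * x * Real.log x - κ * x - x * (κ * Real.log x + c) - D * (κ * x) = 0 := by
      rw [hD]; field_simp; ring
    rw [hG, hC₃, add_mul, add_mul]
    rw [abs_le] at a1 a2 a3 ⊢
    constructor <;> linarith [a1.1, a1.2, a2.1, a2.2, a3.1, a3.2]
  -- Chebyshev
  obtain ⟨B₁, hB₁⟩ := 𝒮.abs_le_of_act_one μ hμ1 hδ hC hcount (fun _ => 1) F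
    (by linarith : 1 - δ / 2 < 1) (by linarith) hC₃0 (by simpa using hGs)
  have hF1 : ∀ x, 1 ≤ x → |F x| ≤ B₁ * x := by
    intro x hx
    have := hB₁ x hx
    simp only [one_mul] at this
    rwa [𝒮.act_mu_act_one μ hμ F hx] at this
  set B₂ : ℝ := |B₁| + 1 + |D| with hB₂
  have hpsi : ∀ x, 1 ≤ x → 𝒮.psi Λ x ≤ B₂ * x := by
    intro x hx
    have h := (abs_le.1 (hF1 x hx)).2
    have e1 : B₁ * x ≤ |B₁| * x := by gcongr; exact le_abs_self _
    have e2 : D ≤ |D| * x := (le_abs_self D).trans (le_mul_of_one_le_right (abs_nonneg _) hx)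
    simp only [hF] at h
    rw [hB₂]; linarith
  -- Mertens
  have hMert : ∃ B, ∀ x, 1 ≤ x → |∑ f ∈ 𝒮.ball x, Λ f / 𝒮.norm f - Real.log x| ≤ B := by
    obtain ⟨B₃, hB₃0, hB₃⟩ := 𝒮.act_rpow_le Λ hΛ0 (by positivity : 0 ≤ B₂)
      (by linarith : 1 - δ < 1) (by linarith) hpsi
    refine ⟨(|C₂| + κ + C * B₃) / κ, fun x hx => ?_⟩
    have hx0 : 0 < x := by linarith
    have e0 : 𝒮.act Λ 𝒮.count x = ∑ f ∈ 𝒮.ball x, Real.log (𝒮.norm f) := by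
      have : 𝒮.count = 𝒮.act 1 1 := funext fun x => (𝒮.act_one_one x).symm
      rw [this, 𝒮.act_Lambda_act_one Λ hΛ]; simp [act]
    have e1 : 𝒮.act Λ (fun y => κ * y) x = κ * x * ∑ f ∈ 𝒮.ball x, Λ f / 𝒮.norm f := by
      simp only [act, mul_sum]
      exact sum_congr rfl fun f _ => by ring
    have e2 : |𝒮.act Λ (fun y => 𝒮.count y - κ * y) x| ≤ C * B₃ * x := by
      refine (𝒮.abs_act_le _ _ x).trans ?_
      refine (𝒮.act_le_act (b := Λ) (G := fun y => C * y ^ (1 - δ)) hΛ0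
        (fun f => (abs_of_nonneg (hΛ0 f)).le) (fun _ _ => abs_nonneg _) hcount x).trans ?_
      rw [act_const_mul, mul_assoc]
      exact mul_le_mul_of_nonneg_left (hB₃ x hx) hC
    rw [𝒮.act_sub_right Λ 𝒮.count (fun y => κ * y), e0, e1] at e2
    have e3 : |∑ f ∈ 𝒮.ball x, Real.log (𝒮.norm f) - (κ * x * Real.log x - κ * x)| ≤ |C₂| * x := by
      refine (h₂ x hx).trans ?_
      refine mul_le_mul (le_abs_self _) ?_ (by positivity) (abs_nonneg _)
      calc x ^ (1 - δ / 2) ≤ x ^ (1:ℝ) := Real.rpow_le_rpow_of_exponent_le hx (by linarith)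
        _ = x := Real.rpow_one x
    have e4 : |κ * x * (∑ f ∈ 𝒮.ball x, Λ f / 𝒮.norm f - Real.log x)| ≤
        (|C₂| + κ + C * B₃) * x := by
      have : 0 ≤ κ * x := by positivity
      rw [abs_le] at e2 e3 ⊢
      constructor <;> nlinarith [e2.1, e2.2, e3.1, e3.2]
    rw [abs_mul, abs_of_pos (by positivity)] at e4
    rw [le_div_iff₀ hκ]
    refine le_of_mul_le_mul_left (a := x) ?_ hx0
    linarith
  refine ⟨hMert, ?_⟩
  obtain ⟨B₃, hB₃⟩ := hMert
  -- Selberg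
  have hw : ∀ x, 1 ≤ x → |Real.log x * 𝒮.act 1 F x| ≤ (4 / δ * C₃) * x ^ (1 - δ / 4) := by
    intro x hx
    have hx0 : 0 < x := by linarith
    have hl : Real.log x ≤ x ^ (δ / 4) / (δ / 4) := Real.log_le_rpow_div hx0.le (by positivity)
    rw [abs_mul, abs_of_nonneg (Real.log_nonneg hx)]
    calc Real.log x * |𝒮.act 1 F x| ≤ x ^ (δ / 4) / (δ / 4) * (C₃ * x ^ (1 - δ / 2)) := by
          gcongr; exact hGs x hx
      _ = 4 / δ * C₃ * (x ^ (δ / 4) * x ^ (1 - δ / 2)) := by field_simp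
      _ = _ := by rw [← Real.rpow_add hx0]; congr 2; ring
  obtain ⟨B₄, hB₄⟩ := 𝒮.abs_le_of_act_one μ hμ1 hδ hC hcount Real.log F
    (by linarith : 1 - δ / 4 < 1) (by linarith) (by positivity) hw
  refine ⟨|D| * B₂ + |B₃| + |D| + B₄, fun x hx => ?_⟩
  have hx0 : 0 < x := by linarith
  have hsel : 𝒮.act μ (fun y => Real.log y * 𝒮.act 1 F y) x =
      Real.log x * F x + 𝒮.act Λ F x := by
    have e1 : ∀ y, 1 ≤ y → Real.log y * 𝒮.act 1 F y =
        𝒮.act 1 (fun z => Real.log z * F z + 𝒮.act Λ F z) y := by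
      intro y hy
      rw [𝒮.act_add_right 1 (fun z => Real.log z * F z) (𝒮.act Λ F),
        𝒮.act_one_act_Lambda Λ hΛ]
      simp only [act, mul_sum, Pi.one_apply, one_mul]
      rw [← sum_add_distrib]
      refine sum_congr rfl fun f _ => ?_
      have : Real.log (y / 𝒮.norm f) = Real.log y - Real.log (𝒮.norm f) :=
        Real.log_div (by linarith) (𝒮.norm_pos' f).ne'
      rw [this]; ring
    rw [𝒮.act_congr e1, 𝒮.act_mu_act_one μ hμ _ hx]
  have hs := (abs_le.1 (hB₄ x hx)).2
  rw [hsel] at hs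
  have hact : 𝒮.act Λ F x = 𝒮.act Λ (𝒮.psi Λ) x - x * ∑ f ∈ 𝒮.ball x, Λ f / 𝒮.norm f
      - D * 𝒮.psi Λ x := by
    rw [hF, 𝒮.act_sub_right Λ (fun x => 𝒮.psi Λ x - x) (fun _ => D),
      𝒮.act_sub_right Λ (fun x => 𝒮.psi Λ x) (fun x => x)]
    congr 1
    · congr 1
      simp only [act, mul_sum]; exact sum_congr rfl fun f _ => by ring
    · simp only [act, psi, mul_sum]; exact sum_congr rfl fun f _ => by ring
  have hpsi0 : ∀ y, 0 ≤ 𝒮.psi Λ y := fun y => sum_nonneg fun f _ => hΛ0 f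
  have hpp : 0 ≤ 𝒮.act Λ (𝒮.psi Λ) x :=
    sum_nonneg fun f _ => mul_nonneg (hΛ0 f) (hpsi0 _)
  have hm : x * ∑ f ∈ 𝒮.ball x, Λ f / 𝒮.norm f ≤ x * (Real.log x + |B₃|) := by
    gcongr
    have := (abs_le.1 (hB₃ x hx)).2
    linarith [le_abs_self B₃]
  have hd : D * 𝒮.psi Λ x ≤ |D| * (B₂ * x) := by
    calc D * 𝒮.psi Λ x ≤ |D| * 𝒮.psi Λ x := by
          gcongr
          · exact hpsi0 x
          · exact le_abs_self D
      _ ≤ _ := by gcongr; exact hpsi x hx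
  have hlog : D * Real.log x ≤ |D| * x := by
    have : Real.log x ≤ x := Real.log_le_self hx0.le
    calc D * Real.log x ≤ |D| * Real.log x := by
          gcongr
          · exact Real.log_nonneg hx
          · exact le_abs_self D
      _ ≤ _ := by gcongr
  rw [hact] at hs
  simp only [hF] at hs
  nlinarith

end

end ArithSemigroup

namespace ArithSemigroup

open Finset

variable {P : Type*}

/-- The Möbius function of the free commutative monoid. -/
def freeMu (f : P →₀ ℕ) : ℝ := if ∀ p ∈ f.support, f p = 1 then (-1) ^ #f.support else 0

/-- The von Mangoldt function of the free commutative monoid on a set of primes of norm `N`. -/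
noncomputable def freeLambda (N : P → ℕ) (f : P →₀ ℕ) : ℝ :=
  if #f.support = 1 then ∑ p ∈ f.support, Real.log (N p) else 0

lemma abs_freeMu_le (f : P →₀ ℕ) : |freeMu f| ≤ 1 := by
  unfold freeMu; split_ifs <;> simp

lemma freeLambda_nonneg (N : P → ℕ) (f : P →₀ ℕ) : 0 ≤ freeLambda N f := by
  unfold freeLambda; split_ifs
  · exact sum_nonneg fun p _ => Real.log_natCast_nonneg _
  · exact le_rfl

lemma freeLambda_single (N : P → ℕ) (p : P) {k : ℕ} (hk : k ≠ 0) :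
    freeLambda N (Finsupp.single p k) = Real.log (N p) := by
  simp [freeLambda, Finsupp.support_single, hk]

lemma exists_single_of_freeLambda_ne_zero {N : P → ℕ} {f : P →₀ ℕ} (h : freeLambda N f ≠ 0) :
    ∃ p k, k ≠ 0 ∧ f = Finsupp.single p k := by
  unfold freeLambda at h
  split_ifs at h with h1
  · obtain ⟨p, hp, hf⟩ := Finsupp.card_support_eq_one.1 h1
    exact ⟨p, f p, hp, hf⟩
  · exact absurd rfl h

lemma sum_freeMu [DecidableEq P] (f : P →₀ ℕ) :
    ∑ q ∈ HasAntidiagonal.antidiagonal f, freeMu q.1 = if f = 0 then 1 else 0 := by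
  have h1 := sum_powerset_neg_one_pow_card (x := f.support)
  have h2 : (if f = 0 then (1:ℝ) else 0) = ((if f.support = ∅ then 1 else 0 : ℤ) : ℝ) := by
    simp [Finsupp.support_eq_empty]
  rw [h2, ← h1]
  push_cast
  symm
  set e : Finset P → (P →₀ ℕ) := fun s => Finsupp.indicator s (fun _ _ => 1) with he
  have hes : ∀ s, (e s).support = s := by
    intro s; ext p; simp [he, Finsupp.indicator_apply]
  have he1 : ∀ s p, e s p = if p ∈ s then 1 else 0 := by
    intro s p; simp [he, Finsupp.indicator_apply]
  have hle : ∀ s ∈ f.support.powerset, e s ≤ f := by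
    intro s hs p
    rw [he1]; split_ifs with hp
    · have := Finsupp.mem_support_iff.1 (mem_powerset.1 hs hp); omega
    · exact Nat.zero_le _
  refine sum_of_injOn (fun s => (e s, f - e s)) ?_ ?_ ?_ ?_
  · intro s _ t _ hst
    simp only [Prod.mk.injEq] at hst
    rw [← hes s, hst.1, hes]
  · intro s hs
    simp only [Finset.mem_coe, HasAntidiagonal.mem_antidiagonal]
    exact add_tsub_cancel_of_le (hle s hs)
  · rintro ⟨g, h⟩ hgh hn
    rw [HasAntidiagonal.mem_antidiagonal] at hgh
    by_contra hne
    apply hn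
    have hg : ∀ p ∈ g.support, g p = 1 := by
      by_contra hg; exact hne (if_neg hg)
    have hgs : e g.support = g := by
      ext p; rw [he1]; split_ifs with hp
      · exact (hg p hp).symm
      · exact (Finsupp.notMem_support_iff.1 hp).symm
    have hgh' : g + h = f := hgh
    refine ⟨g.support, ?_, ?_⟩
    · simp only [coe_powerset, Set.mem_preimage, Set.mem_powerset_iff, Finset.coe_subset]
      intro p hp
      rw [Finsupp.mem_support_iff] at hp ⊢
      rw [← hgh', Finsupp.add_apply]; omega
    · simp only [hgs, ← hgh', add_tsub_cancel_left]
  · intro s _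
    simp only [freeMu, hes]
    rw [if_pos]
    intro p hp; rw [he1, if_pos hp]

/-- The norm on the free commutative monoid. -/
def freeNorm (N : P → ℕ) (f : P →₀ ℕ) : ℕ := f.prod fun p k => N p ^ k

lemma log_freeNorm {N : P → ℕ} (hN : ∀ p, 2 ≤ N p) (f : P →₀ ℕ) :
    Real.log (freeNorm N f) = ∑ p ∈ f.support, f p * Real.log (N p) := by
  unfold freeNorm Finsupp.prod
  push_cast
  rw [Real.log_prod]
  · exact sum_congr rfl fun p _ => Real.log_pow _ _
  · intro p _; have := hN p; positivity

lemma sum_freeLambda [DecidableEq P] {N : P → ℕ} (hN : ∀ p, 2 ≤ N p) (f : P →₀ ℕ) :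
    ∑ q ∈ HasAntidiagonal.antidiagonal f, freeLambda N q.1 = Real.log (freeNorm N f) := by
  rw [log_freeNorm hN]
  have : ∑ p ∈ f.support, f p * Real.log (N p) =
      ∑ q ∈ f.support.sigma (fun p => Icc 1 (f p)), Real.log (N q.1) := by
    rw [sum_sigma]; simp
  rw [this]
  symm
  refine sum_of_injOn (fun q => (Finsupp.single q.1 q.2, f - Finsupp.single q.1 q.2)) ?_ ?_ ?_ ?_
  · rintro ⟨p, k⟩ h1 ⟨p', k'⟩ h2 h
    simp only [Finset.mem_coe, mem_sigma, mem_Icc] at h1 h2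
    simp only [Prod.mk.injEq] at h
    rcases (Finsupp.single_eq_single_iff _ _ _ _).1 h.1 with ⟨rfl, rfl⟩ | ⟨h3, _⟩
    · rfl
    · omega
  · rintro ⟨p, k⟩ h1
    simp only [Finset.mem_coe, mem_sigma, mem_Icc] at h1
    simp only [Finset.mem_coe, HasAntidiagonal.mem_antidiagonal]
    exact add_tsub_cancel_of_le (Finsupp.single_le_iff.2 h1.2.2)
  · rintro ⟨g, h⟩ hgh hn
    rw [HasAntidiagonal.mem_antidiagonal] at hgh
    by_contra hne
    apply hn
    obtain ⟨p, k, hk, hg⟩ := exists_single_of_freeLambda_ne_zero hne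
    simp only at hg hgh
    have hfp : k ≤ f p := by
      have h2 : g p + h p = f p := by rw [← hgh]; rfl
      rw [hg, Finsupp.single_eq_same] at h2; omega
    refine ⟨⟨p, k⟩, ?_, ?_⟩
    · simp only [Finset.mem_coe, mem_sigma, mem_Icc, Finsupp.mem_support_iff]
      exact ⟨by omega, by omega, hfp⟩
    · simp only [← hg, ← hgh, add_tsub_cancel_left]
  · rintro ⟨p, k⟩ h1
    simp only [mem_sigma, mem_Icc] at h1
    have hk : k ≠ 0 := by omega
    exact (freeLambda_single N p hk).symm

/-- The arithmetical semigroup of the free commutative monoid on `P`. -/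
def free (N : P → ℕ) (hN : ∀ p, 2 ≤ N p)
    (hfin : ∀ x : ℝ, {f : P →₀ ℕ | (freeNorm N f : ℝ) ≤ x}.Finite) :
    ArithSemigroup (P →₀ ℕ) where
  norm := freeNorm N
  norm_pos f := Finset.prod_pos fun p _ => pow_pos (by have := hN p; omega) _
  norm_zero := Finsupp.prod_zero_index
  norm_add f g := Finsupp.prod_add_index' (fun _ => pow_zero _) fun _ _ _ => pow_add _ _ _
  finite_le := hfin

lemma freeNorm_single (N : P → ℕ) (p : P) (k : ℕ) : freeNorm N (Finsupp.single p k) = N p ^ k := by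
  simp [freeNorm]

lemma finite_primes {N : P → ℕ}
    (hfin : ∀ x : ℝ, {f : P →₀ ℕ | (freeNorm N f : ℝ) ≤ x}.Finite) (x : ℝ) :
    {p | (N p : ℝ) ≤ x}.Finite := by
  refine Set.Finite.of_injOn (f := fun p => Finsupp.single p 1) ?_ ?_ (hfin x)
  · intro p hp; simpa [freeNorm_single] using hp
  · intro p _ q _ h
    exact (Finsupp.single_left_inj one_ne_zero).1 h

/-- Chebyshev bounds for the primes of an arithmetical semigroup, with an absolute constant in
the upper bound. -/
theorem prime_bounds (N : P → ℕ) (hN : ∀ p, 2 ≤ N p)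
    (hfin : ∀ x : ℝ, {f : P →₀ ℕ | (freeNorm N f : ℝ) ≤ x}.Finite) {κ δ C : ℝ}
    (hκ : 0 < κ) (hδ : 0 < δ) (hδ1 : δ < 1) (hC : 0 ≤ C)
    (hcount : ∀ x, 1 ≤ x →
      |({f : P →₀ ℕ | (freeNorm N f : ℝ) ≤ x}.ncard : ℝ) - κ * x| ≤ C * x ^ (1 - δ)) :
    (∃ c > 0, ∀ᶠ x : ℝ in Filter.atTop, c * x ≤ {p | (N p : ℝ) ≤ x}.ncard * Real.log x) ∧
    ∀ᶠ x : ℝ in Filter.atTop, {p | (N p : ℝ) ≤ x}.ncard * Real.log x ≤ 7 * x := by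
  classical
  set 𝒮 := free N hN hfin with h𝒮
  have hcnt : ∀ x, 𝒮.count x = ({f : P →₀ ℕ | (freeNorm N f : ℝ) ≤ x}.ncard : ℝ) := by
    intro x; rw [count, ball, Set.ncard_eq_toFinset_card _ (hfin x)]; rfl
  have hcount' : ∀ x, 1 ≤ x → |𝒮.count x - κ * x| ≤ C * x ^ (1 - δ) := by
    intro x hx; rw [hcnt]; exact hcount x hx
  set Λ := freeLambda N with hΛdef
  obtain ⟨⟨B₁, hB₁⟩, ⟨B₂, hB₂⟩⟩ := 𝒮.psi_bounds freeMu Λ sum_freeMu abs_freeMu_le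
    (freeLambda_nonneg N) (sum_freeLambda hN) hκ hδ hδ1 hC hcount'
  set Pr : ℝ → Finset P := fun x => (finite_primes hfin x).toFinset with hPr
  have hPrm : ∀ x p, p ∈ Pr x ↔ (N p : ℝ) ≤ x := by intro x p; simp [hPr]
  have hPrc : ∀ x, ({p | (N p : ℝ) ≤ x}.ncard : ℝ) = #(Pr x) := by
    intro x; rw [Set.ncard_eq_toFinset_card _ (finite_primes hfin x)]
  have hN1 : ∀ p, (1:ℝ) < N p := fun p => by exact_mod_cast hN p
  simp only [hPrc]
  constructor
  · -- lower bound
    set A := Real.exp (2 * B₁ + 1) with hA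
    have hB₁0 : 0 ≤ B₁ := (abs_nonneg _).trans (hB₁ 1 le_rfl)
    have hA1 : 1 ≤ A := Real.one_le_exp (by positivity)
    refine ⟨A⁻¹, by positivity, ?_⟩
    filter_upwards [Filter.eventually_ge_atTop A] with x hx
    have hx1 : 1 ≤ x := hA1.trans hx
    have hx0 : 0 < x := by linarith
    have hpsi : 𝒮.psi Λ x ≤ #(Pr x) * Real.log x := by
      have hsub : ∑ f ∈ 𝒮.ball x, Λ f ≤
          ∑ q ∈ (Pr x).sigma (fun p => Icc 1 (Nat.log (N p) ⌊x⌋₊)), Real.log (N q.1) := by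
        rw [← sum_filter_ne_zero]
        set T := (Pr x).sigma (fun p => Icc 1 (Nat.log (N p) ⌊x⌋₊)) with hT
        have himg : {f ∈ 𝒮.ball x | Λ f ≠ 0} ⊆ image (fun q => Finsupp.single q.1 q.2) T := by
          intro f hf
          rw [mem_filter, mem_ball] at hf
          obtain ⟨p, k, hk, rfl⟩ := exists_single_of_freeLambda_ne_zero hf.2
          have h1 : ((N p ^ k : ℕ) : ℝ) ≤ x := by
            have := hf.1; simp only [h𝒮, free, freeNorm_single] at this; exact this
          refine mem_image.2 ⟨⟨p, k⟩, ?_, rfl⟩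
          simp only [hT, mem_sigma, hPrm, mem_Icc]
          refine ⟨?_, by omega, ?_⟩
          · refine le_trans ?_ h1
            push_cast
            exact le_self_pow₀ (hN1 p).le hk
          · exact Nat.le_log_of_pow_le (hN p) ((Nat.le_floor_iff hx0.le).2 h1)
        refine (sum_le_sum_of_subset_of_nonneg himg fun f _ _ => freeLambda_nonneg N f).trans_eq ?_
        rw [sum_image]
        · refine sum_congr rfl fun q hq => freeLambda_single N _ ?_
          simp only [hT, mem_sigma, mem_Icc] at hq; omega
        · rintro ⟨p, k⟩ h1 ⟨p', k'⟩ h2 h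
          simp only [hT, Finset.mem_coe, mem_sigma, mem_Icc] at h1 h2
          rcases (Finsupp.single_eq_single_iff _ _ _ _).1 h with ⟨h3, h4⟩ | ⟨h3, _⟩
          · simp only at h3 h4; subst h3 h4; rfl
          · simp only at h3; omega
      refine hsub.trans ?_
      rw [sum_sigma, ← nsmul_eq_mul]
      refine sum_le_card_nsmul _ _ _ fun p hp => ?_
      simp only [sum_const, Nat.card_Icc, add_tsub_cancel_right, nsmul_eq_mul]
      rw [← Real.log_pow]
      refine Real.log_le_log (by have := hN1 p; positivity) ?_
      have h1 : N p ^ Nat.log (N p) ⌊x⌋₊ ≤ ⌊x⌋₊ :=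
        Nat.pow_log_le_self _ (by have := Nat.one_le_floor_iff x |>.2 hx1; omega)
      exact (by exact_mod_cast h1 : (N p : ℝ) ^ _ ≤ ⌊x⌋₊).trans (Nat.floor_le hx0.le)
    refine le_trans ?_ hpsi
    have hm1 := (abs_le.1 (hB₁ x hx1)).1
    have hxA : 1 ≤ x / A := by rw [le_div_iff₀ (by positivity)]; linarith
    have hm2 := (abs_le.1 (hB₁ (x / A) hxA)).2
    rw [Real.log_div (by positivity) (by positivity), hA, Real.log_exp, ← hA] at hm2
    have hsub : 𝒮.ball (x / A) ⊆ 𝒮.ball x := 𝒮.ball_mono (div_le_self hx0.le hA1)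
    have hsd := sum_sdiff (f := fun f => Λ f / 𝒮.norm f) hsub
    have hb : ∑ f ∈ 𝒮.ball x \ 𝒮.ball (x / A), Λ f / 𝒮.norm f ≤ A / x * 𝒮.psi Λ x := by
      rw [psi, mul_sum]
      refine (sum_le_sum (g := fun f => A / x * Λ f) fun f hf => ?_).trans
        (sum_le_sum_of_subset_of_nonneg sdiff_subset fun f _ _ =>
          mul_nonneg (by positivity) (freeLambda_nonneg N f))
      rw [mem_sdiff, mem_ball, mem_ball, not_le] at hf
      rw [div_eq_inv_mul]
      refine mul_le_mul_of_nonneg_right ?_ (freeLambda_nonneg N f)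
      rw [inv_le_comm₀ (𝒮.norm_pos' f) (by positivity), inv_div]
      exact hf.2.le
    have : 1 ≤ A / x * 𝒮.psi Λ x := by linarith
    rw [div_mul_eq_mul_div, le_div_iff₀ hx0] at this
    rw [inv_mul_le_iff₀ (by positivity)]; linarith
  · -- upper bound
    set B₃ := |κ| + C with hB₃
    have h1 : ∀ᶠ x : ℝ in Filter.atTop, B₂ ≤ (1/4) * Real.log x := by
      have := Real.tendsto_log_atTop.const_mul_atTop (by norm_num : (0:ℝ) < 1/4)
      exact this.eventually_ge_atTop _
    have h2 : ∀ᶠ x : ℝ in Filter.atTop, B₃ * 4 * x ^ (3/4:ℝ) ≤ x := by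
      have h3 := (tendsto_rpow_atTop (by norm_num : (0:ℝ) < 1/4)).eventually_ge_atTop (B₃ * 4)
      filter_upwards [h3, Filter.eventually_ge_atTop 1] with x hx hx1
      calc B₃ * 4 * x ^ (3/4:ℝ) ≤ x ^ (1/4:ℝ) * x ^ (3/4:ℝ) := by gcongr
        _ = x := by rw [← Real.rpow_add (by linarith)]; norm_num
    filter_upwards [h1, h2, Filter.eventually_ge_atTop 2] with x hx1 hx2 hx3
    have hx0 : 0 < x := by linarith
    have hx1' : 1 ≤ x := by linarith
    have hlog : 0 < Real.log x := Real.log_pos (by linarith)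
    have hpsi : 𝒮.psi Λ x ≤ (9/4) * x := by
      have := hB₂ x hx1'
      have h4 : 𝒮.psi Λ x * Real.log x ≤ ((9/4) * x) * Real.log x := by nlinarith
      exact le_of_mul_le_mul_right h4 hlog
    have hsq1 : 1 ≤ √x := Real.one_le_sqrt.2 hx1'
    have hsmall : (#(Pr √x) : ℝ) ≤ B₃ * √x := by
      refine le_trans ?_ (𝒮.sum_one_le hδ hC hcount' hsq1)
      unfold count
      have : #(Pr √x) ≤ #(𝒮.ball √x) := by
        refine card_le_card_of_injOn (fun p => Finsupp.single p 1) ?_ ?_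
        · intro p hp
          have := (hPrm _ _).1 hp
          simpa [h𝒮, free, freeNorm_single] using this
        · intro p _ q _ h
          exact (Finsupp.single_left_inj one_ne_zero).1 h
      exact_mod_cast this
    have hlarge : #(Pr x \ Pr √x) * (Real.log x / 2) ≤ 𝒮.psi Λ x := by
      rw [← nsmul_eq_mul]
      calc #(Pr x \ Pr √x) • (Real.log x / 2)
          ≤ ∑ p ∈ Pr x \ Pr √x, Λ (Finsupp.single p 1) := by
            refine card_nsmul_le_sum _ _ _ fun p hp => ?_
            rw [mem_sdiff, hPrm, hPrm, not_le] at hp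
            rw [hΛdef, freeLambda_single N p one_ne_zero, ← Real.log_sqrt hx0.le]
            exact Real.log_le_log (by positivity) hp.2.le
        _ = ∑ f ∈ image (fun p => Finsupp.single p 1) (Pr x \ Pr √x), Λ f := by
            rw [sum_image]
            intro p _ q _ h
            exact (Finsupp.single_left_inj one_ne_zero).1 h
        _ ≤ _ := by
            refine sum_le_sum_of_subset_of_nonneg ?_ fun f _ _ => freeLambda_nonneg N f
            intro f hf
            obtain ⟨p, hp, rfl⟩ := mem_image.1 hf
            rw [mem_sdiff, hPrm] at hp
            simpa [h𝒮, free, freeNorm_single] using hp.1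
    have hcard : (#(Pr x) : ℝ) ≤ #(Pr x \ Pr √x) + #(Pr √x) := by
      exact_mod_cast (card_le_card (fun p hp => by
        by_cases h : p ∈ Pr √x <;> simp [h, hp])).trans (card_union_le _ _)
    have hls : Real.log x * √x ≤ 4 * x ^ (3/4:ℝ) := by
      have hl : Real.log x ≤ x ^ (1/4:ℝ) / (1/4) := Real.log_le_rpow_div hx0.le (by norm_num)
      calc Real.log x * √x ≤ x ^ (1/4:ℝ) / (1/4) * x ^ (1/2:ℝ) := by
            rw [Real.sqrt_eq_rpow]; gcongr
        _ = 4 * (x ^ (1/4:ℝ) * x ^ (1/2:ℝ)) := by ring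
        _ = _ := by rw [← Real.rpow_add hx0]; norm_num
    have hB₃0 : 0 ≤ B₃ := by positivity
    have h5 : #(Pr √x) * Real.log x ≤ x := by
      calc #(Pr √x) * Real.log x ≤ B₃ * √x * Real.log x := by gcongr
        _ = B₃ * (Real.log x * √x) := by ring
        _ ≤ B₃ * (4 * x ^ (3/4:ℝ)) := by gcongr
        _ ≤ x := by linarith
    nlinarith

end ArithSemigroup

/-- A trapezoidal cutoff function. -/
noncomputable def cutoff (t : ℝ) : ℝ := 2 * (max (1 - t) 0 - max (1 / 2 - t) 0)

/-- A piecewise linear bump function supported on `[1/4, 1]`. -/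
noncomputable def bump (t : ℝ) : ℝ := cutoff t - cutoff (2 * t)

lemma cutoff_of_ge {t : ℝ} (ht : 1 ≤ t) : cutoff t = 0 := by
  rw [cutoff, max_eq_right (by linarith), max_eq_right (by linarith)]; ring

lemma bump_of_ge {t : ℝ} (ht : 1 ≤ t) : bump t = 0 := by
  rw [bump, cutoff_of_ge ht, cutoff_of_ge (by linarith), sub_zero]

lemma bump_of_le {t : ℝ} (ht : t ≤ 1 / 4) : bump t = 0 := by
  rw [bump, cutoff, cutoff, max_eq_left (by linarith), max_eq_left (by linarith),
    max_eq_left (by linarith), max_eq_left (by linarith)]; ring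

lemma abs_le_of_dyadic {U T : ℝ → ℝ} {κ a b C : ℝ} (hb : 0 < b) (hba : b ≤ a)
    (hC : 0 ≤ C) (hU0 : ∀ x < 1, U x = 0) (hUT : ∀ x, 1 ≤ x → U x - U (x / 2) = T x)
    (hT : ∀ x, 1 ≤ x → |T x - κ * x ^ a| ≤ C * x ^ b) :
    ∃ κ' C', 0 ≤ C' ∧ ∀ x, 1 ≤ x → |U x - κ' * x ^ a| ≤ C' * x ^ b := by
  have ha : 0 < a := by linarith
  have h2a : (2:ℝ) ^ (-a) < 1 := Real.rpow_lt_one_of_one_lt_of_neg one_lt_two (by linarith)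
  have h2b : (2:ℝ) ^ (-b) < 1 := Real.rpow_lt_one_of_one_lt_of_neg one_lt_two (by linarith)
  set κ' := κ / (1 - 2 ^ (-a)) with hκ'
  set C' := C / (1 - 2 ^ (-b)) + |κ'| * 2 ^ b with hC'
  have hd : 0 < 1 - (2:ℝ) ^ (-b) := by linarith
  have hC'0 : 0 ≤ C' := by positivity
  have main : ∀ n : ℕ, ∀ x : ℝ, 1 / 2 ≤ x → x < 2 ^ n → |U x - κ' * x ^ a| ≤ C' * x ^ b := by
    intro n
    induction n with
    | zero =>
      intro x hx hx1
      have hx1' : x < 1 := by simpa using hx1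
      have hx0 : 0 < x := by linarith
      rw [hU0 x hx1', zero_sub, abs_neg, abs_mul, abs_of_pos (by positivity : 0 < x ^ a)]
      have e1 : x ^ a ≤ 1 := Real.rpow_le_one hx0.le hx1'.le ha.le
      have e2 : 1 ≤ 2 ^ b * x ^ b := by
        rw [← Real.mul_rpow (by norm_num) hx0.le]
        exact Real.one_le_rpow (by linarith) hb.le
      calc |κ'| * x ^ a ≤ |κ'| * (2 ^ b * x ^ b) := by gcongr; linarith
        _ = (0 + |κ'| * 2 ^ b) * x ^ b := by ring
        _ ≤ C' * x ^ b := by rw [hC']; gcongr; positivity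
    | succ n ih =>
      intro x hx hx1
      have hx0 : 0 < x := by linarith
      by_cases h1 : 1 ≤ x
      · have := ih (x / 2) (by linarith) (by rw [pow_succ] at hx1; linarith)
        have e : U x - κ' * x ^ a = (U (x / 2) - κ' * (x / 2) ^ a) + (T x - κ * x ^ a) := by
          have h3 : (x / 2) ^ a = x ^ a * 2 ^ (-a) := by
            rw [Real.div_rpow hx0.le (by norm_num), Real.rpow_neg (by norm_num)]; rfl
          have h4 : κ = κ' * (1 - 2 ^ (-a)) := by
            rw [hκ', div_mul_cancel₀]; linarith
          have h4' : κ * x ^ a = κ' * x ^ a - κ' * (x ^ a * 2 ^ (-a)) := by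
            conv_lhs => rw [h4]
            ring
          rw [h3, ← hUT x h1]; linarith
        have h5 : (x / 2) ^ b = x ^ b * 2 ^ (-b) := by
          rw [Real.div_rpow hx0.le (by norm_num), Real.rpow_neg (by norm_num)]; rfl
        rw [e]
        refine (abs_add_le _ _).trans ((add_le_add this (hT x h1)).trans ?_)
        rw [h5]
        have h6 : C ≤ C' * (1 - 2 ^ (-b)) := by
          rw [hC', add_mul, div_mul_cancel₀ _ hd.ne']
          have : 0 ≤ |κ'| * 2 ^ b * (1 - 2 ^ (-b)) := by positivity
          linarith
        have hxb : 0 < x ^ b := by positivity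
        nlinarith
      · exact ih x hx (lt_of_lt_of_le (not_le.1 h1) (one_le_pow₀ (by norm_num)))
  refine ⟨κ', C', hC'0, fun x hx => ?_⟩
  obtain ⟨n, hn⟩ := pow_unbounded_of_one_lt x one_lt_two
  exact main n x (by linarith) hn

namespace ArithSemigroup

open Finset

variable {M : Type*} [AddCommMonoid M] (𝒮 : ArithSemigroup M)

lemma sum_ball_extend {x y : ℝ} (hxy : x ≤ y) (g : ℝ → ℝ) (hg : ∀ t, x < t → g t = 0) :
    ∑ f ∈ 𝒮.ball x, g (𝒮.norm f) = ∑ f ∈ 𝒮.ball y, g (𝒮.norm f) := by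
  refine sum_subset (𝒮.ball_mono hxy) fun f _ hf => hg _ ?_
  simpa using hf

lemma sum_ball_of_lt {x : ℝ} (hx : x < 1) (g : M → ℝ) : ∑ f ∈ 𝒮.ball x, g f = 0 := by
  refine sum_eq_zero fun f hf => ?_
  have := 𝒮.one_le_norm f
  simp only [mem_ball] at hf; linarith

/-- A power saving for a smoothed count implies one for the sharp count. -/
theorem count_of_bump {κ b C : ℝ} (hb : 0 < b) (hb1 : b < 1) (hC : 0 ≤ C)
    (h : ∀ y, 1 ≤ y → |∑ f ∈ 𝒮.ball y, bump (𝒮.norm f / y) - κ * y| ≤ C * y ^ b) :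
    ∃ κ' C' δ : ℝ, 0 < δ ∧ δ < 1 ∧ 0 ≤ C' ∧ ∀ x, 1 ≤ x → |𝒮.count x - κ' * x| ≤ C' * x ^ (1 - δ) := by
  classical
  set AW : ℝ → ℝ := fun x => ∑ f ∈ 𝒮.ball x, cutoff (𝒮.norm f / x) with hAW
  set A1 : ℝ → ℝ := fun x => ∑ f ∈ 𝒮.ball x, (x - 𝒮.norm f) with hA1
  obtain ⟨κ₁, C₁, hC₁, h₁⟩ := abs_le_of_dyadic (U := AW)
    (T := fun y => ∑ f ∈ 𝒮.ball y, bump (𝒮.norm f / y)) (κ := κ) (a := 1) (b := b) (C := C)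
    hb hb1.le hC (fun x hx => 𝒮.sum_ball_of_lt hx _) (fun x hx => by
      have hx0 : 0 < x := by linarith
      have e : AW (x / 2) = ∑ f ∈ 𝒮.ball x, cutoff (𝒮.norm f / (x / 2)) := by
        rw [hAW]
        refine 𝒮.sum_ball_extend (by linarith) (fun t => cutoff (t / (x / 2))) fun t ht => ?_
        exact cutoff_of_ge (by rw [le_div_iff₀ (by positivity)]; linarith)
      rw [e, hAW, ← sum_sub_distrib]
      refine sum_congr rfl fun f _ => ?_
      rw [bump]; congr 2; field_simp) (by simpa using h)
  obtain ⟨κ₂, C₂, hC₂, h₂⟩ := abs_le_of_dyadic (U := A1)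
    (T := fun x => (x / 2) * AW x) (κ := κ₁ / 2) (a := 2) (b := 1 + b) (C := C₁ / 2)
    (by linarith) (by linarith) (by positivity) (fun x hx => 𝒮.sum_ball_of_lt hx _)
    (fun x hx => by
      have hx0 : 0 < x := by linarith
      have e1 : A1 (x / 2) = ∑ f ∈ 𝒮.ball x, max (x / 2 - 𝒮.norm f) 0 := by
        rw [← 𝒮.sum_ball_extend (x := x / 2) (by linarith) (fun t => max (x / 2 - t) 0)
          fun t ht => max_eq_right (by linarith)]
        refine sum_congr rfl fun f hf => ?_
        rw [mem_ball] at hf; rw [max_eq_left (by linarith)]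
      have e2 : A1 x = ∑ f ∈ 𝒮.ball x, max (x - 𝒮.norm f) 0 := by
        refine sum_congr rfl fun f hf => ?_
        rw [mem_ball] at hf; rw [max_eq_left (by linarith)]
      rw [e1, e2, hAW, mul_sum, ← sum_sub_distrib]
      refine sum_congr rfl fun f _ => ?_
      have hm : ∀ c : ℝ, max (c * x - 𝒮.norm f) 0 = x * max (c - 𝒮.norm f / x) 0 := by
        intro c
        rw [mul_max_of_nonneg _ _ hx0.le, mul_zero, mul_sub, mul_div_cancel₀ _ hx0.ne', mul_comm]
      have h3 := hm 1
      have h4 := hm (1 / 2)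
      rw [one_mul] at h3
      have : x / 2 = 1 / 2 * x := by ring
      rw [cutoff, h3, this, h4]; ring)
    (fun x hx => by
      have hx0 : 0 < x := by linarith
      have e : x / 2 * AW x - κ₁ / 2 * x ^ (2:ℝ) = x / 2 * (AW x - κ₁ * x ^ (1:ℝ)) := by
        rw [Real.rpow_one, Real.rpow_two]; ring
      rw [e, abs_mul, abs_of_pos (by positivity), Real.rpow_add hx0, Real.rpow_one]
      calc x / 2 * _ ≤ x / 2 * (C₁ * x ^ b) := by gcongr; simpa using h₁ x hx
        _ = _ := by ring)
  have hA1' : ∀ x, 1 ≤ x → |A1 x - κ₂ * x ^ 2| ≤ C₂ * x ^ (1 + b) := by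
    intro x hx; simpa using h₂ x hx
  -- differencing
  have hdiff : ∀ x y, x ≤ y → (y - x) * 𝒮.count x ≤ A1 y - A1 x ∧
      A1 y - A1 x ≤ (y - x) * 𝒮.count y := by
    intro x y hxy
    have hs := sum_sdiff (f := fun f => y - (𝒮.norm f : ℝ)) (𝒮.ball_mono hxy)
    have e1 : ∑ f ∈ 𝒮.ball x, (y - (𝒮.norm f : ℝ)) = A1 x + (y - x) * 𝒮.count x := by
      rw [hA1, count, mul_comm, ← nsmul_eq_mul, ← sum_const, ← sum_add_distrib]
      exact sum_congr rfl fun _ _ => by ring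
    have e2 : 0 ≤ ∑ f ∈ 𝒮.ball y \ 𝒮.ball x, (y - (𝒮.norm f : ℝ)) :=
      sum_nonneg fun f hf => by
        rw [mem_sdiff, mem_ball] at hf; linarith [hf.1]
    have e3 : ∑ f ∈ 𝒮.ball y \ 𝒮.ball x, (y - (𝒮.norm f : ℝ)) ≤
        (y - x) * (𝒮.count y - 𝒮.count x) := by
      have : 𝒮.count y - 𝒮.count x = #(𝒮.ball y \ 𝒮.ball x) := by
        rw [count, count, card_sdiff_of_subset (𝒮.ball_mono hxy), Nat.cast_sub]
        exact card_le_card (𝒮.ball_mono hxy)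
      rw [this, mul_comm, ← nsmul_eq_mul]
      refine sum_le_card_nsmul _ _ _ fun f hf => ?_
      rw [mem_sdiff, mem_ball, mem_ball, not_le] at hf; linarith [hf.2]
    have hA1y : A1 y = ∑ f ∈ 𝒮.ball y, (y - (𝒮.norm f : ℝ)) := rfl
    constructor <;> linarith
  set e : ℝ := (1 - b) / 2 with he
  have he0 : 0 < e := by rw [he]; linarith
  have he1 : e < 1 := by rw [he]; linarith
  refine ⟨2 * κ₂, |κ₂| + 20 * C₂ + 𝒮.count 2 + 4 * |κ₂|, e, he0, he1,
    by have := 𝒮.count_nonneg 2; positivity, fun x hx => ?_⟩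
  have hx0 : 0 < x := by linarith
  have hc2 := 𝒮.count_nonneg 2
  have hxe1 : 1 ≤ x ^ (1 - e) := Real.one_le_rpow hx (by linarith)
  rcases le_total x 2 with hx2 | hx2
  · have h3 : 𝒮.count x ≤ 𝒮.count 2 := by
      unfold count; exact_mod_cast card_le_card (𝒮.ball_mono hx2)
    have h4 := 𝒮.count_nonneg x
    have h5 : |2 * κ₂ * x| ≤ 4 * |κ₂| := by
      rw [abs_mul, abs_mul, abs_of_pos hx0, abs_two]
      nlinarith [abs_nonneg κ₂]
    calc |𝒮.count x - 2 * κ₂ * x| ≤ |𝒮.count x| + |2 * κ₂ * x| := abs_sub _ _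
      _ ≤ 𝒮.count 2 + 4 * |κ₂| := by rw [abs_of_nonneg h4]; gcongr
      _ ≤ |κ₂| + 20 * C₂ + 𝒮.count 2 + 4 * |κ₂| := by
        have := abs_nonneg κ₂; linarith
      _ ≤ _ := le_mul_of_one_le_right (by positivity) hxe1
  · set hh : ℝ := x ^ (1 - e) / 2 with hhh
    have hhx : x ^ (1 - e) ≤ x := by
      calc x ^ (1 - e) ≤ x ^ (1:ℝ) := Real.rpow_le_rpow_of_exponent_le hx (by linarith)
        _ = x := Real.rpow_one x
    have hh0 : 0 < hh := by positivity
    have hprod : x ^ (1 + b) = 4 * hh * hh := by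
      have : x ^ (1 + b) = x ^ (1 - e) * x ^ (1 - e) := by
        rw [← Real.rpow_add hx0]; congr 1; rw [he]; ring
      rw [this, hhh]; ring
    have hup := hA1' (x + hh) (by linarith)
    have hmid := hA1' x hx
    have hlow := hA1' (x - hh) (by linarith)
    have hup' : (x + hh) ^ (1 + b) ≤ 4 * x ^ (1 + b) := by
      calc (x + hh) ^ (1 + b) ≤ (2 * x) ^ (1 + b) := by
            apply Real.rpow_le_rpow <;> linarith
        _ = 2 ^ (1 + b) * x ^ (1 + b) := Real.mul_rpow (by norm_num) hx0.le
        _ ≤ 2 ^ (2:ℝ) * x ^ (1 + b) := by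
            gcongr
            · norm_num
            · linarith
        _ = _ := by norm_num
    have hlow' : (x - hh) ^ (1 + b) ≤ x ^ (1 + b) := by
      apply Real.rpow_le_rpow <;> linarith
    have d1 := (hdiff x (x + hh) (by linarith)).1
    have d2 := (hdiff (x - hh) x (by linarith)).2
    have hup2 : |A1 (x + hh) - κ₂ * (x + hh) ^ 2| ≤ C₂ * (4 * x ^ (1 + b)) :=
      hup.trans (by gcongr)
    have hlow2 : |A1 (x - hh) - κ₂ * (x - hh) ^ 2| ≤ C₂ * (x ^ (1 + b)) :=
      hlow.trans (by gcongr)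
    rw [hprod] at hup2 hlow2 hmid
    have u1 : hh * 𝒮.count x ≤ hh * (2 * κ₂ * x + |κ₂| * hh + 20 * C₂ * hh) := by
      have : κ₂ * hh * hh ≤ |κ₂| * hh * hh := by gcongr; exact le_abs_self _
      nlinarith [(abs_le.1 hup2).2, (abs_le.1 hmid).1]
    have u2 : hh * (2 * κ₂ * x - |κ₂| * hh - 20 * C₂ * hh) ≤ hh * 𝒮.count x := by
      have : κ₂ * hh * hh ≤ |κ₂| * hh * hh := by gcongr; exact le_abs_self _
      have h9 : 0 ≤ C₂ * hh * hh := by positivity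
      nlinarith [(abs_le.1 hlow2).2, (abs_le.1 hmid).1]
    have v1 := le_of_mul_le_mul_left u1 hh0
    have v2 := le_of_mul_le_mul_left u2 hh0
    have hle : (|κ₂| + 20 * C₂) * hh ≤ (|κ₂| + 20 * C₂ + 𝒮.count 2 + 4 * |κ₂|) * x ^ (1 - e) := by
      have h7 : hh ≤ x ^ (1 - e) := by rw [hhh]; linarith
      have := abs_nonneg κ₂
      apply mul_le_mul _ h7 hh0.le (by positivity)
      linarith
    rw [abs_le]; constructor <;> linarith

end ArithSemigroup

open MeasureTheory Module in
/-- Comparison of a smoothed sum over a lattice with the corresponding integral. -/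
theorem lattice_sum_sub_integral_le {V ι : Type*} [NormedAddCommGroup V] [NormedSpace ℝ V]
    [FiniteDimensional ℝ V] [MeasurableSpace V] [BorelSpace V] [Finite ι]
    (μ : Measure V) [μ.IsAddHaarMeasure] (b : Basis ι ℝ V) (hd : 0 < finrank ℝ V)
    {k : V → ℝ} {K : NNReal} {B : ℝ}
    (hk : LipschitzWith K k) (hB : 0 ≤ B) (hkB : ∀ x, B < ‖x‖ → k x = 0) :
    ∃ C, 0 ≤ C ∧ ∀ Y : ℝ, 1 ≤ Y → ∃ s : Finset (Submodule.span ℤ (Set.range b)),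
      (∀ v, v ∉ s → k (Y⁻¹ • (v : V)) = 0) ∧
      |μ.real (ZSpan.fundamentalDomain b) * ∑ v ∈ s, k (Y⁻¹ • (v : V)) -
        Y ^ finrank ℝ V * ∫ x, k x ∂μ| ≤ C * Y ^ (finrank ℝ V - 1) := by
  set Λ := Submodule.span ℤ (Set.range b) with hΛ
  set D := ZSpan.fundamentalDomain b with hD
  set d := finrank ℝ V with hd'
  have hfd : IsAddFundamentalDomain Λ D μ := ZSpan.isAddFundamentalDomain b μ
  have : VAddInvariantMeasure Λ V μ :=
    inferInstanceAs <| VAddInvariantMeasure Λ.toAddSubgroup V μ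
  obtain ⟨R, hR0, hR⟩ : ∃ R : ℝ, 0 ≤ R ∧ ∀ x ∈ D, ‖x‖ ≤ R := by
    obtain ⟨R, hR⟩ := isBounded_iff_forall_norm_le.1 (ZSpan.fundamentalDomain_isBounded b)
    exact ⟨max R 0, le_max_right _ _, fun x hx => (hR x hx).trans (le_max_left _ _)⟩
  have hDfin : μ D ≠ ⊤ := (ZSpan.fundamentalDomain_isBounded b).measure_lt_top.ne
  have hkc : Continuous k := hk.continuous
  have hks : HasCompactSupport k := by
    refine HasCompactSupport.intro (isCompact_closedBall (0:V) B) fun x hx => hkB x ?_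
    simpa using hx
  set w : ℝ := μ.real (Metric.closedBall (0:V) 1) with hw
  refine ⟨(B + 2 * R) ^ d * w * (K * R), by positivity, fun Y hY => ?_⟩
  have hY0 : 0 < Y := by linarith
  set S : Set Λ := {v | ‖(v:V)‖ ≤ Y * B + R} with hS
  have hSfin : S.Finite := by
    have h1 := ZSpan.setFinite_inter b (Metric.isBounded_closedBall (x := (0:V)) (r := Y * B + R))
    refine Set.Finite.of_finite_image (f := ((↑) : Λ → V)) (h1.subset ?_)
      Subtype.val_injective.injOn
    rintro _ ⟨v, hv, rfl⟩
    exact ⟨by simpa [hS] using hv, v.2⟩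
  have hSs : ∀ v : Λ, v ∉ S → ∀ x ∈ D, k (Y⁻¹ • ((v:V) + x)) = 0 := by
    intro v hv x hx
    apply hkB
    rw [norm_smul, Real.norm_of_nonneg (by positivity), lt_inv_mul_iff₀ hY0]
    have h2 : Y * B + R < ‖(v:V)‖ := by simpa [hS] using hv
    have h3 := norm_sub_le ((v:V) + x) x
    rw [add_sub_cancel_right] at h3
    linarith [hR x hx]
  refine ⟨hSfin.toFinset, fun v hv => ?_, ?_⟩
  · have := hSs v (by simpa using hv) 0 (by simp [hD, ZSpan.fundamentalDomain])
    simpa using this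
  have hint : Integrable (fun x => k (Y⁻¹ • x)) μ :=
    (hkc.integrable_of_hasCompactSupport hks).comp_smul (by positivity)
  have e1 : Y ^ d * ∫ x, k x ∂μ = ∑ v ∈ hSfin.toFinset, ∫ x in D, k (Y⁻¹ • ((v:V) + x)) ∂μ := by
    rw [← smul_eq_mul, ← Measure.integral_comp_inv_smul_of_nonneg μ k hY0.le,
      hfd.integral_eq_tsum'' _ hint]
    refine tsum_eq_sum fun v hv => ?_
    refine setIntegral_eq_zero_of_forall_eq_zero fun x hx => ?_
    exact hSs v (by simpa using hv) x hx
  have hcard : (hSfin.toFinset.card : ℝ) * μ.real D ≤ (B + 2 * R) ^ d * w * Y ^ d := by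
    have h1 := hfd.measure_eq_tsum' (Metric.closedBall (0:V) (Y * B + 2 * R))
    have h2 : ∑ v ∈ hSfin.toFinset, μ D ≤ μ (Metric.closedBall (0:V) (Y * B + 2 * R)) := by
      rw [h1]
      refine le_trans (Finset.sum_le_sum fun v hv => ?_) (ENNReal.sum_le_tsum hSfin.toFinset)
      rw [Set.inter_eq_right.2, measure_vadd]
      rintro _ ⟨x, hx, rfl⟩
      have h3 : ‖(v:V)‖ ≤ Y * B + R := by simpa [hS] using hv
      rw [mem_closedBall_zero_iff]
      change ‖(v:V) + x‖ ≤ _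
      have := norm_add_le (v:V) x
      linarith [hR x hx]
    have h4 : μ (Metric.closedBall (0:V) (Y * B + 2 * R)) ≠ ⊤ :=
      Metric.isBounded_closedBall.measure_lt_top.ne
    have h5 := ENNReal.toReal_mono h4 h2
    rw [Finset.sum_const, nsmul_eq_mul, ENNReal.toReal_mul, ENNReal.toReal_natCast,
      Measure.addHaar_closedBall' μ _ (by positivity), ENNReal.toReal_mul,
      ENNReal.toReal_ofReal (by positivity)] at h5
    refine h5.trans ?_
    have h6 : (Y * B + 2 * R) ^ d ≤ ((B + 2 * R) * Y) ^ d := by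
      gcongr; nlinarith
    calc _ ≤ ((B + 2 * R) * Y) ^ d * w := by
          apply mul_le_mul_of_nonneg_right h6 measureReal_nonneg
      _ = _ := by rw [mul_pow]; ring
  have herr : ∀ v : Λ, |μ.real D * k (Y⁻¹ • (v:V)) - ∫ x in D, k (Y⁻¹ • ((v:V) + x)) ∂μ| ≤
      K * R / Y * μ.real D := by
    intro v
    have hi : IntegrableOn (fun x => k (Y⁻¹ • ((v:V) + x))) D μ :=
      (hint.comp_add_left (v:V)).integrableOn
    have hi₀ : IntegrableOn (fun _ : V => k (Y⁻¹ • (v:V))) D μ :=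
      integrableOn_const hDfin (by simp)
    have e2 : μ.real D * k (Y⁻¹ • (v:V)) = ∫ x in D, k (Y⁻¹ • (v:V)) ∂μ := by
      rw [setIntegral_const, smul_eq_mul]
    rw [e2, ← integral_sub hi₀ hi, ← Real.norm_eq_abs]
    refine norm_setIntegral_le_of_norm_le_const hDfin.lt_top fun x hx => ?_
    have h7 := hk.dist_le_mul (Y⁻¹ • (v:V)) (Y⁻¹ • ((v:V) + x))
    rw [Real.dist_eq, dist_eq_norm, ← smul_sub, norm_smul, sub_add_cancel_left, norm_neg,
      Real.norm_of_nonneg (by positivity)] at h7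
    refine h7.trans ?_
    calc (K:ℝ) * (Y⁻¹ * ‖x‖) ≤ K * (Y⁻¹ * R) := by gcongr; exact hR x hx
      _ = _ := by ring
  rw [e1, Finset.mul_sum, ← Finset.sum_sub_distrib]
  refine (Finset.abs_sum_le_sum_abs _ _).trans ((Finset.sum_le_sum fun v _ => herr v).trans ?_)
  rw [Finset.sum_const, nsmul_eq_mul]
  have h8 : Y ^ d = Y ^ (d - 1) * Y := by rw [← pow_succ]; congr 1; omega
  calc (hSfin.toFinset.card : ℝ) * (K * R / Y * μ.real D)
      = (hSfin.toFinset.card * μ.real D) * (K * R / Y) := by ring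
    _ ≤ ((B + 2 * R) ^ d * w * Y ^ d) * (K * R / Y) := by gcongr
    _ = _ := by rw [h8]; field_simp

/-- Bounded Lipschitz real-valued functions. -/
def BddLipschitz {X : Type*} [PseudoMetricSpace X] (f : X → ℝ) : Prop :=
  (∃ C : ℝ, 0 ≤ C ∧ ∀ x, |f x| ≤ C) ∧ ∃ K : NNReal, LipschitzWith K f

lemma BddLipschitz.mul {X : Type*} [PseudoMetricSpace X] {f g : X → ℝ}
    (hf : BddLipschitz f) (hg : BddLipschitz g) : BddLipschitz fun x => f x * g x := by
  obtain ⟨⟨A, hA0, hA⟩, K, hK⟩ := hf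
  obtain ⟨⟨B, hB0, hB⟩, L, hL⟩ := hg
  refine ⟨⟨A * B, by positivity, fun x => ?_⟩, A.toNNReal * L + B.toNNReal * K, ?_⟩
  · rw [abs_mul]; exact mul_le_mul (hA x) (hB x) (abs_nonneg _) hA0
  · refine LipschitzWith.of_dist_le_mul fun x y => ?_
    have h1 := hK.dist_le_mul x y
    have h2 := hL.dist_le_mul x y
    rw [Real.dist_eq] at h1 h2 ⊢
    push_cast
    rw [Real.coe_toNNReal _ hA0, Real.coe_toNNReal _ hB0]
    have e : f x * g x - f y * g y = f x * (g x - g y) + g y * (f x - f y) := by ring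
    rw [e]
    refine (abs_add_le _ _).trans ?_
    rw [abs_mul, abs_mul]
    calc |f x| * |g x - g y| + |g y| * |f x - f y|
        ≤ A * (L * dist x y) + B * (K * dist x y) := by
          gcongr
          · exact hA x
          · exact hB y
      _ = _ := by ring

lemma BddLipschitz.const {X : Type*} [PseudoMetricSpace X] (c : ℝ) :
    BddLipschitz fun _ : X => c :=
  ⟨⟨|c|, abs_nonneg _, fun _ => le_rfl⟩, 0, LipschitzWith.const c⟩

lemma BddLipschitz.prod {X ι : Type*} [PseudoMetricSpace X] (s : Finset ι) {f : ι → X → ℝ}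
    (hf : ∀ i, BddLipschitz (f i)) : BddLipschitz fun x => ∏ i ∈ s, f i x := by
  classical
  induction s using Finset.induction_on with
  | empty => simpa using BddLipschitz.const 1
  | insert a s ha ih => simp only [Finset.prod_insert ha]; exact (hf a).mul ih

lemma BddLipschitz.comp {X Z : Type*} [PseudoMetricSpace X] [PseudoMetricSpace Z] {f : X → ℝ}
    (hf : BddLipschitz f) {g : Z → X} {L : NNReal} (hg : LipschitzWith L g) :
    BddLipschitz fun z => f (g z) :=
  ⟨⟨hf.1.choose, hf.1.choose_spec.1, fun z => hf.1.choose_spec.2 (g z)⟩,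
    _, hf.2.choose_spec.comp hg⟩

/-- The tent function supported on `[-1, 1]`. -/
noncomputable def tent (t : ℝ) : ℝ := max (1 - |t|) 0

lemma tent_of_ge {t : ℝ} (ht : 1 ≤ |t|) : tent t = 0 := max_eq_right (by linarith)

lemma bddLipschitz_tent : BddLipschitz tent := by
  refine ⟨⟨1, zero_le_one, fun x => ?_⟩, 1, ?_⟩
  · rw [tent, abs_of_nonneg (le_max_right _ _)]
    exact max_le (by linarith [abs_nonneg x]) zero_le_one
  · refine LipschitzWith.of_dist_le_mul fun x y => ?_
    rw [Real.dist_eq, Real.dist_eq, tent, tent, NNReal.coe_one, one_mul]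
    refine (abs_max_sub_max_le_abs _ _ _).trans ?_
    rw [sub_sub_sub_cancel_left, abs_sub_comm]
    exact abs_abs_sub_abs_le x y

lemma sum_tent_add_floor (t : ℝ) :
    ∑ e ∈ ({-⌊t⌋, -⌊t⌋ - 1} : Finset ℤ), tent (t + e) = 1 := by
  rw [Finset.sum_pair (by omega), tent, tent]
  push_cast
  have h1 := Int.fract_nonneg t
  have h2 := Int.fract_lt_one t
  have e1 : t + -(⌊t⌋ : ℝ) = Int.fract t := by rw [Int.fract]; ring
  have e2 : t + (-(⌊t⌋ : ℝ) - 1) = Int.fract t - 1 := by rw [Int.fract]; ring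
  rw [e1, e2, abs_of_nonneg h1, abs_of_nonpos (by linarith), max_eq_left (by linarith),
    max_eq_left (by linarith)]
  ring

lemma tent_add_int_eq_zero {t : ℝ} {e : ℤ} (he : e ∉ ({-⌊t⌋, -⌊t⌋ - 1} : Finset ℤ)) :
    tent (t + e) = 0 := by
  apply tent_of_ge
  have h1 := Int.fract_nonneg t
  have h2 := Int.fract_lt_one t
  simp only [Finset.mem_insert, Finset.mem_singleton, not_or] at he
  have e1 : t = ⌊t⌋ + Int.fract t := (Int.floor_add_fract t).symm
  rcases lt_or_ge e (-⌊t⌋ - 1) with h | h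
  · have : (e : ℝ) ≤ -⌊t⌋ - 2 := by exact_mod_cast (by omega : e ≤ -⌊t⌋ - 2)
    rw [abs_of_nonpos] <;> linarith
  · have : (-⌊t⌋ + 1 : ℝ) ≤ e := by exact_mod_cast (by omega : -⌊t⌋ + 1 ≤ e)
    rw [abs_of_nonneg] <;> linarith

lemma bddLipschitz_cutoff : ∃ K : NNReal, LipschitzWith K cutoff := by
  refine ⟨4, LipschitzWith.of_dist_le_mul fun x y => ?_⟩
  have h1 := abs_max_sub_max_le_abs (1 - x) (1 - y) 0
  have h2 := abs_max_sub_max_le_abs (1 / 2 - x) (1 / 2 - y) 0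
  rw [sub_sub_sub_cancel_left, abs_sub_comm y x] at h1 h2
  rw [Real.dist_eq, Real.dist_eq]
  have e : cutoff x - cutoff y = 2 * (max (1 - x) 0 - max (1 - y) 0)
    - 2 * (max (1 / 2 - x) 0 - max (1 / 2 - y) 0) := by rw [cutoff, cutoff]; ring
  rw [e]
  refine (abs_sub _ _).trans ?_
  rw [abs_mul, abs_mul, abs_two]
  push_cast
  linarith

lemma exists_lipschitzWith_bump : ∃ K : NNReal, LipschitzWith K bump := by
  obtain ⟨K, hK⟩ := bddLipschitz_cutoff
  refine ⟨3 * K, LipschitzWith.of_dist_le_mul fun x y => ?_⟩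
  have h1 := hK.dist_le_mul x y
  have h2 := hK.dist_le_mul (2 * x) (2 * y)
  rw [Real.dist_eq, Real.dist_eq] at h1 h2 ⊢
  have e : bump x - bump y = (cutoff x - cutoff y) - (cutoff (2 * x) - cutoff (2 * y)) := by
    rw [bump, bump]; ring
  rw [← mul_sub, abs_mul, abs_two] at h2
  rw [e]
  refine (abs_sub _ _).trans ?_
  push_cast
  linarith

/-- The function `u ↦ bump (exp u)` is bounded and Lipschitz. -/
lemma bddLipschitz_bump_exp : BddLipschitz fun u : ℝ => bump (Real.exp u) := by
  obtain ⟨K, hK⟩ := exists_lipschitzWith_bump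
  have h0 : ∀ u : ℝ, bump (Real.exp u) = bump (Real.exp (min u 0)) := by
    intro u
    rcases le_total u 0 with h | h
    · rw [min_eq_left h]
    · rw [min_eq_right h, bump_of_ge (Real.one_le_exp h), bump_of_ge (by simp)]
  have hexp : LipschitzWith 1 fun u : ℝ => Real.exp (min u 0) := by
    refine LipschitzWith.of_dist_le_mul fun x y => ?_
    have hm : |min x 0 - min y 0| ≤ |x - y| := by
      have := abs_min_sub_min_le_max x 0 y 0
      simpa using this
    rw [Real.dist_eq, Real.dist_eq, NNReal.coe_one, one_mul]
    refine le_trans ?_ hm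
    have key : ∀ a b : ℝ, a ≤ 0 → b ≤ 0 → Real.exp a - Real.exp b ≤ |a - b| := by
      intro a b ha hb
      rcases le_total a b with hab | hab
      · have := Real.exp_le_exp.2 hab
        linarith [abs_nonneg (a - b)]
      · have h1 : Real.exp a ≤ 1 := Real.exp_le_one_iff.2 ha
        have h2 := Real.add_one_le_exp (b - a)
        have h3 : Real.exp b = Real.exp a * Real.exp (b - a) := by rw [← Real.exp_add]; ring_nf
        rw [abs_of_nonneg (by linarith), h3]
        nlinarith [Real.exp_pos a]
    rw [abs_le]
    constructor
    · have := key (min y 0) (min x 0) (min_le_right _ _) (min_le_right _ _)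
      rw [abs_sub_comm] at this; linarith
    · exact key _ _ (min_le_right _ _) (min_le_right _ _)
  refine ⟨⟨3 * K, by positivity, fun u => ?_⟩, K * 1, ?_⟩
  · have h := hK.dist_le_mul (Real.exp (min u 0)) 1
    rw [Real.dist_eq, Real.dist_eq, bump_of_ge le_rfl, sub_zero] at h
    beta_reduce
    rw [h0]
    have h1 : Real.exp (min u 0) ≤ 1 := Real.exp_le_one_iff.2 (min_le_right _ _)
    have h2 := Real.exp_pos (min u 0)
    have h3 : |Real.exp (min u 0) - 1| ≤ 3 := by rw [abs_le]; constructor <;> linarith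
    calc _ ≤ _ := h
      _ ≤ K * 3 := by gcongr
      _ = _ := by ring
  · have := hK.comp hexp
    rwa [show bump ∘ (fun u => Real.exp (min u 0)) = fun u => bump (Real.exp u) from
      funext fun u => (h0 u).symm] at this

lemma lipschitzWith_log_max {ε : ℝ} (hε : 0 < ε) :
    LipschitzWith (ε⁻¹).toNNReal fun t : ℝ => Real.log (max t ε) := by
  refine LipschitzWith.of_dist_le_mul fun x y => ?_
  rw [Real.coe_toNNReal _ (by positivity), Real.dist_eq, Real.dist_eq]
  have hm : |max x ε - max y ε| ≤ |x - y| := abs_max_sub_max_le_abs x y ε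
  have key : ∀ a b : ℝ, ε ≤ a → ε ≤ b → Real.log a - Real.log b ≤ ε⁻¹ * |a - b| := by
    intro a b ha hb
    have ha0 : 0 < a := by linarith
    have hb0 : 0 < b := by linarith
    rw [← Real.log_div ha0.ne' hb0.ne']
    refine (Real.log_le_sub_one_of_pos (by positivity)).trans ?_
    have e : a / b - 1 = b⁻¹ * (a - b) := by field_simp
    rw [e]
    calc b⁻¹ * (a - b) ≤ b⁻¹ * |a - b| := by gcongr; exact le_abs_self _
      _ ≤ _ := by gcongr
  refine le_trans ?_ (mul_le_mul_of_nonneg_left hm (by positivity))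
  rw [abs_le]
  constructor
  · have := key _ _ (le_max_right y ε) (le_max_right x ε)
    rw [abs_sub_comm] at this; linarith
  · exact key _ _ (le_max_right _ _) (le_max_right _ _)

namespace IdealCount

open Module NumberField NumberField.InfinitePlace NumberField.mixedEmbedding
  NumberField.Units NumberField.Units.dirichletUnitTheorem NumberField.mixedEmbedding.fundamentalCone

variable (E : Type*) [Field E] [NumberField E]

section

variable {E}

/-- The logarithmic coordinates of a point of the mixed space. -/
noncomputable def logCoord (x : mixedSpace E) : realSpace E :=
  fun w => w.mult * Real.log (normAtPlace w x)

open scoped Classical in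
/-- The smooth substitute for the indicator function of a fundamental cone, in terms of
logarithmic coordinates. -/
noncomputable def cone (y : realSpace E) : ℝ :=
  ∏ i : {w : InfinitePlace E // w ≠ w₀}, tent ((completeBasis E).repr y i)

/-- The test function used to count lattice points. -/
noncomputable def kern (x : mixedSpace E) : ℝ := bump (mixedEmbedding.norm x) * cone (logCoord x)

lemma sum_eq_repr (y : realSpace E) :
    ∑ w, y w = (completeBasis E).repr y w₀ * finrank ℚ E := by
  classical
  let f : realSpace E →ₗ[ℝ] ℝ := ∑ w, LinearMap.proj w
  have hf : ∀ y : realSpace E, f y = ∑ w, y w := fun y => by simp [f]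
  rw [← hf]
  conv_lhs => rw [← (completeBasis E).sum_repr y]
  rw [map_sum, Finset.sum_eq_single w₀]
  · rw [map_smul, hf, completeBasis_apply_of_eq, ← Nat.cast_sum, sum_mult_eq, smul_eq_mul]
  · intro i _ hi
    have hb := completeBasis_apply_of_ne (K := E) ⟨i, hi⟩
    rw [map_smul, hf]
    simp only at hb
    rw [hb, sum_expMap_symm_apply (coe_ne_zero _),
      Units.norm]
    simp
  · simp

lemma bddLipschitz_comp_linear {V : Type*} [NormedAddCommGroup V] [NormedSpace ℝ V]
    [FiniteDimensional ℝ V] {f : ℝ → ℝ} (hf : BddLipschitz f) (l : V →ₗ[ℝ] ℝ) :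
    BddLipschitz fun v => f (l v) :=
  hf.comp (LinearMap.toContinuousLinearMap l).lipschitz

lemma bddLipschitz_kern_log :
    BddLipschitz fun y : realSpace E => bump (Real.exp (∑ w, y w)) * cone y := by
  classical
  have h1 := bddLipschitz_comp_linear bddLipschitz_bump_exp
    (∑ w, LinearMap.proj w : realSpace E →ₗ[ℝ] ℝ)
  simp only [LinearMap.coe_sum, Finset.sum_apply, LinearMap.proj_apply] at h1
  refine h1.mul (BddLipschitz.prod _ fun i => ?_)
  exact bddLipschitz_comp_linear bddLipschitz_tent ((completeBasis E).coord i)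

lemma exists_bound_of_ne_zero : ∃ M : ℝ, 0 ≤ M ∧ ∀ y : realSpace E,
    bump (Real.exp (∑ w, y w)) * cone y ≠ 0 → ∀ w, |y w| ≤ M := by
  classical
  have hd : (1:ℝ) ≤ finrank ℚ E := by exact_mod_cast (finrank_pos : 0 < finrank ℚ E)
  refine ⟨∑ i, 2 * ‖completeBasis E i‖, by positivity, fun y hy w => ?_⟩
  obtain ⟨h1, h2⟩ := mul_ne_zero_iff.1 hy
  have hc : ∀ i, |(completeBasis E).repr y i| ≤ 2 := by
    intro i
    by_cases hi : i = w₀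
    · subst hi
      set s := ∑ w, y w with hs
      have h3 : s < 0 := by
        by_contra! h; exact h1 (bump_of_ge (Real.one_le_exp h))
      have h4 : -2 ≤ s := by
        by_contra! h
        apply h1 (bump_of_le _)
        have h5 : Real.exp s ≤ Real.exp (-2) := Real.exp_le_exp.2 h.le
        refine h5.trans ?_
        rw [show (-2:ℝ) = -1 + -1 by norm_num, Real.exp_add]
        have := Real.exp_neg_one_lt_half
        nlinarith [Real.exp_pos (-1)]
      have h6 := sum_eq_repr y
      rw [← hs] at h6
      set r := (completeBasis E).repr y w₀
      have h7 : |s| ≤ 2 := by rw [abs_le]; constructor <;> linarith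
      rw [h6, abs_mul, abs_of_pos (by linarith : (0:ℝ) < finrank ℚ E)] at h7
      nlinarith [abs_nonneg r]
    · by_contra! h
      exact h2 (Finset.prod_eq_zero (Finset.mem_univ ⟨i, hi⟩) (tent_of_ge (by linarith)))
  have h8 : ‖y‖ ≤ ∑ i, 2 * ‖completeBasis E i‖ := by
    conv_lhs => rw [← (completeBasis E).sum_repr y]
    refine (norm_sum_le _ _).trans (Finset.sum_le_sum fun i _ => ?_)
    rw [_root_.norm_smul]
    gcongr
    exact hc i
  exact (norm_le_pi_norm y w).trans h8

lemma norm_eq_exp {x : mixedSpace E} (hx : ∀ w, normAtPlace w x ≠ 0) :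
    mixedEmbedding.norm x = Real.exp (∑ w, logCoord x w) := by
  rw [mixedEmbedding.norm_apply, Real.exp_sum]
  refine Finset.prod_congr rfl fun w _ => ?_
  rw [logCoord, ← Real.log_pow, Real.exp_log]
  exact pow_pos (lt_of_le_of_ne (normAtPlace_nonneg w x) (hx w).symm) _

lemma kern_eq_zero_of_norm {x : mixedSpace E} (hx : mixedEmbedding.norm x = 0) : kern x = 0 := by
  rw [kern, hx, bump_of_le (by norm_num), zero_mul]

open scoped Classical in
/-- `kern` is Lipschitz and compactly supported. -/
lemma exists_lipschitzWith_kern : ∃ (K : NNReal) (B : ℝ), LipschitzWith K (kern (E := E)) ∧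
    0 ≤ B ∧ ∀ x : mixedSpace E, B < ‖x‖ → kern x = 0 := by
  classical
  obtain ⟨M, hM0, hM⟩ := exists_bound_of_ne_zero (E := E)
  obtain ⟨K, hK⟩ := (bddLipschitz_kern_log (E := E)).2
  set h : realSpace E → ℝ := fun y => bump (Real.exp (∑ w, y w)) * cone y with hh
  have hmult : ∀ w : InfinitePlace E, (1:ℝ) ≤ w.mult := fun w => by
    exact_mod_cast mult_pos
  have hk : ∀ x : mixedSpace E, (∀ w, normAtPlace w x ≠ 0) → kern x = h (logCoord x) := by
    intro x hx
    rw [kern, norm_eq_exp hx]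
  set ε : ℝ := Real.exp (-(M + 1)) with hε
  have hε0 : 0 < ε := Real.exp_pos _
  have hεlog : Real.log ε = -(M + 1) := Real.log_exp _
  set Lg : mixedSpace E → realSpace E :=
    fun x w => w.mult * Real.log (max (normAtPlace w x) ε) with hLg
  have hkL : ∀ x, kern x = h (Lg x) := by
    intro x
    by_cases hx : ∀ w, ε ≤ normAtPlace w x
    · rw [hk x fun w => (hε0.trans_le (hx w)).ne']
      congr 1
      funext w
      simp only [hLg, logCoord, max_eq_left (hx w)]
    · push Not at hx
      obtain ⟨w, hw⟩ := hx
      have h1 : h (Lg x) = 0 := by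
        by_contra hne
        have := hM _ hne w
        rw [hLg] at this
        beta_reduce at this
        rw [max_eq_right hw.le, hεlog, abs_mul, abs_neg, abs_of_pos (by linarith : 0 < M + 1),
          abs_of_pos (by linarith [hmult w])] at this
        nlinarith [hmult w]
      rw [h1]
      by_cases h0 : ∀ w, normAtPlace w x ≠ 0
      · rw [hk x h0]
        by_contra hne
        have := hM _ hne w
        have hpos : 0 < normAtPlace w x := lt_of_le_of_ne (normAtPlace_nonneg w x) (h0 w).symm
        have h2 : Real.log (normAtPlace w x) < -(M + 1) := by
          rw [← hεlog]; exact Real.log_lt_log hpos hw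
        rw [logCoord, abs_mul, abs_of_neg (by linarith : Real.log (normAtPlace w x) < 0),
          abs_of_pos (by linarith [hmult w])] at this
        nlinarith [hmult w]
      · push Not at h0
        obtain ⟨w', hw'⟩ := h0
        apply kern_eq_zero_of_norm
        rw [mixedEmbedding.norm_apply]
        exact Finset.prod_eq_zero (Finset.mem_univ w') (by rw [hw']; simp)
  have hLgL : LipschitzWith (2 * (ε⁻¹).toNNReal) Lg := by
    refine LipschitzWith.of_dist_le_mul fun x y => ?_
    refine (dist_pi_le_iff (by positivity)).2 fun w => ?_
    have h1 := (lipschitzWith_log_max hε0).dist_le_mul (normAtPlace w x) (normAtPlace w y)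
    have h2 : dist (normAtPlace w x) (normAtPlace w y) ≤ dist x y := by
      have h3 : ∀ z : mixedSpace E, normAtPlace w z ≤ ‖z‖ := fun z => by
        rw [norm_eq_sup'_normAtPlace]
        exact Finset.le_sup' (fun w => normAtPlace w z) (Finset.mem_univ w)
      rw [Real.dist_eq, dist_eq_norm, abs_le]
      have h4 := normAtPlace_add_le w (x - y) y
      have h5 := normAtPlace_add_le w (y - x) x
      rw [sub_add_cancel] at h4 h5
      have h6 := h3 (y - x)
      rw [norm_sub_rev] at h6
      constructor <;> linarith [h3 (x - y)]
    rw [hLg, Real.dist_eq]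
    beta_reduce
    rw [Real.dist_eq] at h1
    rw [← mul_sub, abs_mul, abs_of_pos (by linarith [hmult w])]
    have h7 : (w.mult : ℝ) ≤ 2 := by
      have : w.mult ≤ 2 := by unfold mult; split_ifs <;> norm_num
      exact_mod_cast this
    push_cast
    calc (w.mult : ℝ) * _ ≤ 2 * ((ε⁻¹).toNNReal * dist x y) := by
          apply mul_le_mul h7 _ (abs_nonneg _) (by norm_num)
          exact h1.trans (by gcongr)
      _ = _ := by ring
  refine ⟨K * (2 * (ε⁻¹).toNNReal), Real.exp M, ?_, (Real.exp_pos M).le, fun x hx => ?_⟩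
  · have := hK.comp hLgL
    rwa [show h ∘ Lg = kern from funext fun x => (hkL x).symm] at this
  · rw [hkL]
    by_contra hne
    have hb := hM _ hne
    have : ‖x‖ ≤ Real.exp M := by
      rw [norm_eq_sup'_normAtPlace]
      refine Finset.sup'_le _ _ fun w _ => ?_
      have h1 := le_of_abs_le (hb w)
      rw [hLg] at h1
      beta_reduce at h1
      have h2 : Real.log (max (normAtPlace w x) ε) ≤ M := by
        by_contra! h3
        nlinarith [hmult w]
      have h4 := (Real.log_le_iff_le_exp (lt_max_of_lt_right hε0)).1 h2
      exact (le_max_left _ _).trans h4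
    linarith

end

end IdealCount

namespace IdealCount

open Module NumberField NumberField.InfinitePlace NumberField.mixedEmbedding
  NumberField.Units NumberField.Units.dirichletUnitTheorem NumberField.mixedEmbedding.fundamentalCone

section

variable {E : Type*} [Field E] [NumberField E]

lemma logCoord_mul {x y : mixedSpace E} (hx : ∀ w, normAtPlace w x ≠ 0)
    (hy : ∀ w, normAtPlace w y ≠ 0) : logCoord (x * y) = logCoord x + logCoord y := by
  funext w
  simp only [logCoord, Pi.add_apply, map_mul]
  rw [Real.log_mul (hx w) (hy w), mul_add]

lemma normAtPlace_unit_ne_zero (u : (𝓞 E)ˣ) (w : InfinitePlace E) :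
    normAtPlace w (mixedEmbedding E (u : E)) ≠ 0 := by
  rw [normAtPlace_apply]
  exact (map_ne_zero w).2 (coe_ne_zero u)

lemma logCoord_unit (u : (𝓞 E)ˣ) (w : InfinitePlace E) :
    logCoord (mixedEmbedding E (u : E)) w = w.mult * Real.log (w (u : E)) := by
  rw [logCoord, normAtPlace_apply]

/-- The unit with the given coordinates with respect to the fundamental system. -/
noncomputable def unitOfCoord (c : torsion E × (Fin (rank E) → ℤ)) : (𝓞 E)ˣ :=
  c.1 * ∏ i, (fundSystem E i) ^ (c.2 i)

lemma unitOfCoord_bijective : Function.Bijective (unitOfCoord (E := E)) := by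
  refine ⟨fun a b h => ?_, fun u => ?_⟩
  · obtain ⟨c, -, hc⟩ := exist_unique_eq_mul_prod E (unitOfCoord a)
    rw [hc a rfl, hc b h]
  · obtain ⟨c, hc, -⟩ := exist_unique_eq_mul_prod E u
    exact ⟨c, hc.symm⟩

lemma logCoord_unitOfCoord (c : torsion E × (Fin (rank E) → ℤ)) :
    logCoord (mixedEmbedding E (unitOfCoord c : E)) =
      ∑ i, (c.2 i : ℝ) • completeBasis E (fundamentalCone.equivFinRank (K := E) i) := by
  funext w
  rw [logCoord_unit, Finset.sum_apply]
  simp only [Pi.smul_apply, smul_eq_mul, completeBasis_apply_of_ne, expMap_symm_apply,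
    Equiv.symm_apply_apply, normAtAllPlaces_apply, normAtPlace_apply]
  have h1 : w ((unitOfCoord c : (𝓞 E)ˣ) : E) = ∏ i, w (fundSystem E i : E) ^ (c.2 i) := by
    let φ : (𝓞 E)ˣ →* ℝ := (MonoidHomClass.toMonoidHom w : E →* ℝ).comp
      ((algebraMap (𝓞 E) E).toMonoidHom.comp (Units.coeHom (𝓞 E)))
    have hφ : ∀ u, φ u = w (u : E) := fun _ => rfl
    simp only [← hφ]
    rw [unitOfCoord, map_mul, map_prod, hφ, (mem_torsion E).1 c.1.2 w, one_mul]
    exact Finset.prod_congr rfl fun i _ => map_zpow φ _ _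
  rw [h1, Real.log_prod (fun i _ => zpow_ne_zero _ ((map_ne_zero w).2 (coe_ne_zero _))),
    Finset.mul_sum]
  refine Finset.sum_congr rfl fun i _ => ?_
  rw [Real.log_zpow]; ring

open scoped Classical in
lemma kern_unitOfCoord_mul {x : mixedSpace E} (hx : ∀ w, normAtPlace w x ≠ 0)
    (c : torsion E × (Fin (rank E) → ℤ)) :
    kern (mixedEmbedding E (unitOfCoord c : E) * x) = bump (mixedEmbedding.norm x) *
      ∏ i, tent ((completeBasis E).repr (logCoord x) (fundamentalCone.equivFinRank (K := E) i) + c.2 i) := by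
  rw [kern, ← unitSMul_smul, norm_unit_smul, unitSMul_smul,
    logCoord_mul (normAtPlace_unit_ne_zero _) hx, cone, logCoord_unitOfCoord]
  congr 1
  rw [← Equiv.prod_comp (fundamentalCone.equivFinRank (K := E))]
  refine Finset.prod_congr rfl fun i _ => ?_
  congr 1
  rw [map_add, Finsupp.add_apply, map_sum, Finsupp.finsetSum_apply, Finset.sum_eq_single i]
  · simp [add_comm]
  · intro j _ hj
    have : (fundamentalCone.equivFinRank (K := E) j : InfinitePlace E) ≠ fundamentalCone.equivFinRank (K := E) i :=
      fun h => hj ((fundamentalCone.equivFinRank (K := E)).injective (Subtype.ext h))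
    simp [this]
  · simp

/-- Summing the test function over an orbit of the unit group. -/
lemma finsum_kern_unit {x : mixedSpace E} (hx : ∀ w, normAtPlace w x ≠ 0) :
    ∑ᶠ u : (𝓞 E)ˣ, kern (mixedEmbedding E (u : E) * x) =
      torsionOrder E * bump (mixedEmbedding.norm x) := by
  classical
  have : Fintype (torsion E) := Fintype.ofFinite _
  let t : Fin (rank E) → ℝ := fun i =>
    (completeBasis E).repr (logCoord x) (fundamentalCone.equivFinRank (K := E) i)
  let T : Fin (rank E) → Finset ℤ := fun i => {-⌊t i⌋, -⌊t i⌋ - 1}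
  rw [← finsum_eq_of_bijective (f := fun c => bump (mixedEmbedding.norm x) *
    ∏ i, tent (t i + c.2 i)) _ unitOfCoord_bijective (fun c => (kern_unitOfCoord_mul hx c).symm),
    finsum_eq_sum_of_support_subset (s := Finset.univ ×ˢ Fintype.piFinset T)]
  · rw [Finset.sum_product]
    simp only
    rw [Finset.sum_const, ← Finset.mul_sum, ← Finset.prod_univ_sum T (fun i e => tent (t i + e)),
      Finset.prod_congr rfl (fun i _ => sum_tent_add_floor (t i))]
    simp [torsionOrder, Nat.card_eq_fintype_card]
  · intro c hc
    simp only [Finset.coe_product, Finset.coe_univ, Set.mem_prod, Set.mem_univ, true_and,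
      Finset.mem_coe, Fintype.mem_piFinset]
    intro i
    by_contra hi
    exact hc (by
      simp only
      rw [Finset.prod_eq_zero (Finset.mem_univ i) (tent_add_int_eq_zero hi), mul_zero])

/-- Summing the test function over the generators of a principal ideal. -/
lemma finsum_kern_generators {α₀ : 𝓞 E} (hα₀ : α₀ ≠ 0) {Y : ℝ} (hY : 0 < Y) :
    ∑ᶠ α ∈ {α : 𝓞 E | Ideal.span {α} = Ideal.span {α₀}}, kern (Y⁻¹ • mixedEmbedding E (α : E)) =
      torsionOrder E * bump (Ideal.absNorm (Ideal.span {α₀}) / Y ^ finrank ℚ E) := by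
  have h1 : {α : 𝓞 E | Ideal.span {α} = Ideal.span {α₀}} =
      Set.range fun u : (𝓞 E)ˣ => (u : 𝓞 E) * α₀ := by
    ext α
    rw [Set.mem_ofPred_eq, Ideal.span_singleton_eq_span_singleton, Set.mem_range]
    constructor
    · intro h
      obtain ⟨u, hu⟩ := h.symm
      exact ⟨u, by rw [mul_comm]; exact hu⟩
    · rintro ⟨u, rfl⟩
      exact Associated.symm ⟨u, mul_comm _ _⟩
  have h2 : Function.Injective fun u : (𝓞 E)ˣ => (u : 𝓞 E) * α₀ := fun u v h =>
    Units.ext (mul_right_cancel₀ hα₀ h)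
  have h3 : (α₀ : E) ≠ 0 := by exact_mod_cast hα₀
  have hx : ∀ w, normAtPlace w (Y⁻¹ • mixedEmbedding E (α₀ : E)) ≠ 0 := fun w => by
    rw [normAtPlace_smul, normAtPlace_apply]
    exact mul_ne_zero (abs_ne_zero.2 (inv_ne_zero hY.ne')) ((map_ne_zero w).2 h3)
  rw [h1, finsum_mem_range h2]
  have h4 := finsum_kern_unit hx
  rw [mixedEmbedding.norm_smul, mixedEmbedding.norm_eq_norm, abs_of_pos (inv_pos.2 hY)] at h4
  rw [Ideal.absNorm_span_singleton]
  convert h4 using 3 with u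
  · rw [show ((u * α₀ : 𝓞 E) : E) = (u : E) * (α₀ : E) from map_mul _ _ _, map_mul,
      mul_smul_comm]
  · rw [inv_pow, div_eq_inv_mul, ← Algebra.coe_norm_int]
    simp

lemma kern_eq_zero_of_le {x : mixedSpace E} (hx : 1 ≤ mixedEmbedding.norm x) : kern x = 0 := by
  rw [kern, bump_of_ge hx, zero_mul]

/-- Summing the test function over an ideal. -/
lemma finsum_kern_ideal (J : Ideal (𝓞 E)) {Y : ℝ} (hY : 0 < Y)
    (hfin : {α : 𝓞 E | α ∈ J ∧ kern (Y⁻¹ • mixedEmbedding E (α : E)) ≠ 0}.Finite)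
    (T : Finset (Ideal (𝓞 E)))
    (hT : ∀ I, I ∈ T ↔ I ≠ ⊥ ∧ J ∣ I ∧ Submodule.IsPrincipal I ∧
      (Ideal.absNorm I : ℝ) ≤ Y ^ finrank ℚ E) :
    ∑ α ∈ hfin.toFinset, kern (Y⁻¹ • mixedEmbedding E (α : E)) =
      torsionOrder E * ∑ I ∈ T, bump (Ideal.absNorm I / Y ^ finrank ℚ E) := by
  classical
  rw [Finset.mul_sum, ← Finset.sum_fiberwise_of_maps_to (t := T) (g := fun α => Ideal.span {α})]
  · refine Finset.sum_congr rfl fun I hI => ?_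
    obtain ⟨h0, hJ, ⟨α₀, hα₀⟩, -⟩ := (hT I).1 hI
    change I = Ideal.span {α₀} at hα₀
    have hα : α₀ ≠ 0 := by rintro rfl; exact h0 (by simpa using hα₀)
    rw [hα₀, ← finsum_kern_generators hα hY]
    refine (finsum_mem_eq_sum_of_inter_support_eq _ ?_).symm
    ext α
    simp only [Set.mem_inter_iff, Set.mem_ofPred_eq, Function.mem_support, Finset.coe_filter,
      Set.Finite.mem_toFinset]
    have : Ideal.span {α} = Ideal.span {α₀} → α ∈ J := fun h =>
      Ideal.dvd_iff_le.1 (hJ.trans (hα₀ ▸ dvd_refl _)) (h ▸ Ideal.mem_span_singleton_self α)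
    tauto
  · intro α hα
    obtain ⟨hJ, hk⟩ := (Set.Finite.mem_toFinset _).1 hα
    refine (hT _).2 ⟨?_, ?_, ⟨α, rfl⟩, ?_⟩
    · intro h
      rw [Ideal.span_singleton_eq_bot] at h
      subst h
      refine hk (kern_eq_zero_of_norm ?_)
      simp
    · rwa [Ideal.dvd_iff_le, Ideal.span_singleton_le_iff_mem]
    · by_contra! h
      refine hk (kern_eq_zero_of_le ?_)
      rw [mixedEmbedding.norm_smul, mixedEmbedding.norm_eq_norm, abs_of_pos (inv_pos.2 hY),
        inv_pow, ← div_eq_inv_mul, one_le_div (by positivity)]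
      rw [Ideal.absNorm_span_singleton] at h
      refine h.le.trans (le_of_eq ?_)
      rw [← Algebra.coe_norm_int]
      simp

end

end IdealCount

namespace IdealCount

open Module NumberField NumberField.InfinitePlace NumberField.mixedEmbedding
  NumberField.Units

open scoped nonZeroDivisors

section

variable {E : Type*} [Field E] [NumberField E]

lemma mem_span_latticeBasis_iff (J : (Ideal (𝓞 E))⁰) (x : mixedSpace E) :
    x ∈ Submodule.span ℤ (Set.range (fractionalIdealLatticeBasis E (FractionalIdeal.mk0 E J))) ↔
      ∃ α ∈ (J : Ideal (𝓞 E)), mixedEmbedding E (α : E) = x := by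
  rw [mem_span_fractionalIdealLatticeBasis]
  constructor
  · rintro ⟨a, ha, rfl⟩
    rw [FractionalIdeal.coe_mk0] at ha
    obtain ⟨α, hα, rfl⟩ := (FractionalIdeal.mem_coeIdeal _).1 ha
    exact ⟨α, hα, rfl⟩
  · rintro ⟨α, hα, rfl⟩
    refine ⟨α, ?_, rfl⟩
    rw [FractionalIdeal.coe_mk0]
    exact (FractionalIdeal.mem_coeIdeal _).2 ⟨α, hα, rfl⟩

lemma exists_principal_sum (J : (Ideal (𝓞 E))⁰) : ∃ κ C : ℝ, 0 ≤ C ∧ ∀ Y : ℝ, 1 ≤ Y →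
    ∀ T : Finset (Ideal (𝓞 E)),
    (∀ I, I ∈ T ↔ I ≠ ⊥ ∧ (J : Ideal (𝓞 E)) ∣ I ∧ Submodule.IsPrincipal I ∧
      (Ideal.absNorm I : ℝ) ≤ Y ^ finrank ℚ E) →
    |∑ I ∈ T, bump (Ideal.absNorm I / Y ^ finrank ℚ E) - κ * Y ^ finrank ℚ E| ≤
      C * Y ^ (finrank ℚ E - 1) := by
  classical
  obtain ⟨K, B, hK, hB, hkB⟩ := exists_lipschitzWith_kern (E := E)
  have hd : 0 < finrank ℝ (mixedSpace E) := by
    rw [mixedEmbedding.finrank]; exact finrank_pos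
  obtain ⟨C, hC, h⟩ := lattice_sum_sub_integral_le MeasureTheory.volume
    (fractionalIdealLatticeBasis E (FractionalIdeal.mk0 E J)) hd hK hB hkB
  set D := MeasureTheory.volume.real (ZSpan.fundamentalDomain
    (fractionalIdealLatticeBasis E (FractionalIdeal.mk0 E J))) with hD
  have hD0 : 0 < D := by
    refine ENNReal.toReal_pos (ZSpan.measure_fundamentalDomain_ne_zero _) ?_
    exact (ZSpan.fundamentalDomain_isBounded _).measure_lt_top.ne
  have ht : (0:ℝ) < torsionOrder E := by exact_mod_cast torsionOrder_pos E
  refine ⟨(D * torsionOrder E)⁻¹ * ∫ x, kern (E := E) x, (D * torsionOrder E)⁻¹ * C, by positivity,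
    fun Y hY T hT => ?_⟩
  have hY0 : 0 < Y := by linarith
  obtain ⟨s, hs, hsum⟩ := h Y hY
  rw [mixedEmbedding.finrank] at hsum
  have hlift : ∀ α : 𝓞 E, α ∈ (J : Ideal (𝓞 E)) → ∃ v : Submodule.span ℤ
      (Set.range (fractionalIdealLatticeBasis E (FractionalIdeal.mk0 E J))),
      (v : mixedSpace E) = mixedEmbedding E (α : E) := fun α hα =>
    ⟨⟨_, (mem_span_latticeBasis_iff J _).2 ⟨α, hα, rfl⟩⟩, rfl⟩
  choose! lift hlift' using hlift
  have hmem : ∀ α : 𝓞 E, α ∈ (J : Ideal (𝓞 E)) ∧ kern (Y⁻¹ • mixedEmbedding E (α : E)) ≠ 0 →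
      ∃ v ∈ s, (v : mixedSpace E) = mixedEmbedding E (α : E) := by
    intro α hα
    refine ⟨lift α, by_contra fun hvs => hα.2 ?_, hlift' α hα.1⟩
    rw [← hlift' α hα.1]
    exact hs _ hvs
  have hinj : Function.Injective fun α : 𝓞 E => mixedEmbedding E (α : E) :=
    (mixedEmbedding_injective E).comp RingOfIntegers.coe_injective
  have hfin : {α : 𝓞 E | α ∈ (J : Ideal (𝓞 E)) ∧
      kern (Y⁻¹ • mixedEmbedding E (α : E)) ≠ 0}.Finite := by
    refine Set.Finite.of_finite_image (f := fun α : 𝓞 E => mixedEmbedding E (α : E)) ?_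
      hinj.injOn
    refine (s.finite_toSet.image Subtype.val).subset ?_
    rintro _ ⟨α, hα, rfl⟩
    obtain ⟨v, hv, hv'⟩ := hmem α hα
    exact ⟨v, hv, hv'⟩
  have hswap : ∑ v ∈ s, kern (Y⁻¹ • (v : mixedSpace E)) =
      ∑ α ∈ hfin.toFinset, kern (Y⁻¹ • mixedEmbedding E (α : E)) := by
    symm
    have hl : ∀ α ∈ hfin.toFinset, (lift α : mixedSpace E) = mixedEmbedding E (α : E) :=
      fun α hα => hlift' α ((Set.Finite.mem_toFinset hfin).1 hα).1
    refine Finset.sum_bij_ne_zero (fun α _ _ => lift α) ?_ ?_ ?_ ?_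
    · intro α hα _
      obtain ⟨v, hv, hv'⟩ := hmem α ((Set.Finite.mem_toFinset hfin).1 hα)
      have : lift α = v := Subtype.ext ((hl α hα).trans hv'.symm)
      rwa [this]
    · intro α hα _ β hβ _ hαβ
      exact hinj ((hl α hα).symm.trans ((congrArg Subtype.val hαβ).trans (hl β hβ)))
    · intro v hv hk
      obtain ⟨α, hα, hα'⟩ := (mem_span_latticeBasis_iff J _).1 v.2
      have h1 : kern (Y⁻¹ • mixedEmbedding E (α : E)) ≠ 0 := by rwa [hα']
      exact ⟨α, (Set.Finite.mem_toFinset hfin).2 ⟨hα, h1⟩, h1,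
        Subtype.ext ((hlift' α hα).trans hα')⟩
    · intro α hα _
      rw [hl α hα]
  rw [hswap, finsum_kern_ideal _ hY0 hfin T hT] at hsum
  set S := ∑ I ∈ T, bump (Ideal.absNorm I / Y ^ finrank ℚ E)
  have h1 : S - (D * torsionOrder E)⁻¹ * (∫ x, kern (E := E) x) * Y ^ finrank ℚ E =
      (D * torsionOrder E)⁻¹ * (D * (torsionOrder E * S) - Y ^ finrank ℚ E * ∫ x, kern (E := E) x) := by
    field_simp
  rw [h1, abs_mul, abs_of_pos (by positivity), mul_assoc]
  exact mul_le_mul_of_nonneg_left hsum (by positivity)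

lemma exists_class_sum (c : ClassGroup (𝓞 E)) : ∃ κ C : ℝ, 0 ≤ C ∧ ∀ y : ℝ, 1 ≤ y →
    ∀ T : Finset (Ideal (𝓞 E))⁰, (∀ I, I ∈ T ↔ (Ideal.absNorm (I : Ideal (𝓞 E)) : ℝ) ≤ y ∧
      ClassGroup.mk0 I = c) →
    |∑ I ∈ T, bump (Ideal.absNorm (I : Ideal (𝓞 E)) / y) - κ * y| ≤
      C * y ^ (max (1 - 1 / finrank ℚ E : ℝ) (1 / 2)) := by
  classical
  obtain ⟨J, hJ⟩ := ClassGroup.mk0_surjective c⁻¹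
  obtain ⟨κ, C, hC, h⟩ := exists_principal_sum J
  set N : ℝ := (Ideal.absNorm (J : Ideal (𝓞 E)) : ℝ) with hN
  have hN1 : 1 ≤ N := by
    rw [hN]; exact_mod_cast Nat.one_le_iff_ne_zero.2 (Ideal.absNorm_ne_zero_of_nonZeroDivisors J)
  have hd : (0:ℝ) < finrank ℚ E := by exact_mod_cast (finrank_pos : 0 < finrank ℚ E)
  refine ⟨κ * N, C * N, by positivity, fun y hy T hT => ?_⟩
  set Y : ℝ := (y * N) ^ (1 / finrank ℚ E : ℝ) with hYdef
  have hyN : 1 ≤ y * N := one_le_mul_of_one_le_of_one_le hy hN1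
  have hY : 1 ≤ Y := Real.one_le_rpow hyN (by positivity)
  have hYd : Y ^ finrank ℚ E = y * N := by
    rw [hYdef, ← Real.rpow_natCast, ← Real.rpow_mul (by positivity), one_div_mul_cancel hd.ne',
      Real.rpow_one]
  have hinj : Function.Injective fun I : (Ideal (𝓞 E))⁰ => (J : Ideal (𝓞 E)) * (I : Ideal (𝓞 E)) := fun A B hAB =>
    Subtype.ext (mul_left_cancel₀ (nonZeroDivisors.coe_ne_zero J) hAB)
  have hprin : ∀ I : (Ideal (𝓞 E))⁰, Submodule.IsPrincipal ((J : Ideal (𝓞 E)) * (I : Ideal (𝓞 E))) ↔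
      ClassGroup.mk0 I = c := by
    intro I
    rw [← Submonoid.coe_mul, ← ClassGroup.mk0_eq_one_iff (SetLike.coe_mem _)]
    change ClassGroup.mk0 (J * I) = 1 ↔ _
    rw [map_mul, hJ, inv_mul_eq_one, eq_comm]
  have h1 := h Y hY (T.image fun I : (Ideal (𝓞 E))⁰ => (J : Ideal (𝓞 E)) * (I : Ideal (𝓞 E))) (fun I => by
    rw [hYd, Finset.mem_image]
    constructor
    · rintro ⟨A, hA, rfl⟩
      obtain ⟨hA1, hA2⟩ := (hT A).1 hA
      refine ⟨mul_ne_zero (nonZeroDivisors.coe_ne_zero J) (nonZeroDivisors.coe_ne_zero A),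
        dvd_mul_right _ _, (hprin A).2 hA2, ?_⟩
      rw [map_mul, Nat.cast_mul, mul_comm]
      exact mul_le_mul_of_nonneg_right hA1 (by positivity)
    · rintro ⟨h0, ⟨A, rfl⟩, hp, hn⟩
      have hA0 : A ≠ 0 := right_ne_zero_of_mul h0
      refine ⟨⟨A, mem_nonZeroDivisors_of_ne_zero hA0⟩, (hT _).2 ⟨?_, (hprin ⟨A, _⟩).1 hp⟩, rfl⟩
      rw [map_mul, Nat.cast_mul, mul_comm] at hn
      exact le_of_mul_le_mul_right hn (by positivity))
  rw [Finset.sum_image hinj.injOn, hYd] at h1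
  have h2 : ∀ I : (Ideal (𝓞 E))⁰, bump (Ideal.absNorm ((J : Ideal (𝓞 E)) * (I : Ideal (𝓞 E))) / (y * N)) =
      bump (Ideal.absNorm (I : Ideal (𝓞 E)) / y) := by
    intro I
    rw [map_mul, Nat.cast_mul, mul_comm y, mul_div_mul_left _ _ (by positivity)]
  simp only [h2] at h1
  rw [mul_assoc, mul_comm N y]
  refine h1.trans ?_
  rw [mul_assoc]
  refine mul_le_mul_of_nonneg_left ?_ hC
  set b : ℝ := max (1 - 1 / finrank ℚ E : ℝ) (1 / 2) with hb
  have hb1 : b ≤ 1 := max_le (by have := one_div_pos.2 hd; linarith) (by norm_num)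
  have h3 : Y ^ (finrank ℚ E - 1) = (y * N) ^ (1 - 1 / finrank ℚ E : ℝ) := by
    rw [hYdef, ← Real.rpow_natCast, ← Real.rpow_mul (by positivity),
      Nat.cast_sub (finrank_pos : 0 < finrank ℚ E)]
    congr 1
    field_simp
    simp
  rw [h3]
  calc (y * N) ^ (1 - 1 / finrank ℚ E : ℝ) ≤ (y * N) ^ b :=
        Real.rpow_le_rpow_of_exponent_le hyN (le_max_left _ _)
    _ = y ^ b * N ^ b := Real.mul_rpow (by linarith) (by linarith)
    _ ≤ y ^ b * N := mul_le_mul_of_nonneg_left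
        ((Real.rpow_le_rpow_of_exponent_le hN1 hb1).trans_eq (Real.rpow_one N)) (by positivity)
    _ = N * y ^ b := mul_comm _ _

variable (E) in
/-- A smoothed count of the nonzero ideals with a power saving. -/
theorem exists_ideal_sum : ∃ κ C b : ℝ, 0 ≤ C ∧ 0 < b ∧ b < 1 ∧ ∀ y : ℝ, 1 ≤ y →
    ∀ T : Finset (Ideal (𝓞 E))⁰, (∀ I, I ∈ T ↔ (Ideal.absNorm (I : Ideal (𝓞 E)) : ℝ) ≤ y) →
    |∑ I ∈ T, bump (Ideal.absNorm (I : Ideal (𝓞 E)) / y) - κ * y| ≤ C * y ^ b := by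
  classical
  choose κ C hC h using exists_class_sum (E := E)
  have hd : (0:ℝ) < finrank ℚ E := by exact_mod_cast (finrank_pos : 0 < finrank ℚ E)
  refine ⟨∑ c, κ c, ∑ c, C c, max (1 - 1 / finrank ℚ E : ℝ) (1 / 2),
    Finset.sum_nonneg fun c _ => hC c, lt_max_of_lt_right (by norm_num),
    max_lt (by have := one_div_pos.2 hd; linarith) (by norm_num), fun y hy T hT => ?_⟩
  rw [← Finset.sum_fiberwise_of_maps_to (t := Finset.univ) (g := ClassGroup.mk0)
    (fun _ _ => Finset.mem_univ _), Finset.sum_mul, Finset.sum_mul, ← Finset.sum_sub_distrib]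
  refine (Finset.abs_sum_le_sum_abs _ _).trans (Finset.sum_le_sum fun c _ => ?_)
  exact h c y hy _ fun I => by rw [Finset.mem_filter, hT]

end

end IdealCount

namespace IdealCount

open Module NumberField IsDedekindDomain Filter

open ArithSemigroup

open scoped nonZeroDivisors

variable (E : Type*) [Field E] [NumberField E]

/-- The absolute norm of a prime. -/
noncomputable def primeNorm (v : HeightOneSpectrum (𝓞 E)) : ℕ := Ideal.absNorm v.asIdeal

variable {E}

lemma two_le_primeNorm (v : HeightOneSpectrum (𝓞 E)) : 2 ≤ primeNorm E v := by
  have h0 : primeNorm E v ≠ 0 := fun h => v.ne_bot (Ideal.absNorm_eq_zero_iff.1 h)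
  have h1 : primeNorm E v ≠ 1 := fun h => v.isPrime.ne_top (Ideal.absNorm_eq_one_iff.1 h)
  omega

/-- The ideal with the given prime factorization. -/
noncomputable def idealOf (f : HeightOneSpectrum (𝓞 E) →₀ ℕ) : Ideal (𝓞 E) :=
  ((Finsupp.toMultiset f).map HeightOneSpectrum.asIdeal).prod

lemma normalizedFactors_idealOf (f : HeightOneSpectrum (𝓞 E) →₀ ℕ) :
    UniqueFactorizationMonoid.normalizedFactors (idealOf f) =
      (Finsupp.toMultiset f).map HeightOneSpectrum.asIdeal := by
  refine UniqueFactorizationMonoid.normalizedFactors_prod_of_prime fun p hp => ?_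
  obtain ⟨v, -, rfl⟩ := Multiset.mem_map.1 hp
  exact v.prime

lemma idealOf_injective : Function.Injective (idealOf (E := E)) := fun f g h => by
  classical
  have h1 := normalizedFactors_idealOf f
  rw [h, normalizedFactors_idealOf] at h1
  exact ((Multiset.toFinsupp (α := HeightOneSpectrum (𝓞 E))).symm.injective (Multiset.map_injective
    (fun _ _ h => HeightOneSpectrum.ext h) h1)).symm

lemma idealOf_ne_zero (f : HeightOneSpectrum (𝓞 E) →₀ ℕ) : idealOf f ≠ 0 := by
  refine Multiset.prod_ne_zero fun h => ?_
  obtain ⟨v, -, hv⟩ := Multiset.mem_map.1 h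
  exact v.ne_bot hv

lemma exists_idealOf_eq {I : Ideal (𝓞 E)} (hI : I ≠ 0) : ∃ f, idealOf f = I := by
  have h : ∀ q ∈ UniqueFactorizationMonoid.normalizedFactors I,
      ∃ v : HeightOneSpectrum (𝓞 E), v.asIdeal = q := fun q hq => by
    have := UniqueFactorizationMonoid.prime_of_normalized_factor q hq
    exact ⟨⟨q, Ideal.isPrime_of_prime this, this.ne_zero⟩, rfl⟩
  classical
  obtain ⟨s, hs⟩ : ∃ s : Multiset (HeightOneSpectrum (𝓞 E)),
      s.map HeightOneSpectrum.asIdeal = UniqueFactorizationMonoid.normalizedFactors I := by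
    generalize UniqueFactorizationMonoid.normalizedFactors I = t at h
    induction t using Multiset.induction_on with
    | empty => exact ⟨0, rfl⟩
    | cons a t ih =>
      obtain ⟨s, hs⟩ := ih fun q hq => h q (Multiset.mem_cons_of_mem hq)
      obtain ⟨v, hv⟩ := h a (Multiset.mem_cons_self _ _)
      exact ⟨v ::ₘ s, by rw [Multiset.map_cons, hs, hv]⟩
  refine ⟨Multiset.toFinsupp s, ?_⟩
  rw [idealOf, Multiset.toFinsupp_toMultiset, hs]
  exact associated_iff_eq.1 (UniqueFactorizationMonoid.prod_normalizedFactors hI)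

lemma absNorm_idealOf (f : HeightOneSpectrum (𝓞 E) →₀ ℕ) :
    Ideal.absNorm (idealOf f) = freeNorm (primeNorm E) f := by
  classical
  rw [idealOf, map_multiset_prod, Multiset.map_map, freeNorm, Finsupp.prod,
    ← Finsupp.toFinset_toMultiset, Finset.prod_multiset_map_count]
  refine Finset.prod_congr rfl fun v _ => ?_
  rw [Finsupp.count_toMultiset]
  rfl

/-- Prime factorization as a bijection onto the nonzero ideals. -/
noncomputable def idealEquiv : (HeightOneSpectrum (𝓞 E) →₀ ℕ) ≃ (Ideal (𝓞 E))⁰ :=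
  Equiv.ofBijective (fun f => ⟨idealOf f, mem_nonZeroDivisors_of_ne_zero (idealOf_ne_zero f)⟩)
    ⟨fun _ _ h => idealOf_injective (congrArg Subtype.val h), fun I => by
      obtain ⟨f, hf⟩ := exists_idealOf_eq (nonZeroDivisors.coe_ne_zero I)
      exact ⟨f, Subtype.ext hf⟩⟩

lemma absNorm_idealEquiv (f : HeightOneSpectrum (𝓞 E) →₀ ℕ) :
    Ideal.absNorm (idealEquiv f : Ideal (𝓞 E)) = freeNorm (primeNorm E) f :=
  absNorm_idealOf f

lemma finite_freeNorm_le (x : ℝ) :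
    {f : HeightOneSpectrum (𝓞 E) →₀ ℕ | (freeNorm (primeNorm E) f : ℝ) ≤ x}.Finite := by
  have h := Ideal.finite_setOfPred_absNorm_le (S := 𝓞 E) ⌊x⌋₊
  refine Set.Finite.of_finite_image (f := idealOf) (h.subset ?_) idealOf_injective.injOn
  rintro _ ⟨f, hf, rfl⟩
  rw [Set.mem_ofPred_eq, absNorm_idealOf]
  exact Nat.le_floor hf

lemma ncard_freeNorm_le (x : ℝ) :
    {f : HeightOneSpectrum (𝓞 E) →₀ ℕ | (freeNorm (primeNorm E) f : ℝ) ≤ x}.ncard =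
      Nat.card {I : (Ideal (𝓞 E))⁰ // (Ideal.absNorm (I : Ideal (𝓞 E)) : ℝ) ≤ x} := by
  rw [← Nat.card_coe_set_eq]
  exact Nat.card_congr (idealEquiv.subtypeEquiv fun f => by
    rw [Set.mem_ofPred_eq, absNorm_idealEquiv])

variable (E) in
/-- Upper and lower bounds for the number of primes of a number field. The upper constant does
not depend on the field. -/
theorem primes_bounds :
    (∃ c > 0, ∀ᶠ x : ℝ in atTop,
      c * x ≤ {v : HeightOneSpectrum (𝓞 E) | (primeNorm E v : ℝ) ≤ x}.ncard * Real.log x) ∧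
    ∀ᶠ x : ℝ in atTop,
      {v : HeightOneSpectrum (𝓞 E) | (primeNorm E v : ℝ) ≤ x}.ncard * Real.log x ≤ 7 * x := by
  obtain ⟨κ, C, b, hC, hb, hb1, h⟩ := exists_ideal_sum E
  let 𝒮 := free (primeNorm E) two_le_primeNorm finite_freeNorm_le
  obtain ⟨κ', C', δ, hδ, hδ1, hC', h'⟩ := 𝒮.count_of_bump hb hb1 hC (κ := κ) fun y hy => by
    have h1 := h y hy ((𝒮.ball y).map idealEquiv.toEmbedding) fun I => by
      rw [Finset.mem_map_equiv, ArithSemigroup.mem_ball]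
      obtain ⟨f, rfl⟩ := idealEquiv.surjective I
      rw [Equiv.symm_apply_apply, absNorm_idealEquiv]
      rfl
    rw [Finset.sum_map] at h1
    simp only [Equiv.coe_toEmbedding, absNorm_idealEquiv] at h1
    exact h1
  have hcount : ∀ x, 1 ≤ x → |({f : HeightOneSpectrum (𝓞 E) →₀ ℕ |
      (freeNorm (primeNorm E) f : ℝ) ≤ x}.ncard : ℝ) - κ' * x| ≤ C' * x ^ (1 - δ) := by
    intro x hx
    convert h' x hx using 4
    rw [ArithSemigroup.count, ArithSemigroup.ball, Set.ncard_eq_toFinset_card _ (finite_freeNorm_le x)]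
    rfl
  refine prime_bounds (primeNorm E) two_le_primeNorm finite_freeNorm_le ?_ hδ hδ1 hC' hcount
  have hlim : Tendsto (fun x : ℝ => ({f : HeightOneSpectrum (𝓞 E) →₀ ℕ |
      (freeNorm (primeNorm E) f : ℝ) ≤ x}.ncard : ℝ) / x) atTop (nhds κ') := by
    rw [tendsto_iff_norm_sub_tendsto_zero]
    have h0 : Tendsto (fun x : ℝ => C' * x ^ (-δ)) atTop (nhds 0) := by
      simpa using (tendsto_rpow_neg_atTop hδ).const_mul C'
    refine squeeze_zero' (Eventually.of_forall fun _ => norm_nonneg _) ?_ h0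
    filter_upwards [eventually_ge_atTop 1] with x hx
    have hx0 : 0 < x := by linarith
    have h2 := hcount x hx
    rw [Real.norm_eq_abs, div_sub' hx0.ne', abs_div, abs_of_pos hx0, div_le_iff₀ hx0,
      mul_comm x κ', mul_assoc]
    refine h2.trans_eq ?_
    rw [sub_eq_neg_add, Real.rpow_add hx0, Real.rpow_one]
  have hlim' := NumberField.Ideal.tendsto_norm_le_div_atTop₀ E
  have h3 := tendsto_nhds_unique hlim (hlim'.congr fun x => by rw [ncard_freeNorm_le])
  rw [h3]
  have h4 := Units.regulator_pos E
  have h5 : (0:ℝ) < classNumber E := by exact_mod_cast classNumber_pos E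
  have h6 : (0:ℝ) < Units.torsionOrder E := by exact_mod_cast Units.torsionOrder_pos E
  have h7 : (0:ℝ) < |discr E| := by exact_mod_cast abs_pos.2 (discr_ne_zero E)
  have h8 := Real.sqrt_pos.2 h7
  push_cast at h8
  positivity

end IdealCount

namespace UnipotentLog

open IsNilpotent

section Comm

variable {S : Type*} [CommRing S] [Algebra ℚ S]

lemma sq_dvd_exp_sub {e : S} (he : IsNilpotent e) : e ^ 2 ∣ exp e - 1 - e := by
  obtain ⟨k, hk⟩ := he
  have hk2 : e ^ (k + 2) = 0 := pow_eq_zero_of_le (by omega) hk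
  rw [exp_eq_sum hk2, Finset.sum_range_succ', Finset.sum_range_succ']
  have : ∑ i ∈ Finset.range k, (((i + 1 + 1).factorial : ℚ)⁻¹) • e ^ (i + 1 + 1) +
      (((0 + 1).factorial : ℚ)⁻¹) • e ^ (0 + 1) + ((Nat.factorial 0 : ℚ)⁻¹) • e ^ 0 - 1 - e =
      ∑ i ∈ Finset.range k, (((i + 1 + 1).factorial : ℚ)⁻¹) • e ^ (i + 1 + 1) := by
    simp
  rw [this]
  refine Finset.dvd_sum fun i _ => ?_
  rw [add_assoc, pow_add]
  exact dvd_smul_of_dvd _ (dvd_mul_left _ _)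

lemma exists_exp_eq_comm {ν : S} (hν : IsNilpotent ν) :
    ∃ N : S, IsNilpotent N ∧ exp N = 1 + ν := by
  obtain ⟨k, hk⟩ := hν
  have key : ∀ j : ℕ, ∃ N : S, ν ∣ N ∧ ν ^ (j + 1) ∣ exp N - (1 + ν) := by
    intro j
    induction j with
    | zero => exact ⟨0, dvd_zero _, by simp⟩
    | succ j ih =>
      obtain ⟨N, hN, hd⟩ := ih
      have nilp : ∀ {x : S}, ν ∣ x → IsNilpotent x := by
        rintro x ⟨y, rfl⟩
        exact ⟨k, by rw [mul_pow, hk, zero_mul]⟩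
      have hinv := exp_mul_exp_neg_self (nilp hN)
      set e := (1 + ν) * exp (-N) - 1 with he
      have hed : ν ^ (j + 1) ∣ e := by
        have : e = -(exp N - (1 + ν)) * exp (-N) := by
          rw [he, neg_mul, sub_mul, hinv]
          ring
        rw [this]
        exact Dvd.dvd.mul_right (by rwa [dvd_neg]) _
      have hed1 : ν ∣ e := (dvd_pow_self ν (by omega)).trans hed
      refine ⟨N + e, dvd_add hN hed1, ?_⟩
      rw [exp_add_of_commute (Commute.all _ _) (nilp hN) (nilp hed1)]
      have h2 : exp N * exp e - (1 + ν) = exp N * (exp e - 1 - e) := by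
        have : exp N * e = (1 + ν) - exp N := by
          rw [he, mul_sub, mul_one, mul_left_comm, hinv, mul_one]
        rw [mul_sub, mul_sub, this]
        ring
      rw [h2]
      refine Dvd.dvd.mul_left (dvd_trans ?_ (sq_dvd_exp_sub (nilp hed1))) _
      calc ν ^ (j + 1 + 1) ∣ (ν ^ (j + 1)) ^ 2 := by
            rw [← pow_mul]; exact pow_dvd_pow _ (by omega)
        _ ∣ e ^ 2 := pow_dvd_pow_of_dvd hed 2
  obtain ⟨N, ⟨y, rfl⟩, hd⟩ := key k
  refine ⟨ν * y, ⟨k, by rw [mul_pow, hk, zero_mul]⟩, ?_⟩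
  rw [_root_.pow_succ, hk, zero_mul, zero_dvd_iff] at hd
  exact sub_eq_zero.mp hd

end Comm

section Ring

variable {A : Type*} [Ring A] [Algebra ℚ A]

open scoped IsMulCommutative in
lemma exists_exp_eq {u : A} (hu : IsNilpotent (u - 1)) :
    ∃ N ∈ Algebra.adjoin ℚ {u}, IsNilpotent N ∧ exp N = u := by
  let S := Algebra.adjoin ℚ {u}
  let ν : S := ⟨u, Algebra.self_mem_adjoin_singleton ℚ u⟩ - 1
  have hinj : Function.Injective S.val := Subtype.val_injective
  have hν : IsNilpotent ν := by
    rw [← IsNilpotent.map_iff hinj]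
    simpa [ν] using hu
  obtain ⟨N, hN, hexp⟩ := exists_exp_eq_comm hν
  refine ⟨N, N.2, hN.map S.val, ?_⟩
  have := map_exp hN S.val
  rw [hexp] at this
  change exp (S.val N) = u
  rw [← this]
  simp [ν]

lemma eq_zero_of_exp_eq_one {c : A} (hc : IsNilpotent c) (h : exp c = 1) : c = 0 := by
  obtain ⟨k, hk⟩ := hc
  have hc' : IsNilpotent c := ⟨k, hk⟩
  have hk1 : c ^ (k + 2) = 0 := pow_eq_zero_of_le (by omega) hk
  rw [exp_eq_sum hk1, Finset.sum_range_succ', Finset.sum_range_succ'] at h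
  simp only [zero_add, Nat.factorial_one, Nat.cast_one, inv_one, pow_one, one_smul,
    Nat.factorial_zero, pow_zero, add_eq_right] at h
  set w := ∑ i ∈ Finset.range k, (((i + 1 + 1).factorial : ℚ)⁻¹) • c ^ (i + 1) with hw
  have hmul : c * w + c = 0 := by
    rw [← h, hw, Finset.mul_sum]
    congr 1
    refine Finset.sum_congr rfl fun i _ => ?_
    rw [mul_smul_comm, ← _root_.pow_succ']
  have hnil : IsNilpotent w := by
    refine Commute.isNilpotent_sum (fun i _ => ((hc'.pow_succ i).smul _)) fun i j _ _ => ?_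
    exact ((Commute.refl c).pow_pow _ _).smul_left _ |>.smul_right _
  have hu : IsUnit (w + 1) := hnil.isUnit_add_one
  have : c * (w + 1) = 0 := by rw [mul_add, mul_one, hmul]
  exact (hu.mul_left_eq_zero).mp this

lemma exp_injective {a b : A} (hab : Commute a b) (ha : IsNilpotent a) (hb : IsNilpotent b)
    (h : exp a = exp b) : a = b := by
  rw [← sub_eq_zero]
  apply eq_zero_of_exp_eq_one (hab.isNilpotent_sub ha hb)
  rw [sub_eq_add_neg, exp_add_of_commute hab.neg_right ha hb.neg, h, exp_mul_exp_neg_self hb]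

lemma exp_nsmul {a : A} (ha : IsNilpotent a) (k : ℕ) : exp (k • a) = exp a ^ k := by
  induction k with
  | zero => simp [exp_zero]
  | succ k ih =>
    have hk : IsNilpotent (k • a) := by
      rw [nsmul_eq_mul]; exact (Nat.cast_commute k a).isNilpotent_mul_left ha
    rw [succ_nsmul, exp_add_of_commute ((Commute.refl a).smul_left k) hk ha, ih, _root_.pow_succ]

/-- Conjugating a logarithm of a unipotent `u` by `g`, when `g u g⁻¹ = u ^ q`. -/
lemma exists_log_conj {u : A} (hu : IsNilpotent (u - 1)) (g : Aˣ) (q : ℕ)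
    (h : g * u * (g⁻¹ : Aˣ) = u ^ q) :
    ∃ N : A, IsNilpotent N ∧ exp N = u ∧ g * N * (g⁻¹ : Aˣ) = q • N := by
  obtain ⟨N, hNmem, hN, hexp⟩ := exists_exp_eq hu
  refine ⟨N, hN, hexp, ?_⟩
  let φ : A ≃ₐ[ℚ] A := MulSemiringAction.toAlgEquiv ℚ A (ConjAct.toConjAct g)
  have hφ : ∀ x, φ x = g * x * (g⁻¹ : Aˣ) := fun x => rfl
  rw [← hφ] at h ⊢
  have hcomm : Commute (φ N) (q • N) := by
    have h1 : φ N ∈ Algebra.adjoin ℚ {u ^ q} := by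
      have : φ N ∈ (Algebra.adjoin ℚ {u}).map φ.toAlgHom := ⟨N, hNmem, rfl⟩
      rw [AlgHom.map_adjoin, Set.image_singleton] at this
      rwa [← h]
    have h2 : φ N ∈ Algebra.adjoin ℚ {u} := by
      refine Algebra.adjoin_le ?_ h1
      rintro x rfl
      exact pow_mem (Algebra.self_mem_adjoin_singleton ℚ u) q
    have h3 := Algebra.isMulCommutative_adjoin_singleton ℚ u
    have : Commute (φ N) N := by
      have := h3.is_comm.comm ⟨φ N, h2⟩ ⟨N, hNmem⟩
      exact congrArg Subtype.val this
    exact this.smul_right q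
  have hq : IsNilpotent (q • N) := by
    rw [nsmul_eq_mul]; exact (Nat.cast_commute q N).isNilpotent_mul_left hN
  refine exp_injective hcomm (hN.map φ) hq ?_
  rw [exp_nsmul hN, hexp, ← h, ← map_exp hN φ, hexp]

end Ring

section Trace

variable {L V : Type*} [Field L] [CharZero L] [AddCommGroup V] [Module L V]
  [FiniteDimensional L V]

open Polynomial

lemma isNilpotent_of_trace_pow_eq_zero (x : Module.End L V)
    (h : ∀ k : ℕ, LinearMap.trace L V (x ^ (k + 1)) = 0) : IsNilpotent x := by
  have hχ : x.charpoly ≠ 0 := x.charpoly_monic.ne_zero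
  obtain ⟨Q, hQ, hnd⟩ := exists_eq_pow_rootMultiplicity_mul_and_not_dvd x.charpoly hχ 0
  set m := x.charpoly.rootMultiplicity 0
  rw [C_0, sub_zero] at hQ hnd
  have hcop : IsCoprime (X ^ (m + 1) : L[X]) Q := by
    apply IsCoprime.pow_left
    exact (irreducible_X.coprime_iff_not_dvd).mpr hnd
  obtain ⟨a, b, hab⟩ := hcop
  have hzero : aeval x (X ^ (m + 1) * Q) = 0 := by
    have : X ^ (m + 1) * Q = X * x.charpoly := by
      conv_rhs => rw [hQ]
      ring
    rw [this, map_mul, LinearMap.aeval_self_charpoly, mul_zero]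
  set e : Module.End L V := aeval x (a * X ^ (m + 1)) with he
  have hidem : IsIdempotentElem e := by
    have h1 : (a * X ^ (m + 1)) * (a * X ^ (m + 1)) =
        a * X ^ (m + 1) - a * b * (X ^ (m + 1) * Q) := by
      linear_combination (a * X ^ (m + 1)) * hab
    rw [IsIdempotentElem, he, ← map_mul, h1, map_sub, map_mul _ (a * b), hzero, mul_zero, sub_zero]
  have htr : LinearMap.trace L V e = 0 := by
    have : ∀ P : L[X], LinearMap.trace L V (aeval x (P * X)) = 0 := by
      intro P
      induction P using Polynomial.induction_on' with
      | add p q hp hq => rw [add_mul, map_add, map_add, hp, hq, add_zero]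
      | monomial n c =>
        rw [← C_mul_X_pow_eq_monomial, mul_assoc, ← _root_.pow_succ, map_mul, aeval_C, map_pow, aeval_X,
          ← Algebra.smul_def, map_smul, h, smul_zero]
    rw [he, _root_.pow_succ, ← mul_assoc]
    exact this _
  have he0 : e = 0 := LinearMap.IsIdempotentElem.eq_zero_of_trace_eq_zero hidem htr
  refine ⟨m + 1, ?_⟩
  have h2 : (X : L[X]) ^ (m + 1) = X ^ (m + 1) * (a * X ^ (m + 1)) + b * (X ^ (m + 1) * Q) := by
    linear_combination (- X ^ (m + 1)) * hab
  have := congrArg (aeval x) h2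
  rw [map_add, map_mul, map_mul _ b, hzero, ← he, he0, mul_zero, mul_zero, add_zero, map_pow,
    aeval_X] at this
  exact this

omit [CharZero L] [FiniteDimensional L V] in
lemma trace_eq_zero_of_isNilpotent {x : Module.End L V} (hx : IsNilpotent x) :
    LinearMap.trace L V x = 0 :=
  (LinearMap.isNilpotent_trace_of_isNilpotent hx).eq_zero

end Trace

end UnipotentLog

namespace LieAux

variable {L V : Type*} [Field L] [AddCommGroup V] [Module L V]

attribute [local instance 100] LieRing.ofAssociativeRing

/-- A subspace of endomorphisms closed under commutators. -/
def IsLieClosed (M : Submodule L (Module.End L V)) : Prop :=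
  ∀ x ∈ M, ∀ y ∈ M, x * y - y * x ∈ M

/-- The Lie subalgebra attached to a subspace closed under commutators. -/
def IsLieClosed.toLieSubalgebra {M : Submodule L (Module.End L V)} (hM : IsLieClosed M) :
    LieSubalgebra L (Module.End L V) :=
  { M with lie_mem' := fun {x y} hx hy => hM x hx y hy }

lemma exists_ker_of_nilpotent [FiniteDimensional L V] {M : Submodule L (Module.End L V)}
    (hM : IsLieClosed M)
    (hnil : ∀ x ∈ M, IsNilpotent x) (V₁ : Submodule L V) (hV₁ : V₁ ≠ ⊥)
    (hstab : ∀ x ∈ M, ∀ v ∈ V₁, x v ∈ V₁) : ∃ v ∈ V₁, v ≠ 0 ∧ ∀ x ∈ M, x v = 0 := by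
  let 𝔤 := hM.toLieSubalgebra
  let U : LieSubmodule L 𝔤 V :=
    { V₁ with lie_mem := fun {x v} hv => hstab x.1 x.2 v hv }
  have hU : Nontrivial U := by
    obtain ⟨v, hv, hv0⟩ := Submodule.exists_mem_ne_zero_of_ne_bot hV₁
    exact ⟨⟨v, hv⟩, 0, fun h => hv0 (congrArg Subtype.val h)⟩
  have hnilp : LieModule.IsNilpotent 𝔤 U := by
    rw [LieModule.isNilpotent_iff_forall' (R := L)]
    rintro ⟨x, hx⟩
    obtain ⟨k, hk⟩ := hnil x hx
    refine ⟨k, ?_⟩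
    ext ⟨v, hv⟩
    have : ∀ j : ℕ, ((((LieModule.toEnd L 𝔤 U) ⟨x, hx⟩) ^ j) ⟨v, hv⟩ : V) = (x ^ j) v := by
      intro j
      induction j with
      | zero => rfl
      | succ j ih =>
        rw [pow_succ', pow_succ', Module.End.mul_apply, Module.End.mul_apply, ← ih]
        rfl
    rw [this, hk]
    rfl
  have := LieModule.nontrivial_max_triv_of_isNilpotent L 𝔤 U
  obtain ⟨⟨v, hv⟩, hv0⟩ := exists_ne (0 : LieModule.maxTrivSubmodule L 𝔤 U)
  refine ⟨v.1, v.2, ?_, fun x hx => ?_⟩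
  · intro h
    exact hv0 (Subtype.ext (Subtype.ext h))
  · rw [LieModule.mem_maxTrivSubmodule] at hv
    exact congrArg Subtype.val (hv ⟨x, hx⟩)

lemma isNilpotent_of_mem_span_commutators [CharZero L] [FiniteDimensional L V]
    {M : Submodule L (Module.End L V)} (hM : IsLieClosed M)
    (htr : ∀ x ∈ M, ∀ y ∈ M, LinearMap.trace L V (x * y) = 0) {z : Module.End L V}
    (hz : z ∈ Submodule.span L {z | ∃ x ∈ M, ∃ y ∈ M, z = x * y - y * x}) : IsNilpotent z := by
  let 𝔤 := hM.toLieSubalgebra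
  have h0 : LieModule.traceForm L 𝔤 V = 0 := by
    ext ⟨x, hx⟩ ⟨y, hy⟩
    exact htr x hx y hy
  have h1 := LieModule.isNilpotent_derivedSeries_of_traceForm_eq_zero h0
  rw [LieModule.isNilpotent_iff_forall' (R := L)] at h1
  have h2 : ∃ w : LieAlgebra.derivedSeries L 𝔤 1, (w.1 : Module.End L V) = z := by
    induction hz using Submodule.span_induction with
    | mem z hz =>
      obtain ⟨x, hx, y, hy, rfl⟩ := hz
      refine ⟨⟨⁅(⟨x, hx⟩ : 𝔤), (⟨y, hy⟩ : 𝔤)⁆, ?_⟩, rfl⟩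
      rw [LieAlgebra.derivedSeries_def, LieAlgebra.derivedSeriesOfIdeal_succ,
        LieAlgebra.derivedSeriesOfIdeal_zero]
      exact LieSubmodule.lie_mem_lie (LieSubmodule.mem_top _) (LieSubmodule.mem_top _)
    | zero => exact ⟨0, rfl⟩
    | add a b _ _ ha hb =>
      obtain ⟨⟨a', ha'⟩, rfl⟩ := ha
      obtain ⟨⟨b', hb'⟩, rfl⟩ := hb
      exact ⟨⟨a' + b', add_mem ha' hb'⟩, rfl⟩
    | smul c a _ ha =>
      obtain ⟨⟨a', ha'⟩, rfl⟩ := ha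
      exact ⟨⟨c • a', Submodule.smul_mem _ c ha'⟩, rfl⟩
  obtain ⟨w, rfl⟩ := h2
  exact h1 w

end LieAux

namespace LieAux

variable {L E : Type*} [Field L] [CharZero L] [AddCommGroup E] [Module L E]

lemma mem_of_forall_sum_pow_mem (S : Submodule L E) (M : ℕ) (c : ℕ → E)
    (h : ∀ k : ℕ, ∑ i ∈ Finset.range M, (k : L) ^ i • c i ∈ S) : ∀ i < M, c i ∈ S := by
  intro i hi
  by_contra hc
  obtain ⟨f, hf, hS⟩ := Submodule.exists_le_ker_of_notMem hc
  let P : Polynomial L := ∑ i ∈ Finset.range M, Polynomial.C (f (c i)) * Polynomial.X ^ i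
  have hP : P = 0 := by
    refine Polynomial.eq_zero_of_infinite_isRoot P ?_
    refine (Set.infinite_range_of_injective (Nat.cast_injective (R := L))).mono ?_
    rintro _ ⟨k, rfl⟩
    have := hS (h k)
    rw [LinearMap.mem_ker, map_sum] at this
    change P.eval _ = 0
    rw [← this]
    simp only [P, Polynomial.eval_finsetSum, Polynomial.eval_mul, Polynomial.eval_C,
      Polynomial.eval_pow, Polynomial.eval_X, map_smul, smul_eq_mul]
    exact Finset.sum_congr rfl fun i _ => mul_comm _ _
  apply hf
  have := congrArg (fun Q => Polynomial.coeff Q i) hP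
  simpa [P, Polynomial.finsetSum_coeff, Polynomial.coeff_C_mul, Polynomial.coeff_X_pow, hi]
    using this

end LieAux

namespace LieAux

open IsNilpotent

variable {L A : Type*} [Field L] [CharZero L] [Ring A] [Algebra L A] [Algebra ℚ A]

variable (L) in
/-- The commutator map `y ↦ x y - y x`. -/
def adL (x : A) : Module.End L A := LinearMap.mulLeft L x - LinearMap.mulRight L x

omit [CharZero L] [Algebra ℚ A] in
@[simp] lemma adL_apply (x y : A) : adL L x y = x * y - y * x := rfl

omit [CharZero L] [Algebra ℚ A] in
lemma isNilpotent_adL {x : A} (hx : IsNilpotent x) : IsNilpotent (adL L x) :=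
  (LinearMap.commute_mulLeft_right x x).isNilpotent_sub
    ((LinearMap.isNilpotent_mulLeft_iff L x).mpr hx)
    ((LinearMap.isNilpotent_mulRight_iff L x).mpr hx)

lemma exp_mul_mul_exp_neg {x : A} (hx : IsNilpotent x) {M : ℕ} (hM : (adL L x) ^ M = 0) (y : A) :
    exp x * y * exp (-x) = ∑ i ∈ Finset.range M, (i.factorial : L)⁻¹ • (adL L x ^ i) y := by
  have hl := (LinearMap.isNilpotent_mulLeft_iff L x).mpr hx
  have hr := (LinearMap.isNilpotent_mulRight_iff L x).mpr hx
  let _ : Algebra ℚ L := DivisionRing.toRatAlgebra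
  have h1 : exp (adL L x) = exp (LinearMap.mulLeft L x) * exp (-LinearMap.mulRight L x) := by
    have hc : Commute (LinearMap.mulLeft L x : Module.End L A) (LinearMap.mulRight L x) :=
      LinearMap.commute_mulLeft_right x x
    rw [adL, sub_eq_add_neg, exp_add_of_commute hc.neg_right hl hr.neg]
  have smul_eq : ∀ (q : ℚ) (f : Module.End L A) , (q • f) y = (q : L) • f y := by
    intro q f
    rw [LinearMap.smul_apply]
    exact (Rat.cast_smul_eq_qsmul L q (f y)).symm
  have h2 : ∀ z, exp (LinearMap.mulLeft L x) z = exp x * z := by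
    intro z
    obtain ⟨k, hk⟩ := hx
    have : (LinearMap.mulLeft L x) ^ k = 0 := by rw [LinearMap.pow_mulLeft, hk]; simp
    rw [exp_eq_sum hk, exp_eq_sum this, LinearMap.sum_apply, Finset.sum_mul]
    refine Finset.sum_congr rfl fun i _ => ?_
    rw [LinearMap.smul_apply, LinearMap.pow_mulLeft, LinearMap.mulLeft_apply, smul_mul_assoc]
  have h3 : ∀ z, exp (-LinearMap.mulRight L x) z = z * exp (-x) := by
    intro z
    have e : -LinearMap.mulRight L x = LinearMap.mulRight L (-x) := by ext; simp
    obtain ⟨k, hk⟩ := hx.neg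
    have : (LinearMap.mulRight L (-x)) ^ k = 0 := by rw [LinearMap.pow_mulRight, hk]; simp
    rw [e, exp_eq_sum hk, exp_eq_sum this, LinearMap.sum_apply, Finset.mul_sum]
    refine Finset.sum_congr rfl fun i _ => ?_
    rw [LinearMap.smul_apply, LinearMap.pow_mulRight, LinearMap.mulRight_apply, mul_smul_comm]
  have h4 : exp (adL L x) y = exp x * y * exp (-x) := by
    rw [h1, Module.End.mul_apply, h3, h2, mul_assoc]
  rw [← h4, exp_eq_sum hM, LinearMap.sum_apply]
  refine Finset.sum_congr rfl fun i _ => ?_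
  rw [smul_eq]
  simp

/-- Conjugation by powers of a unipotent depends polynomially on the exponent. -/
lemma exists_conj_pow {x : A} (hx : IsNilpotent x) : ∃ M : ℕ, 2 ≤ M ∧ (adL L x) ^ M = 0 ∧
    ∀ (y : A) (k : ℕ), exp x ^ k * y * exp (-x) ^ k =
    ∑ i ∈ Finset.range M, (k : L) ^ i • (i.factorial : L)⁻¹ • (adL L x ^ i) y := by
  obtain ⟨M, hM⟩ := isNilpotent_adL (L := L) hx
  have hM2 : (adL L x) ^ (M + 2) = 0 := pow_eq_zero_of_le (by omega) hM
  refine ⟨M + 2, by omega, hM2, fun y k => ?_⟩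
  have e : adL L (k • x) = (k : L) • adL L x := by
    ext z
    rw [LinearMap.smul_apply, Nat.cast_smul_eq_nsmul, adL_apply, adL_apply, smul_mul_assoc,
      mul_smul_comm, smul_sub]
  have hk : IsNilpotent (k • x) := by
    rw [nsmul_eq_mul]; exact (Nat.cast_commute k x).isNilpotent_mul_left hx
  have := exp_mul_mul_exp_neg (L := L) hk (M := M + 2) (by rw [e, smul_pow, hM2, smul_zero]) y
  rw [UnipotentLog.exp_nsmul hx, ← smul_neg, UnipotentLog.exp_nsmul hx.neg] at this
  rw [this, e]
  refine Finset.sum_congr rfl fun i _ => ?_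
  rw [smul_pow, LinearMap.smul_apply, smul_comm]

end LieAux

namespace LieAux

open IsNilpotent

variable {L V G : Type*} [Field L] [AddCommGroup V] [Module L V] [Group G]

section Conj

variable (r : G →* Module.End L V)

lemma map_mul_map_inv (g : G) : r g * r g⁻¹ = 1 := by rw [← map_mul, mul_inv_cancel, map_one]

lemma map_inv_mul_map (g : G) : r g⁻¹ * r g = 1 := by rw [← map_mul, inv_mul_cancel, map_one]

/-- Conjugation by `r g`, as a linear map. -/
def conjL (g : G) : Module.End L (Module.End L V) :=
  LinearMap.mulLeft L (r g) ∘ₗ LinearMap.mulRight L (r g⁻¹)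

@[simp] lemma conjL_apply (g : G) (x : Module.End L V) : conjL r g x = r g * x * r g⁻¹ :=
  (mul_assoc _ _ _).symm

lemma conjL_mul (g h : G) : conjL r (g * h) = conjL r g * conjL r h := by
  ext1 x
  simp only [conjL_apply, Module.End.mul_apply, map_mul, mul_inv_rev, mul_assoc]

lemma conjL_one : conjL r 1 = 1 := by
  ext1 x
  simp only [conjL_apply, inv_one, map_one, one_mul, mul_one, Module.End.one_apply]

lemma conjL_map_mul (g : G) (x y : Module.End L V) :
    conjL r g (x * y) = conjL r g x * conjL r g y := by
  simp only [conjL_apply]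
  calc r g * (x * y) * r g⁻¹ = r g * x * 1 * y * r g⁻¹ := by simp only [mul_assoc, mul_one]
    _ = r g * x * (r g⁻¹ * r g) * y * r g⁻¹ := by rw [map_inv_mul_map]
    _ = _ := by simp only [mul_assoc]

lemma conjL_map_one (g : G) : conjL r g 1 = 1 := by
  rw [conjL_apply, mul_one, map_mul_map_inv]

/-- Conjugation by `r g` as a ring homomorphism. -/
def conjHom (g : G) : Module.End L V →+* Module.End L V where
  toFun := conjL r g
  map_one' := conjL_map_one r g
  map_mul' := conjL_map_mul r g
  map_zero' := map_zero _
  map_add' := map_add _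

lemma trace_conjL (g : G) (x : Module.End L V) :
    LinearMap.trace L V (conjL r g x) = LinearMap.trace L V x := by
  rw [conjL_apply, LinearMap.trace_mul_comm, ← mul_assoc, map_inv_mul_map, one_mul]

/-- Every `r`-stable subspace has an `r`-stable complement. -/
def HasStableComplements : Prop :=
  ∀ V₀ : Submodule L V, (∀ g, ∀ v ∈ V₀, r g v ∈ V₀) →
    ∃ V₁ : Submodule L V, (∀ g, ∀ v ∈ V₁, r g v ∈ V₁) ∧ IsCompl V₀ V₁

variable {r}

lemma eq_bot_of_nilpotent [FiniteDimensional L V] (hss : HasStableComplements r)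
    {M : Submodule L (Module.End L V)} (hM : IsLieClosed M)
    (hconj : ∀ g, ∀ x ∈ M, conjL r g x ∈ M) (hspan : M ≤ Submodule.span L (Set.range r))
    (hnil : ∀ x ∈ M, IsNilpotent x) : M = ⊥ := by
  let V₀ : Submodule L V :=
    { carrier := {v | ∀ x ∈ M, x v = 0}
      add_mem' := fun {a b} ha hb x hx => by rw [map_add, ha x hx, hb x hx, add_zero]
      zero_mem' := fun x _ => map_zero x
      smul_mem' := fun c v hv x hx => by rw [map_smul, hv x hx, smul_zero] }
  obtain ⟨V₁, hV₁, hc⟩ := hss V₀ (by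
    intro g v hv x hx
    have h1 := hv _ (hconj g⁻¹ x hx)
    rw [conjL_apply, inv_inv, Module.End.mul_apply, Module.End.mul_apply] at h1
    have h2 := congrArg (r g) h1
    rwa [map_zero, ← Module.End.mul_apply, map_mul_map_inv] at h2)
  have hstab : ∀ x ∈ Submodule.span L (Set.range r), ∀ v ∈ V₁, x v ∈ V₁ := by
    intro x hx v hv
    induction hx using Submodule.span_induction with
    | mem x hx => obtain ⟨g, rfl⟩ := hx; exact hV₁ g v hv
    | zero => exact V₁.zero_mem
    | add a b _ _ ha hb => exact V₁.add_mem ha hb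
    | smul c a _ ha => exact V₁.smul_mem c ha
  have hbot : V₁ = ⊥ := by
    by_contra hne
    obtain ⟨v, hv, hv0, hker⟩ := exists_ker_of_nilpotent hM hnil V₁ hne
      fun x hx => hstab x (hspan hx)
    exact hv0 ((Submodule.mem_bot L).mp (hc.disjoint.le_bot ⟨hker, hv⟩))
  have htop : V₀ = ⊤ := by
    have := hc.sup_eq_top
    rwa [hbot, sup_bot_eq] at this
  rw [Submodule.eq_bot_iff]
  intro x hx
  ext v
  have : v ∈ V₀ := htop ▸ Submodule.mem_top
  exact this x hx

end Conj

section LogSpan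

variable [CharZero L] [Algebra ℚ (Module.End L V)] (r : G →* Module.End L V) (H : Subgroup G)

/-- The nilpotent logarithms of the unipotent elements of `r(H)`. -/
def logSet : Set (Module.End L V) := {N | IsNilpotent N ∧ ∃ τ ∈ H, exp N = r τ}

/-- The span of the logarithms of the unipotent elements of `r(H)`. -/
def logSpan : Submodule L (Module.End L V) := Submodule.span L (logSet r H)

variable {r H}

omit [CharZero L] in
lemma exp_neg_eq {N : Module.End L V} (hN : IsNilpotent N) {τ : G} (h : exp N = r τ) :
    exp (-N) = r τ⁻¹ := by
  have h1 := exp_neg_mul_exp_self hN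
  rw [h] at h1
  calc exp (-N) = exp (-N) * (r τ * r τ⁻¹) := by rw [map_mul_map_inv, mul_one]
    _ = r τ⁻¹ := by rw [← mul_assoc, h1, one_mul]

omit [CharZero L] in
lemma conjL_mem_logSet [H.Normal] (g : G) {N : Module.End L V} (hN : N ∈ logSet r H) :
    conjL r g N ∈ logSet r H := by
  obtain ⟨hnil, τ, hτ, he⟩ := hN
  refine ⟨hnil.map (conjHom r g), g * τ * g⁻¹, Subgroup.Normal.conj_mem inferInstance τ hτ g, ?_⟩
  have := map_exp hnil (conjHom r g)
  change exp (conjHom r g N) = _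
  rw [← this, he]
  change conjL r g (r τ) = _
  simp [mul_assoc]

omit [CharZero L] in
lemma conjL_mem_logSpan [H.Normal] (g : G) {x : Module.End L V} (hx : x ∈ logSpan r H) :
    conjL r g x ∈ logSpan r H := by
  induction hx using Submodule.span_induction with
  | mem x hx => exact Submodule.subset_span (conjL_mem_logSet g hx)
  | zero => rw [map_zero]; exact Submodule.zero_mem _
  | add a b _ _ ha hb => rw [map_add]; exact Submodule.add_mem _ ha hb
  | smul c a _ ha => rw [map_smul]; exact Submodule.smul_mem _ c ha

lemma mem_span_range_of_mem_logSet {N : Module.End L V} (hN : N ∈ logSet r H) :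
    N ∈ Submodule.span L (Set.range r) := by
  obtain ⟨⟨k, hk⟩, τ, hτ, he⟩ := hN
  have hnil : IsNilpotent N := ⟨k, hk⟩
  have hk2 : N ^ (k + 2) = 0 := pow_eq_zero_of_le (by omega) hk
  have := mem_of_forall_sum_pow_mem (L := L) (Submodule.span L (Set.range r)) (k + 2)
    (fun i => (i.factorial : L)⁻¹ • N ^ i) ?_ 1 (by omega)
  · simpa using this
  · intro j
    have h1 : exp (j • N) = r (τ ^ j) := by rw [UnipotentLog.exp_nsmul hnil, he, map_pow]
    have h2 : (j • N) ^ (k + 2) = 0 := by rw [smul_pow, hk2, smul_zero]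
    rw [exp_eq_sum h2] at h1
    have h3 : ∑ i ∈ Finset.range (k + 2), (j : L) ^ i • (i.factorial : L)⁻¹ • N ^ i = r (τ ^ j) := by
      rw [← h1]
      refine Finset.sum_congr rfl fun i _ => ?_
      have hq : ∀ (q : ℚ) (x : Module.End L V), q • x = (q : L) • x := by
        intro q x
        exact (Rat.cast_smul_eq_qsmul L q x).symm
      rw [smul_pow, hq, ← Nat.cast_smul_eq_nsmul L, smul_smul, smul_smul, mul_comm]
      push_cast
      rfl
    rw [h3]
    exact Submodule.subset_span ⟨_, rfl⟩

lemma logSpan_le : logSpan r H ≤ Submodule.span L (Set.range r) :=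
  Submodule.span_le.mpr fun _ hN => mem_span_range_of_mem_logSet hN

lemma commutator_mem_logSpan [H.Normal] {N y : Module.End L V} (hN : N ∈ logSet r H)
    (hy : y ∈ logSpan r H) : N * y - y * N ∈ logSpan r H := by
  obtain ⟨hnil, τ, hτ, he⟩ := hN
  obtain ⟨M, hM, hM0, h⟩ := exists_conj_pow (L := L) hnil
  have := mem_of_forall_sum_pow_mem (L := L) (logSpan r H) M
    (fun i => (i.factorial : L)⁻¹ • (adL L N ^ i) y) ?_ 1 (by omega)
  · simpa using this
  · intro k
    rw [← h y k, he, exp_neg_eq hnil he, ← map_pow, ← map_pow, inv_pow, ← conjL_apply]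
    exact conjL_mem_logSpan _ hy

lemma isLieClosed_logSpan [H.Normal] : IsLieClosed (logSpan r H) := by
  intro x hx y hy
  induction hx using Submodule.span_induction with
  | mem x hx => exact commutator_mem_logSpan hx hy
  | zero => simp
  | add a b _ _ ha hb =>
    have : (a + b) * y - y * (a + b) = (a * y - y * a) + (b * y - y * b) := by noncomm_ring
    rw [this]; exact Submodule.add_mem _ ha hb
  | smul c a _ ha =>
    rw [smul_mul_assoc, mul_smul_comm, ← smul_sub]; exact Submodule.smul_mem _ c ha

end LogSpan

end LieAux

namespace LieAux

variable {L V G : Type*} [Field L] [AddCommGroup V] [Module L V] [Group G] [CharZero L]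
  [Algebra ℚ (Module.End L V)] [FiniteDimensional L V] {r : G →* Module.End L V} {H : Subgroup G}
  [H.Normal]

open UnipotentLog

omit [Algebra ℚ (Module.End L V)] in
lemma isNilpotent_commutator {N x : Module.End L V} (h : Commute (N * x - x * N) x) :
    IsNilpotent (N * x - x * N) := by
  refine isNilpotent_of_trace_pow_eq_zero _ fun k => ?_
  set z := N * x - x * N with hz
  have : z ^ (k + 1) = (z ^ k * N) * x - x * (z ^ k * N) := by
    rw [pow_succ, ← mul_assoc x, ← (h.pow_left k).eq, hz]
    noncomm_ring
  rw [this, map_sub, LinearMap.trace_mul_comm, sub_self]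

omit [Algebra ℚ (Module.End L V)] [FiniteDimensional L V] [CharZero L] in
lemma isNilpotent_of_mem_span {s : Set (Module.End L V)} (hs : ∀ x ∈ s, IsNilpotent x)
    (hc : ∀ x ∈ Submodule.span L s, ∀ y ∈ Submodule.span L s, Commute x y) :
    ∀ x ∈ Submodule.span L s, IsNilpotent x := by
  intro x hx
  induction hx using Submodule.span_induction with
  | mem x hx => exact hs x hx
  | zero => exact IsNilpotent.zero
  | add a b ha' hb' ha hb => exact (hc a ha' b hb').isNilpotent_add ha hb
  | smul c a _ ha => exact ha.smul c

/-- The radical of the trace form on the span of unipotent logarithms. -/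
def traceRadical (r : G →* Module.End L V) (H : Subgroup G) : Submodule L (Module.End L V) where
  carrier := {x | x ∈ logSpan r H ∧ ∀ y ∈ logSpan r H, LinearMap.trace L V (x * y) = 0}
  add_mem' := fun {a b} ha hb => ⟨add_mem ha.1 hb.1, fun y hy => by
    rw [add_mul, map_add, ha.2 y hy, hb.2 y hy, add_zero]⟩
  zero_mem' := ⟨zero_mem _, fun y _ => by rw [zero_mul, map_zero]⟩
  smul_mem' := fun c a ha => ⟨Submodule.smul_mem _ c ha.1, fun y hy => by
    rw [smul_mul_assoc, map_smul, ha.2 y hy, smul_zero]⟩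

omit [FiniteDimensional L V] in
lemma commutator_mem_traceRadical {x y : Module.End L V} (hx : x ∈ logSpan r H)
    (hy : y ∈ traceRadical r H) : x * y - y * x ∈ traceRadical r H := by
  refine ⟨isLieClosed_logSpan x hx y hy.1, fun w hw => ?_⟩
  have h1 := hy.2 _ (isLieClosed_logSpan w hw x hx)
  have h2 : (x * y - y * x) * w = x * (y * w) - y * x * w := by noncomm_ring
  rw [h2, map_sub, LinearMap.trace_mul_comm, ← map_sub, ← h1]
  congr 1
  noncomm_ring

omit [CharZero L] [FiniteDimensional L V] in
lemma conjL_mem_traceRadical (g : G) {x : Module.End L V} (hx : x ∈ traceRadical r H) :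
    conjL r g x ∈ traceRadical r H := by
  refine ⟨conjL_mem_logSpan g hx.1, fun y hy => ?_⟩
  have h1 := hx.2 _ (conjL_mem_logSpan g⁻¹ hy)
  have h2 : conjL r g (conjL r g⁻¹ y) = y := by
    rw [← Module.End.mul_apply, ← conjL_mul, mul_inv_cancel, conjL_one, Module.End.one_apply]
  rwa [← trace_conjL r g, conjL_map_mul, h2] at h1

omit [CharZero L] [FiniteDimensional L V] [H.Normal] in
lemma traceRadical_le : traceRadical r H ≤ logSpan r H := fun _ h => h.1

omit [CharZero L] [Algebra ℚ (Module.End L V)] [FiniteDimensional L V] in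
lemma conjL_mem_span (g : G) {s : Set (Module.End L V)} (hs : ∀ x ∈ s, conjL r g x ∈ s)
    {x : Module.End L V} (hx : x ∈ Submodule.span L s) : conjL r g x ∈ Submodule.span L s := by
  have h : Submodule.span L s ≤ (Submodule.span L s).comap (conjL r g) :=
    Submodule.span_le.mpr fun y hy => Submodule.subset_span (hs y hy)
  exact h hx

lemma commute_of_mem_traceRadical (hss : HasStableComplements r) {x y : Module.End L V}
    (hx : x ∈ traceRadical r H) (hy : y ∈ traceRadical r H) : Commute x y := by
  set R := traceRadical r H
  have hR : IsLieClosed R := fun a ha b hb => commutator_mem_traceRadical ha.1 hb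
  let D := Submodule.span L {z | ∃ x ∈ R, ∃ y ∈ R, z = x * y - y * x}
  have hDR : D ≤ R := Submodule.span_le.mpr (by
    rintro _ ⟨a, ha, b, hb, rfl⟩
    exact hR a ha b hb)
  have hD : D = ⊥ := by
    refine eq_bot_of_nilpotent hss (fun a ha b hb => ?_) (fun g a ha => ?_)
      ((hDR.trans traceRadical_le).trans logSpan_le) (fun z hz => ?_)
    · exact Submodule.subset_span ⟨a, hDR ha, b, hDR hb, rfl⟩
    · refine conjL_mem_span g ?_ ha
      rintro _ ⟨a, ha, b, hb, rfl⟩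
      refine ⟨_, conjL_mem_traceRadical g ha, _, conjL_mem_traceRadical g hb, ?_⟩
      rw [map_sub, conjL_map_mul, conjL_map_mul]
    · exact isNilpotent_of_mem_span_commutators hR (fun a ha b hb => ha.2 b hb.1) hz
  have : x * y - y * x ∈ D := Submodule.subset_span ⟨x, hx, y, hy, rfl⟩
  rw [hD, Submodule.mem_bot] at this
  exact sub_eq_zero.mp this

lemma commute_logSet (hss : HasStableComplements r) {N x : Module.End L V}
    (hN : N ∈ logSet r H) (hx : x ∈ traceRadical r H) : Commute N x := by
  set R := traceRadical r H
  let s : Set (Module.End L V) := {z | ∃ N ∈ logSet r H, ∃ y ∈ R, z = N * y - y * N}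
  have hDR : Submodule.span L s ≤ R := Submodule.span_le.mpr (by
    rintro _ ⟨a, ha, b, hb, rfl⟩
    exact commutator_mem_traceRadical (Submodule.subset_span ha) hb)
  have hcomm : ∀ a ∈ R, ∀ b ∈ R, Commute a b := fun a ha b hb =>
    commute_of_mem_traceRadical hss ha hb
  have hD : Submodule.span L s = ⊥ := by
    refine eq_bot_of_nilpotent hss (fun a ha b hb => ?_) (fun g a ha => ?_)
      ((hDR.trans traceRadical_le).trans logSpan_le) ?_
    · rw [(hcomm a (hDR ha) b (hDR hb)).eq, sub_self]
      exact Submodule.zero_mem _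
    · refine conjL_mem_span g ?_ ha
      rintro _ ⟨a, ha, b, hb, rfl⟩
      refine ⟨_, conjL_mem_logSet g ha, _, conjL_mem_traceRadical g hb, ?_⟩
      rw [map_sub, conjL_map_mul, conjL_map_mul]
    · refine isNilpotent_of_mem_span ?_ fun a ha b hb => hcomm a (hDR ha) b (hDR hb)
      rintro _ ⟨N, hN, y, hy, rfl⟩
      exact isNilpotent_commutator
        (hcomm _ (commutator_mem_traceRadical (Submodule.subset_span hN) hy) _ hy)
  have : N * x - x * N ∈ Submodule.span L s := Submodule.subset_span ⟨N, hN, x, hx, rfl⟩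
  rw [hD, Submodule.mem_bot] at this
  exact sub_eq_zero.mp this

lemma traceRadical_eq_bot (hss : HasStableComplements r) : traceRadical r H = ⊥ := by
  refine eq_bot_of_nilpotent hss (fun a ha b hb => commutator_mem_traceRadical ha.1 hb)
    (fun g a ha => conjL_mem_traceRadical g ha) (traceRadical_le.trans logSpan_le)
    (fun x hx => isNilpotent_of_trace_pow_eq_zero _ fun k => ?_)
  have key : ∀ y ∈ logSpan r H, LinearMap.trace L V (x ^ k * y) = 0 := by
    intro y hy
    induction hy using Submodule.span_induction with
    | mem N hN =>
      refine trace_eq_zero_of_isNilpotent ?_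
      exact ((commute_logSet hss hN hx).symm.pow_left k).isNilpotent_mul_left hN.1
    | zero => rw [mul_zero, map_zero]
    | add a b _ _ ha hb => rw [mul_add, map_add, ha, hb, add_zero]
    | smul c a _ ha => rw [mul_smul_comm, map_smul, ha, smul_zero]
  rw [pow_succ]
  exact key x hx.1

/-- A nilpotent element of the span is a commutator of itself with some element of the span. -/
lemma exists_commutator_eq_self (hss : HasStableComplements r) {N : Module.End L V}
    (hN : N ∈ logSpan r H) (hnil : IsNilpotent N) :
    ∃ x ∈ logSpan r H, x * N - N * x = N := by
  set W := logSpan r H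
  let adN : W →ₗ[L] W :=
    (LinearMap.mulRight L N - LinearMap.mulLeft L N).restrict
      (p := W) (q := W) fun x hx => isLieClosed_logSpan x hx N hN
  suffices h : (⟨N, hN⟩ : W) ∈ LinearMap.range adN by
    obtain ⟨x, hx⟩ := h
    exact ⟨x, x.2, congrArg Subtype.val hx⟩
  by_contra hne
  obtain ⟨f, hf, hker⟩ := Submodule.exists_le_ker_of_notMem hne
  let B : W →ₗ[L] Module.Dual L W :=
    ((LinearMap.mul L (Module.End L V)).compr₂ (LinearMap.trace L V)).domRestrict₁₂ W W
  have hB : ∀ x y : W, B x y = LinearMap.trace L V (x.1 * y.1) := fun _ _ => rfl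
  have hinj : Function.Injective B := by
    rw [injective_iff_map_eq_zero]
    intro x hx
    have : x.1 ∈ traceRadical r H :=
      ⟨x.2, fun y hy => (hB x ⟨y, hy⟩).symm.trans (by rw [hx]; rfl)⟩
    rw [traceRadical_eq_bot hss, Submodule.mem_bot] at this
    exact Subtype.ext this
  obtain ⟨z, hz⟩ : ∃ z, B z = f :=
    (LinearMap.injective_iff_surjective_of_finrank_eq_finrank
      (Subspace.dual_finrank_eq).symm).mp hinj f
  have hcomm : N * z.1 - z.1 * N ∈ traceRadical r H := by
    refine ⟨isLieClosed_logSpan N hN z z.2, fun y hy => ?_⟩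
    have h1 : f (adN ⟨y, hy⟩) = 0 := hker ⟨⟨y, hy⟩, rfl⟩
    rw [← hz, hB] at h1
    change LinearMap.trace L V (z.1 * (y * N - N * y)) = 0 at h1
    rw [← h1, mul_sub, sub_mul, map_sub, map_sub, ← mul_assoc, ← mul_assoc,
      mul_assoc N, LinearMap.trace_mul_comm L N]
  rw [traceRadical_eq_bot hss, Submodule.mem_bot, sub_eq_zero] at hcomm
  apply hf
  rw [← hz, hB]
  exact trace_eq_zero_of_isNilpotent (Commute.isNilpotent_mul_left (show Commute z.1 N from hcomm.symm) hnil)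

end LieAux

namespace LieAux

open MvPolynomial

variable {ι L : Type*} [Fintype ι] [DecidableEq ι] [Field L]

/-- The derivation of the coordinate ring of matrices induced by left multiplication by `X`. -/
noncomputable def matDer (X : Matrix ι ι L) :
    Derivation L (MvPolynomial (ι × ι) L) (MvPolynomial (ι × ι) L) :=
  mkDerivation L fun p => ∑ k, C (X p.1 k) * MvPolynomial.X (k, p.2)

omit [DecidableEq ι] in
lemma matDer_X (X : Matrix ι ι L) (p : ι × ι) :
    matDer X (MvPolynomial.X p) = ∑ k, C (X p.1 k) * MvPolynomial.X (k, p.2) :=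
  mkDerivation_X _ _ _

omit [DecidableEq ι] in
lemma matDer_add (X Y : Matrix ι ι L) : matDer (X + Y) = matDer X + matDer Y := by
  refine MvPolynomial.derivation_ext fun p => ?_
  simp only [Derivation.add_apply, matDer_X, Matrix.add_apply, C_add, add_mul,
    Finset.sum_add_distrib]

omit [DecidableEq ι] in
lemma matDer_smul (c : L) (X : Matrix ι ι L) : matDer (c • X) = c • matDer X := by
  refine MvPolynomial.derivation_ext fun p => ?_
  simp only [Derivation.smul_apply, matDer_X, Matrix.smul_apply, smul_eq_mul, C_mul, mul_assoc,
    Finset.smul_sum, MvPolynomial.smul_eq_C_mul]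

/-- Evaluation of a polynomial in the matrix entries. -/
noncomputable def matEval {R : Type*} [CommRing R] [Algebra L R] (S : Matrix ι ι R) :
    MvPolynomial (ι × ι) L →ₐ[L] R := aeval fun p => S p.1 p.2

omit [Fintype ι] [DecidableEq ι] in
@[simp] lemma matEval_X {R : Type*} [CommRing R] [Algebra L R] (S : Matrix ι ι R) (p : ι × ι) :
    matEval (L := L) S (MvPolynomial.X p) = S p.1 p.2 := aeval_X _ _

omit [DecidableEq ι] in
lemma derivation_matEval {R : Type*} [CommRing R] [Algebra L R] (D : Derivation L R R)
    (S : Matrix ι ι R) (X : Matrix ι ι L)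
    (h : ∀ i j, D (S i j) = ∑ k, algebraMap L R (X i k) * S k j) (f : MvPolynomial (ι × ι) L) :
    D (matEval S f) = matEval S (matDer X f) := by
  induction f using MvPolynomial.induction_on with
  | C a => rw [← MvPolynomial.algebraMap_eq, AlgHom.commutes, Derivation.map_algebraMap,
      Derivation.map_algebraMap, map_zero]
  | add p q hp hq => rw [map_add, map_add, map_add, map_add, hp, hq]
  | mul_X p i hp =>
    rw [map_mul, Derivation.leibniz, Derivation.leibniz, hp, matEval_X, h, matDer_X, map_add,
      smul_eq_mul, smul_eq_mul, smul_eq_mul, smul_eq_mul, map_mul, map_mul, map_sum, matEval_X]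
    congr 2
    refine Finset.sum_congr rfl fun k _ => ?_
    rw [map_mul, matEval_X, ← MvPolynomial.algebraMap_eq, AlgHom.commutes]

/-- The matrix `exp (t X) * b` of formal power series in `t`. -/
noncomputable def expMul (X b : Matrix ι ι L) : Matrix ι ι (PowerSeries L) :=
  Matrix.of fun i j => PowerSeries.mk fun k => (k.factorial : L)⁻¹ * (X ^ k * b) i j

lemma expMul_apply (X b : Matrix ι ι L) (i j : ι) : expMul X b i j =
    PowerSeries.mk fun k => (k.factorial : L)⁻¹ * (X ^ k * b) i j := rfl

lemma derivative_expMul [CharZero L] (X b : Matrix ι ι L) (i j : ι) :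
    PowerSeries.derivative L (expMul X b i j) =
      ∑ k, algebraMap L (PowerSeries L) (X i k) * expMul X b k j := by
  ext n
  rw [PowerSeries.coeff_derivative, expMul_apply, PowerSeries.coeff_mk, map_sum]
  have h1 : (X ^ (n + 1) * b) i j = ∑ k, X i k * (X ^ n * b) k j := by
    rw [pow_succ', mul_assoc, Matrix.mul_apply]
  have h2 : ((n + 1).factorial : L)⁻¹ * (n + 1) = (n.factorial : L)⁻¹ := by
    rw [Nat.factorial_succ]
    push_cast
    have : (n + 1 : L) ≠ 0 := by exact_mod_cast Nat.succ_ne_zero n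
    field_simp
  rw [mul_right_comm, h2, h1, Finset.mul_sum]
  refine Finset.sum_congr rfl fun k _ => ?_
  rw [PowerSeries.algebraMap_apply, Algebra.algebraMap_self_apply, PowerSeries.coeff_C_mul,
    expMul_apply, PowerSeries.coeff_mk]
  ring

lemma constantCoeff_matEval_expMul (X b : Matrix ι ι L) (f : MvPolynomial (ι × ι) L) :
    PowerSeries.constantCoeff (matEval (expMul X b) f) = matEval b f := by
  induction f using MvPolynomial.induction_on with
  | C a => rw [← MvPolynomial.algebraMap_eq, AlgHom.commutes, AlgHom.commutes,
      PowerSeries.algebraMap_apply, PowerSeries.constantCoeff_C]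
  | add p q hp hq => rw [map_add, map_add, map_add, hp, hq]
  | mul_X p i hp =>
    rw [map_mul, map_mul, map_mul, hp, matEval_X, matEval_X, expMul_apply,
      ← PowerSeries.coeff_zero_eq_constantCoeff_apply, PowerSeries.coeff_mk]
    simp

lemma matEval_matDer_eq_zero [CharZero L] {Y S : Matrix ι ι L} {n m : ℕ} (hY : Y ^ n = 0)
    (hm : m ≠ 0)
    (f : MvPolynomial (ι × ι) L) (h : ∀ j : ℕ, matEval
      ((∑ i ∈ Finset.range n, ((m * j : ℕ) : L) ^ i • (i.factorial : L)⁻¹ • Y ^ i) * S) f = 0) :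
    matEval S (matDer Y f) = 0 := by
  let P : Matrix ι ι (Polynomial L) := Matrix.of fun a b => PowerSeries.trunc n (expMul Y S a b)
  have hP : ∀ a b, ((P a b : Polynomial L) : PowerSeries L) = expMul Y S a b := by
    intro a b
    ext k
    rw [Polynomial.coeff_coe]
    change (PowerSeries.trunc n _).coeff k = _
    rw [PowerSeries.coeff_trunc]
    split_ifs with hk
    · rfl
    · rw [expMul_apply, PowerSeries.coeff_mk, pow_eq_zero_of_le (not_lt.mp hk) hY]
      simp
  have hev : ∀ (t : L), Polynomial.eval t (matEval P f) = matEval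
      ((∑ i ∈ Finset.range n, t ^ i • (i.factorial : L)⁻¹ • Y ^ i) * S) f := by
    intro t
    have : (Polynomial.aeval t).comp (matEval P) = matEval
      ((∑ i ∈ Finset.range n, t ^ i • (i.factorial : L)⁻¹ • Y ^ i) * S) := by
      refine MvPolynomial.algHom_ext fun p => ?_
      rw [AlgHom.comp_apply, matEval_X, matEval_X, Polynomial.aeval_def, Finset.sum_mul,
        Matrix.sum_apply]
      change Polynomial.eval₂ _ t (PowerSeries.trunc n _) = _
      rw [PowerSeries.eval₂_trunc_eq_sum_range]
      refine Finset.sum_congr rfl fun i _ => ?_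
      rw [expMul_apply, PowerSeries.coeff_mk, smul_mul_assoc, smul_mul_assoc, Matrix.smul_apply,
        Matrix.smul_apply, smul_eq_mul, smul_eq_mul, Algebra.algebraMap_self_apply, mul_comm]
    exact DFunLike.congr_fun this f
  have h0 : matEval P f = 0 := by
    refine Polynomial.eq_zero_of_infinite_isRoot _ ?_
    have hinj : Function.Injective fun j : ℕ => ((m * j : ℕ) : L) := by
      intro a b hab
      exact Nat.eq_of_mul_eq_mul_left (Nat.pos_of_ne_zero hm) (Nat.cast_injective hab)
    refine (Set.infinite_range_of_injective hinj).mono ?_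
    rintro _ ⟨j, rfl⟩
    change Polynomial.eval _ _ = 0
    rw [hev, h]
  have h1 : matEval (expMul Y S) f = 0 := by
    have : (Polynomial.coeToPowerSeries.algHom (A := L) (R := L)).comp (matEval P) =
        matEval (expMul Y S) := by
      refine MvPolynomial.algHom_ext fun p => ?_
      rw [AlgHom.comp_apply, matEval_X, matEval_X, Polynomial.coeToPowerSeries.algHom_apply, ← hP]
      simp
    rw [← this, AlgHom.comp_apply, h0, map_zero]
  rw [← constantCoeff_matEval_expMul Y, ← derivation_matEval (PowerSeries.derivative L) _ Y
    (derivative_expMul Y S), h1, map_zero, map_zero]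

lemma matEval_expMul_eq_zero [CharZero L] {X b : Matrix ι ι L} (I : Set (MvPolynomial (ι × ι) L))
    (hD : ∀ f ∈ I, matDer X f ∈ I) (hI : ∀ f ∈ I, matEval b f = 0) {f : MvPolynomial (ι × ι) L}
    (hf : f ∈ I) : matEval (expMul X b) f = 0 := by
  have key : ∀ n : ℕ, ∀ f ∈ I, PowerSeries.coeff n (matEval (expMul X b) f) = 0 := by
    intro n
    induction n with
    | zero =>
      intro f hf
      rw [PowerSeries.coeff_zero_eq_constantCoeff_apply, constantCoeff_matEval_expMul, hI f hf]
    | succ n ih =>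
      intro f hf
      have h1 := ih _ (hD f hf)
      rw [← derivation_matEval (PowerSeries.derivative L) _ X (derivative_expMul X b),
        PowerSeries.coeff_derivative] at h1
      have : (n + 1 : L) ≠ 0 := by exact_mod_cast Nat.succ_ne_zero n
      exact (mul_eq_zero.mp h1).resolve_right this
  ext n
  rw [key n f hf, map_zero]

lemma X_sub_C_pow_dvd_iff_taylor {R : Type*} [CommRing R] (P : Polynomial R) (c : R) (s : ℕ) :
    (Polynomial.X - Polynomial.C c) ^ s ∣ P ↔ ∀ j < s, (Polynomial.taylor c P).coeff j = 0 := by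
  rw [← Polynomial.X_pow_dvd_iff]
  have h1 : Polynomial.taylorEquiv c ((Polynomial.X - Polynomial.C c) ^ s) = Polynomial.X ^ s := by
    change Polynomial.taylor c _ = _
    rw [Polynomial.taylor_pow, map_sub, Polynomial.taylor_X, Polynomial.taylor_C,
      add_sub_cancel_right]
  rw [← map_dvd_iff (Polynomial.taylorEquiv c), h1]
  rfl

/-- The `j`-th Taylor coefficient at `c` of the universal characteristic polynomial. -/
noncomputable def charpolyTaylor (ι : Type*) [Fintype ι] [DecidableEq ι] (c : L) (j : ℕ) :
    MvPolynomial (ι × ι) L :=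
  (Polynomial.taylor (C c) (Matrix.charpoly.univ L ι)).coeff j

lemma matEval_charpolyTaylor {R : Type*} [CommRing R] [Algebra L R] (S : Matrix ι ι R) (c : L)
    (j : ℕ) : matEval S (charpolyTaylor ι c j) =
      (Polynomial.taylor (algebraMap L R c) S.charpoly).coeff j := by
  have h1 : (Matrix.charpoly.univ L ι).map
      ((matEval S : MvPolynomial (ι × ι) L →ₐ[L] R) : MvPolynomial (ι × ι) L →+* R) = S.charpoly := by
    have := Matrix.charpoly.univ_map_eval₂Hom ι (algebraMap L R) fun p => S p.1 p.2
    exact this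
  have h2 : ((matEval S : MvPolynomial (ι × ι) L →ₐ[L] R) : MvPolynomial (ι × ι) L →+* R) (C c) = algebraMap L R c := by
    change matEval S (algebraMap L (MvPolynomial (ι × ι) L) c) = _
    rw [AlgHom.commutes]
  rw [← h1, ← h2, ← Polynomial.map_taylor, Polynomial.coeff_map]
  rfl

/-- The multiplicity of an eigenvalue drops somewhere along a set of matrices that is stable under
sufficiently many unipotents. -/
theorem exists_rootMultiplicity_lt [CharZero L] (𝒮 𝒩 : Set (Matrix ι ι L)) (h1 : 1 ∈ 𝒮)
    (h𝒩 : ∀ Y ∈ 𝒩, ∃ n m : ℕ, Y ^ n = 0 ∧ m ≠ 0 ∧ ∀ S ∈ 𝒮, ∀ j : ℕ,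
      (∑ i ∈ Finset.range n, ((m * j : ℕ) : L) ^ i • (i.factorial : L)⁻¹ • Y ^ i) * S ∈ 𝒮)
    {X b : Matrix ι ι L} (hX : X ∈ Submodule.span L 𝒩) {v : ι → L} (hv : v ≠ 0) {c : L}
    (hc : c ≠ 0) (hXv : X.mulVec v = v) (hbv : b.mulVec v = c • v) :
    ∃ S ∈ 𝒮, (S * b).charpoly.rootMultiplicity c < b.charpoly.rootMultiplicity c := by
  by_contra! hcon
  set s := b.charpoly.rootMultiplicity c with hs
  let I : Set (MvPolynomial (ι × ι) L) := {f | ∀ S ∈ 𝒮, matEval (S * b) f = 0}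
  have hmem : ∀ j < s, charpolyTaylor ι c j ∈ I := by
    intro j hj S hS
    rw [matEval_charpolyTaylor, Algebra.algebraMap_self_apply]
    have hdvd : (Polynomial.X - Polynomial.C c) ^ s ∣ (S * b).charpoly :=
      (pow_dvd_pow _ (hcon S hS)).trans (Polynomial.pow_rootMultiplicity_dvd _ _)
    exact (X_sub_C_pow_dvd_iff_taylor _ _ _).mp hdvd j hj
  have hD : ∀ f ∈ I, matDer X f ∈ I := by
    clear hXv
    induction hX using Submodule.span_induction with
    | mem Y hY =>
      intro f hf S hS
      obtain ⟨n, m, hn, hm, hst⟩ := h𝒩 Y hY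
      refine matEval_matDer_eq_zero hn hm f fun j => ?_
      rw [← mul_assoc]
      exact hf _ (hst S hS j)
    | zero =>
      intro f _ S _
      have : matDer (0 : Matrix ι ι L) = 0 := by
        have := matDer_smul (0 : L) (0 : Matrix ι ι L)
        rwa [zero_smul, zero_smul] at this
      rw [this, Derivation.zero_apply, map_zero]
    | add A B _ _ hA hB =>
      intro f hf S hS
      rw [matDer_add, Derivation.add_apply, map_add, hA f hf S hS, hB f hf S hS, add_zero]
    | smul a A _ hA =>
      intro f hf S hS
      rw [matDer_smul, Derivation.smul_apply, map_smul, hA f hf S hS, smul_zero]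
  have hI : ∀ f ∈ I, matEval b f = 0 := fun f hf => by
    have := hf 1 h1
    rwa [one_mul] at this
  set E := expMul X b with hE
  have hEdvd : (Polynomial.X - Polynomial.C (PowerSeries.C c)) ^ s ∣ E.charpoly := by
    rw [X_sub_C_pow_dvd_iff_taylor]
    intro j hj
    have := matEval_expMul_eq_zero I hD hI (hmem j hj)
    rwa [matEval_charpolyTaylor] at this
  obtain ⟨Q, hQ⟩ := hEdvd
  let e : PowerSeries L := PowerSeries.mk fun k => c * (k.factorial : L)⁻¹
  have hXk : ∀ k : ℕ, (X ^ k * b).mulVec v = c • v := by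
    intro k
    rw [← Matrix.mulVec_mulVec, hbv, Matrix.mulVec_smul]
    congr 1
    induction k with
    | zero => rw [pow_zero, Matrix.one_mulVec]
    | succ k ih => rw [pow_succ', ← Matrix.mulVec_mulVec, ih, hXv]
  have hroot : E.charpoly.eval e = 0 := by
    rw [Matrix.eval_charpoly, ← Matrix.exists_mulVec_eq_zero_iff]
    refine ⟨fun i => PowerSeries.C (v i), ?_, ?_⟩
    · intro h
      apply hv
      funext i
      have := congrFun h i
      simpa using this
    · rw [Matrix.sub_mulVec, sub_eq_zero]
      funext i
      ext k
      rw [Matrix.scalar_apply, Matrix.mulVec_diagonal, PowerSeries.coeff_mul_C, PowerSeries.coeff_mk,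
        Matrix.mulVec, dotProduct, map_sum]
      have h2 := congrFun (hXk k) i
      rw [Matrix.mulVec, dotProduct, Pi.smul_apply, smul_eq_mul] at h2
      rw [mul_right_comm, ← h2, Finset.sum_mul]
      refine Finset.sum_congr rfl fun j _ => ?_
      rw [PowerSeries.coeff_mul_C, hE, expMul_apply, PowerSeries.coeff_mk]
      ring
  have hQe : Q.eval e = 0 := by
    rw [hQ, Polynomial.eval_mul, Polynomial.eval_pow, Polynomial.eval_sub, Polynomial.eval_X,
      Polynomial.eval_C] at hroot
    refine (mul_eq_zero.mp hroot).resolve_left (pow_ne_zero _ ?_)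
    intro h
    have := congrArg (PowerSeries.coeff 1) h
    rw [map_sub, PowerSeries.coeff_mk, PowerSeries.coeff_C] at this
    simp [hc] at this
  have hEb : E.charpoly.map (PowerSeries.constantCoeff (R := L)) = b.charpoly := by
    rw [← Matrix.charpoly_map]
    congr 1
    ext i j
    change PowerSeries.constantCoeff (E i j) = _
    rw [hE, expMul_apply,
      ← PowerSeries.coeff_zero_eq_constantCoeff_apply, PowerSeries.coeff_mk]
    simp
  have hQc : (Q.map (PowerSeries.constantCoeff (R := L))).eval c = 0 := by
    have h3 : PowerSeries.constantCoeff e = c := by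
      rw [← PowerSeries.coeff_zero_eq_constantCoeff_apply, PowerSeries.coeff_mk]
      simp
    have := Polynomial.eval_map_apply (PowerSeries.constantCoeff (R := L)) e (p := Q)
    rw [h3, hQe, map_zero] at this
    exact this
  have hb0 : b.charpoly ≠ 0 := b.charpoly_monic.ne_zero
  refine Polynomial.pow_rootMultiplicity_not_dvd hb0 c ?_
  rw [← hs]
  have h4 : b.charpoly = (Polynomial.X - Polynomial.C c) ^ s *
      Q.map (PowerSeries.constantCoeff (R := L)) := by
    rw [← hEb, hQ, Polynomial.map_mul, Polynomial.map_pow, Polynomial.map_sub, Polynomial.map_X,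
      Polynomial.map_C, PowerSeries.constantCoeff_C]
  rw [h4, pow_succ]
  exact mul_dvd_mul_left _ (Polynomial.dvd_iff_isRoot.mpr hQc)

end LieAux

namespace LieAux

open IsNilpotent

variable {L V G : Type*} [Field L] [CharZero L] [AddCommGroup V] [Module L V] [Group G]
  [Algebra ℚ (Module.End L V)]

section Twist

variable (r : G →* Module.End L V) (H : Subgroup G) [H.Normal] (χ : G →* Lˣ)

/-- The action of `G` on the span of the logarithms, twisted by the inverse of `χ`. -/
noncomputable def twist : G →* Module.End L (logSpan r H) where
  toFun g := ((χ g)⁻¹ : Lˣ) • (conjL r g).restrict fun _ hx => conjL_mem_logSpan g hx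
  map_one' := by
    ext x : 2
    simp [Units.smul_def, LinearMap.restrict_apply]
  map_mul' g h := by
    ext x : 2
    simp [Units.smul_def, LinearMap.restrict_apply, conjL_mul, mul_smul, mul_comm]
    rw [smul_comm]

lemma twist_apply (g : G) (x : logSpan r H) :
    (twist r H χ g x : Module.End L V) = ((χ g)⁻¹ : Lˣ) • (r g * x * r g⁻¹) := rfl

/-- The adjoint action of the span of the logarithms on itself. -/
noncomputable def adW : logSpan r H →ₗ[L] Module.End L (logSpan r H) where
  toFun x := (adL L (x : Module.End L V)).restrict fun y hy => isLieClosed_logSpan x x.2 y hy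
  map_add' x y := by
    ext z : 2
    change (x + y : Module.End L V) * z - z * (x + y) = (x * z - z * x) + (y * z - z * y)
    rw [add_mul, mul_add]
    abel
  map_smul' a x := by
    ext z : 2
    change a • (x : Module.End L V) * z - z * (a • (x : Module.End L V)) =
      a • ((x : Module.End L V) * z - z * x)
    rw [smul_mul_assoc, mul_smul_comm, smul_sub]

lemma adW_apply (x y : logSpan r H) :
    (adW r H x y : Module.End L V) = adL L (x : Module.End L V) y := rfl

lemma adW_pow_apply (x y : logSpan r H) (k : ℕ) :
    ((adW r H x ^ k) y : Module.End L V) = (adL L (x : Module.End L V) ^ k) y := by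
  induction k with
  | zero => rfl
  | succ k ih => rw [_root_.pow_succ', _root_.pow_succ', Module.End.mul_apply, adW_apply, ih]; rfl

end Twist

variable {r : G →* Module.End L V} {χ : G →* Lˣ} [FiniteDimensional L V]

omit [FiniteDimensional L V] in
lemma exists_twist_pow {N : logSpan r χ.ker} (hN : (N : Module.End L V) ∈ logSet r χ.ker) :
    ∃ M : ℕ, adW r χ.ker N ^ M = 0 ∧ ∃ τ ∈ χ.ker, ∀ k : ℕ, twist r χ.ker χ (τ ^ k) =
      ∑ i ∈ Finset.range M, (k : L) ^ i • (i.factorial : L)⁻¹ • adW r χ.ker N ^ i := by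
  obtain ⟨hnil, τ, hτ, hexp⟩ := hN
  obtain ⟨M, -, hM, hk⟩ := exists_conj_pow (L := L) hnil
  refine ⟨M, ?_, τ, hτ, fun k => ?_⟩
  · ext y : 2
    rw [adW_pow_apply, hM]
    rfl
  · ext y : 2
    have h1 : χ (τ ^ k) = 1 := by rw [map_pow, MonoidHom.mem_ker.mp hτ, one_pow]
    rw [twist_apply, h1, inv_one, one_smul, ← inv_pow, map_pow, map_pow, ← hexp,
      ← exp_neg_eq hnil hexp, hk]
    simp only [LinearMap.sum_apply, LinearMap.smul_apply, Submodule.coe_sum, Submodule.coe_smul,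
      adW_pow_apply]

/-- If the twisted action of `g` fixes a nonzero nilpotent element, then the multiplicity of the
eigenvalue one drops somewhere on any coset `U g` of a subgroup of finite index. -/
theorem exists_twist_rootMultiplicity_lt (hss : HasStableComplements r) (U : Subgroup G)
    [U.FiniteIndex] {g : G} {N : logSpan r χ.ker} (hN : N ≠ 0)
    (hnil : IsNilpotent (N : Module.End L V)) (hg : twist r χ.ker χ g N = N) :
    ∃ u ∈ U, (twist r χ.ker χ (u * g)).charpoly.rootMultiplicity 1 <
      (twist r χ.ker χ g).charpoly.rootMultiplicity 1 := by
  obtain ⟨x, hx, hxN⟩ := exists_commutator_eq_self hss N.2 hnil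
  let B := Module.finBasis L (logSpan r χ.ker)
  let φ := LinearMap.toMatrixAlgEquiv B
  let 𝒮 := {S | ∃ u ∈ U, u ∈ χ.ker ∧ S = φ (twist r χ.ker χ u)}
  let 𝒩 := {Y | ∃ N : logSpan r χ.ker, (N : Module.End L V) ∈ logSet r χ.ker ∧
    Y = φ (adW r χ.ker N)}
  have hX : φ (adW r χ.ker ⟨x, hx⟩) ∈ Submodule.span L 𝒩 := by
    clear hxN
    have key : ∀ x (hx : x ∈ Submodule.span L (logSet r χ.ker)),
        φ (adW r χ.ker ⟨x, hx⟩) ∈ Submodule.span L 𝒩 := by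
      intro x hx
      induction hx using Submodule.span_induction with
      | mem y hy => exact Submodule.subset_span ⟨⟨y, Submodule.subset_span hy⟩, hy, rfl⟩
      | zero =>
        have : (⟨0, Submodule.zero_mem _⟩ : logSpan r χ.ker) = 0 := rfl
        rw [this, map_zero, map_zero]
        exact Submodule.zero_mem _
      | add a b ha hb iha ihb =>
        have : (⟨a + b, Submodule.add_mem _ ha hb⟩ : logSpan r χ.ker) = ⟨a, ha⟩ + ⟨b, hb⟩ := rfl
        rw [this, map_add, map_add]
        exact Submodule.add_mem _ iha ihb
      | smul c a ha iha =>
        have : (⟨c • a, Submodule.smul_mem _ c ha⟩ : logSpan r χ.ker) = c • ⟨a, ha⟩ := rfl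
        rw [this, map_smul, map_smul]
        exact Submodule.smul_mem _ _ iha
    exact key x hx
  have hcoord : ∀ (f : Module.End L (logSpan r χ.ker)), (φ f).mulVec (B.repr N) = B.repr (f N) :=
    fun f => LinearMap.toMatrix_mulVec_repr B B f N
  obtain ⟨S, ⟨u, huU, hu, rfl⟩, hlt⟩ := exists_rootMultiplicity_lt 𝒮 𝒩
    ⟨1, U.one_mem, Subgroup.one_mem _, by rw [map_one, map_one]⟩
    (by
      rintro Y ⟨N, hN, rfl⟩
      obtain ⟨M, hM, τ, hτ, hk⟩ := exists_twist_pow hN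
      obtain ⟨m, hm, -, hmU⟩ := U.exists_pow_mem_of_index_ne_zero Subgroup.FiniteIndex.index_ne_zero τ
      refine ⟨M, m, by rw [← map_pow, hM, map_zero], hm.ne', ?_⟩
      rintro S ⟨u, huU, hu, rfl⟩ j
      refine ⟨τ ^ (m * j) * u, U.mul_mem (by rw [pow_mul]; exact U.pow_mem hmU j) huU,
        Subgroup.mul_mem _ (Subgroup.pow_mem _ hτ _) hu, ?_⟩
      rw [map_mul, map_mul, hk, map_sum]
      simp only [map_smul, map_pow])
    hX (v := B.repr N) (b := φ (twist r χ.ker χ g)) (c := 1)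
    (by
      intro h
      apply hN
      apply B.repr.injective
      rw [map_zero]
      exact DFunLike.coe_injective h)
    one_ne_zero
    (by
      rw [hcoord]
      congr 2
      exact Subtype.ext hxN)
    (by rw [hcoord, hg, one_smul])
  refine ⟨u, huU, ?_⟩
  rw [← map_mul, ← map_mul] at hlt
  have hch : ∀ f : Module.End L (logSpan r χ.ker), (φ f).charpoly = f.charpoly :=
    fun f => LinearMap.charpoly_toMatrix f B
  rwa [hch, hch] at hlt

end LieAux

namespace ZariskiMeasure

open MeasureTheory Filter Pointwise

section Measure

variable {G : Type*} [Group G] [TopologicalSpace G] [IsTopologicalGroup G] [CompactSpace G]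
  [MeasurableSpace G] [BorelSpace G] (μ : Measure G) [μ.IsMulLeftInvariant] [IsFiniteMeasure μ]

omit [CompactSpace G] [IsFiniteMeasure μ] in
lemma measure_preimage_quotient (N : Subgroup G) (hN : IsOpen (N : Set G)) (S : Finset (G ⧸ N)) :
    μ ((QuotientGroup.mk : G → G ⧸ N) ⁻¹' S) = S.card * μ N := by
  have hpre : ∀ g : G, (QuotientGroup.mk : G → G ⧸ N) ⁻¹' {(g : G ⧸ N)} = g • (N : Set G) := by
    intro g
    ext x
    rw [Set.mem_preimage, Set.mem_singleton_iff, eq_comm, QuotientGroup.eq,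
      Set.mem_smul_set_iff_inv_smul_mem]
    rfl
  have hopen : ∀ g : G, IsOpen (g • (N : Set G)) := fun g => hN.smul g
  rw [← sum_measure_preimage_singleton S]
  · rw [Finset.sum_congr rfl (g := fun _ => μ N), Finset.sum_const, nsmul_eq_mul]
    intro q _
    induction q using QuotientGroup.induction_on with
    | H g => rw [hpre, measure_smul]
  · intro q _
    induction q using QuotientGroup.induction_on with
    | H g => rw [hpre]; exact (hopen g).measurableSet

omit [MeasurableSpace G] [BorelSpace G] in
lemma finite_quotient_of_isOpen (N : Subgroup G) (hN : IsOpen (N : Set G)) : Finite (G ⧸ N) :=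
  Subgroup.quotient_finite_of_isOpen N hN

/-- The density of a closed null set in the finite quotients tends to zero. -/
theorem eventually_ncard_image_le [T2Space G] [NeZero μ] {C : Set G} (hC : IsClosed C)
    (hC0 : μ C = 0) (N : ℕ → Subgroup G) (hanti : Antitone N)
    (hopen : ∀ k, IsOpen (N k : Set G))
    (hinv : ∀ g ∈ C, ∀ x, (∀ k, x ∈ N k) → g * x ∈ C) {ε : ℝ} (hε : 0 < ε) :
    ∀ᶠ k in atTop, (((QuotientGroup.mk : G → G ⧸ N k) '' C).ncard : ℝ) ≤ ε * (N k).index := by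
  let D : ℕ → Set G := fun k => (QuotientGroup.mk : G → G ⧸ N k) ⁻¹' (QuotientGroup.mk '' C)
  have hDmem : ∀ k g, g ∈ D k ↔ ∃ c ∈ C, g⁻¹ * c ∈ N k := by
    intro k g
    constructor
    · rintro ⟨c, hc, h⟩
      exact ⟨c, hc, QuotientGroup.eq.mp h.symm⟩
    · rintro ⟨c, hc, h⟩
      exact ⟨c, hc, (QuotientGroup.eq.mpr h).symm⟩
  have hDanti : Antitone D := by
    intro i j hij g hg
    rw [hDmem] at hg ⊢
    obtain ⟨c, hc, h⟩ := hg
    exact ⟨c, hc, hanti hij h⟩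
  have hclosed : ∀ k, IsClosed (N k : Set G) := fun k => (N k).isClosed_of_isOpen (hopen k)
  have hDinter : ⋂ k, D k = C := by
    apply Set.Subset.antisymm
    · intro g hg
      rw [Set.mem_iInter] at hg
      let T : ℕ → Set G := fun k => C ∩ (fun c => g⁻¹ * c) ⁻¹' (N k : Set G)
      have hT : ∀ k, IsClosed (T k) := fun k =>
        hC.inter ((hclosed k).preimage (continuous_const_mul _))
      obtain ⟨c, hc⟩ := IsCompact.nonempty_iInter_of_sequence_nonempty_isCompact_isClosed T
        (fun k c hc => ⟨hc.1, hanti k.le_succ hc.2⟩)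
        (fun k => by
          obtain ⟨c, hc, h⟩ := (hDmem k g).mp (hg k)
          exact ⟨c, hc, h⟩) (hT 0).isCompact hT
      rw [Set.mem_iInter] at hc
      have := hinv c (hc 0).1 (c⁻¹ * g) fun k => by
        have := (N k).inv_mem (hc k).2
        simpa using this
      simpa using this
    · intro g hg
      rw [Set.mem_iInter]
      intro k
      exact (hDmem k g).mpr ⟨g, hg, by simp [(N k).one_mem]⟩
  have hfin : ∀ k, Finite (G ⧸ N k) := fun k => finite_quotient_of_isOpen _ (hopen k)
  have hfi : ∀ k, (N k).FiniteIndex := fun k => Subgroup.finiteIndex_of_finite_quotient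
  have hDfin : ∀ k, ((QuotientGroup.mk : G → G ⧸ N k) '' C).Finite := fun k => Set.toFinite _
  have hDmeas : ∀ k, μ (D k) = (((QuotientGroup.mk : G → G ⧸ N k) '' C).ncard : ENNReal) * μ (N k) := by
    intro k
    rw [Set.ncard_eq_toFinset_card _ (hDfin k), ← measure_preimage_quotient μ _ (hopen k),
      Set.Finite.coe_toFinset]
  have hDopen : ∀ k, IsOpen (D k) := by
    intro k
    have : D k = ⋃ c ∈ C, (fun g => g⁻¹ * c) ⁻¹' (N k : Set G) := by
      ext g
      rw [hDmem]
      simp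
    rw [this]
    exact isOpen_biUnion fun c _ => (hopen k).preimage (by fun_prop)
  have hlim : Tendsto (fun k => μ (D k)) atTop (nhds 0) := by
    have := tendsto_measure_iInter_atTop (μ := μ) (s := D)
      (fun k => (hDopen k).measurableSet.nullMeasurableSet) hDanti ⟨0, measure_ne_top _ _⟩
    rwa [hDinter, hC0] at this
  have huniv : ∀ k, μ Set.univ = ((N k).index : ENNReal) * μ (N k) := by
    intro k
    have := Fintype.ofFinite (G ⧸ N k)
    have h := measure_preimage_quotient μ _ (hopen k) Finset.univ
    rw [Finset.coe_univ, Set.preimage_univ, Finset.card_univ, ← Nat.card_eq_fintype_card] at h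
    exact h
  have hpos : 0 < μ.real Set.univ := by
    rw [measureReal_def]
    exact ENNReal.toReal_pos (NeZero.ne _ ∘ Measure.measure_univ_eq_zero.mp) (measure_ne_top _ _)
  have hlim' : Tendsto (fun k => μ.real (D k)) atTop (nhds 0) :=
    (ENNReal.tendsto_toReal ENNReal.zero_ne_top).comp hlim
  filter_upwards [hlim'.eventually_le_const (mul_pos hε hpos)] with k hk
  have h1 : μ.real (D k) = ((QuotientGroup.mk : G → G ⧸ N k) '' C).ncard * μ.real (N k) := by
    rw [measureReal_def, hDmeas, ENNReal.toReal_mul, ENNReal.toReal_natCast]; rfl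
  have h2 : μ.real Set.univ = (N k).index * μ.real (N k) := by
    rw [measureReal_def, huniv k, ENNReal.toReal_mul, ENNReal.toReal_natCast]; rfl
  rw [h1, h2, ← mul_assoc] at hk
  refine le_of_mul_le_mul_right hk ?_
  rw [h2] at hpos
  exact pos_of_mul_pos_right hpos (Nat.cast_nonneg _)

end Measure

variable {G : Type*} [Group G] {L : Type*} [Field L]

/-- The zero locus of an ideal of an algebra of functions. -/
def zeroLocus (R : Subalgebra L (G → L)) (I : Ideal R) : Set G :=
  {g | ∀ f ∈ I, (f : G → L) g = 0}

variable [TopologicalSpace G] [IsTopologicalGroup G] [CompactSpace G]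
  [MeasurableSpace G] [BorelSpace G] (μ : Measure G) [μ.IsMulLeftInvariant] [IsFiniteMeasure μ]
  [NeZero μ] (R : Subalgebra L (G → L))

omit [CompactSpace G] in
/-- There is a zero locus of positive measure all of whose proper closed subsets are null, whose
translates are finite in number and cover the group. -/
theorem exists_irreducible_cover [IsNoetherianRing R]
    (htrans : ∀ f ∈ R, ∀ γ, (fun g => f (γ * g)) ∈ R)
    (hclosed : ∀ f ∈ R, IsClosed {g | f g = 0}) :
    ∃ 𝒴 : Set (Set G), 𝒴.Finite ∧ (∀ g, ∃ Y ∈ 𝒴, g ∈ Y) ∧ ∀ Y ∈ 𝒴, IsClosed Y ∧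
      (∀ f ∈ R, (∀ y ∈ Y, f y = 0) ∨ μ (Y ∩ {g | f g = 0}) = 0) ∧
      (∀ x, (∀ f ∈ R, ∀ g, f (g * x) = f g) → ∀ g ∈ Y, g * x ∈ Y) ∧
      ∃ U : Subgroup G, U.FiniteIndex ∧ ∀ u ∈ U, ∀ g ∈ Y, u * g ∈ Y := by
  obtain ⟨I, hI, hmax⟩ := set_has_maximal_iff_noetherian.mpr ‹IsNoetherianRing R›
    {I : Ideal R | μ (zeroLocus R I) ≠ 0} ⟨⊥, by
      have : zeroLocus R ⊥ = Set.univ := by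
        ext g
        simp [zeroLocus]
      change μ _ ≠ 0
      rw [this]
      exact NeZero.ne _ ∘ Measure.measure_univ_eq_zero.mp⟩
  set Y := zeroLocus R I with hY
  have hYc : IsClosed Y := by
    have : Y = ⋂ f ∈ I, {g | (f : G → L) g = 0} := by
      ext g
      simp [hY, zeroLocus]
    rw [this]
    exact isClosed_biInter fun f _ => hclosed f f.2
  have hirr : ∀ f ∈ R, (∀ y ∈ Y, f y = 0) ∨ μ (Y ∩ {g | f g = 0}) = 0 := by
    intro f hf
    by_contra! hcon
    obtain ⟨⟨y, hy, hfy⟩, hpos⟩ := hcon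
    refine hmax (I ⊔ Ideal.span {⟨f, hf⟩}) ?_ ?_
    · change μ _ ≠ 0
      have : zeroLocus R (I ⊔ Ideal.span {⟨f, hf⟩}) = Y ∩ {g | f g = 0} := by
        ext g
        constructor
        · intro h
          exact ⟨fun a ha => h a (Ideal.mem_sup_left ha),
            h ⟨f, hf⟩ (Ideal.mem_sup_right (Ideal.mem_span_singleton_self _))⟩
        · rintro ⟨h1, h2⟩ a ha
          obtain ⟨b, hb, c, hc, rfl⟩ := Submodule.mem_sup.mp ha
          obtain ⟨d, rfl⟩ := Ideal.mem_span_singleton'.mp hc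
          have h2' : f g = 0 := h2
          change (b : G → L) g + (d : G → L) g * f g = 0
          rw [h1 b hb, h2', mul_zero, add_zero]
      rwa [this]
    · refine lt_of_le_of_ne le_sup_left fun h => hfy ?_
      have : (⟨f, hf⟩ : R) ∈ I := by
        rw [h]
        exact Ideal.mem_sup_right (Ideal.mem_span_singleton_self _)
      exact hy _ this
  have hmem : ∀ γ g, g ∈ γ • Y ↔ ∀ f ∈ I, (f : G → L) (γ⁻¹ * g) = 0 := fun γ g => by
    rw [Set.mem_smul_set_iff_inv_smul_mem]; rfl
  have hhalf : ∀ γ : G, ¬ Y ⊆ γ • Y → μ (Y ∩ γ • Y) = 0 := by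
    intro γ h
    rw [Set.not_subset] at h
    obtain ⟨y, hy, hγ⟩ := h
    rw [hmem] at hγ
    push Not at hγ
    obtain ⟨f, hf, hfy⟩ := hγ
    rcases hirr _ (htrans f f.2 γ⁻¹) with h | h
    · exact absurd (h y hy) hfy
    · refine measure_mono_null (Set.inter_subset_inter_right _ fun g hg => ?_) h
      exact (hmem γ g).mp hg f hf
  have hdisj : ∀ γ : G, γ • Y ≠ Y → μ (Y ∩ γ • Y) = 0 := by
    intro γ h
    by_cases h1 : Y ⊆ γ • Y
    · have h2 : ¬ Y ⊆ γ⁻¹ • Y := by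
        intro h2
        apply h
        refine Set.Subset.antisymm ?_ h1
        have := Set.smul_set_mono (a := γ) h2
        rwa [smul_inv_smul] at this
      have h3 := hhalf _ h2
      rw [← measure_smul μ γ, Set.smul_set_inter, smul_inv_smul, Set.inter_comm] at h3
      exact h3
    · exact hhalf γ h1
  have hYμ : ∀ γ : G, μ (γ • Y) = μ Y := fun γ => measure_smul μ γ Y
  let 𝒴 := Set.range fun γ : G => γ • Y
  have h𝒴fin : 𝒴.Finite := by
    have := Measure.finite_const_le_meas_of_disjoint_iUnion₀ μ (ε := μ Y)
      (pos_iff_ne_zero.mpr hI) (As := fun Z : 𝒴 => (Z : Set G))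
      (by
        rintro ⟨_, γ, rfl⟩
        exact (hYc.smul γ).measurableSet.nullMeasurableSet)
      (by
        rintro ⟨_, γ, rfl⟩ ⟨_, δ, rfl⟩ hne
        change μ (γ • Y ∩ δ • Y) = 0
        rw [← measure_smul μ γ⁻¹, Set.smul_set_inter, inv_smul_smul, smul_smul]
        apply hdisj
        intro h
        apply hne
        apply Subtype.ext
        change γ • Y = δ • Y
        rw [mul_smul] at h
        rw [← smul_inv_smul γ (δ • Y), h]) (measure_ne_top _ _)
    have huniv : {i : 𝒴 | μ Y ≤ μ (i : Set G)} = Set.univ := by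
      ext ⟨_, γ, rfl⟩
      simp [hYμ]
    rw [huniv, Set.finite_univ_iff] at this
    exact this
  obtain ⟨y₀, hy₀⟩ : Y.Nonempty := by
    rw [Set.nonempty_iff_ne_empty]
    intro h
    apply hI
    change μ Y = 0
    rw [h, measure_empty]
  refine ⟨𝒴, h𝒴fin, fun g => ⟨_, ⟨g * y₀⁻¹, rfl⟩, ?_⟩, ?_⟩
  · exact ⟨y₀, hy₀, by simp⟩
  · rintro _ ⟨γ, rfl⟩
    refine ⟨hYc.smul γ, fun f hf => ?_, fun x hx g hg => ?_, ?_⟩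
    · rcases hirr _ (htrans f hf γ) with h | h
      · left
        rintro _ ⟨y, hy, rfl⟩
        exact h y hy
      · right
        rw [← h, ← measure_smul μ γ⁻¹, Set.smul_set_inter, inv_smul_smul]
        congr 2
        ext g
        rw [Set.mem_smul_set_iff_inv_smul_mem, inv_inv]
        rfl
    · change g * x ∈ γ • Y
      rw [hmem] at hg ⊢
      intro f hf
      rw [← mul_assoc, hx f f.2]
      exact hg f hf
    · refine ⟨MulAction.stabilizer G (γ • Y), ?_, fun u hu g hg => ?_⟩
      · have : Finite (MulAction.orbit G (γ • Y)) := by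
          refine (h𝒴fin.subset ?_).to_subtype
          rintro _ ⟨δ, rfl⟩
          exact ⟨δ * γ, by simp [mul_smul]⟩
        have : Finite (G ⧸ MulAction.stabilizer G (γ • Y)) :=
          Finite.of_equiv _ (MulAction.orbitEquivQuotientStabilizer G (γ • Y))
        exact Subgroup.finiteIndex_of_finite_quotient
      · have h1 : u • (γ • Y) = γ • Y := hu
        change u * g ∈ γ • Y
        rw [← h1]
        exact ⟨g, hg, rfl⟩

omit [NeZero μ] [μ.IsMulLeftInvariant] [IsFiniteMeasure μ] [MeasurableSpace G] [BorelSpace G] in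
/-- A subset on which the rank drops along cosets of all subgroups of finite index has small image
in the finite quotients. -/
theorem eventually_ncard_image_le_of_rank_drop [T2Space G] [IsNoetherianRing R]
    (htrans : ∀ f ∈ R, ∀ γ, (fun g => f (γ * g)) ∈ R)
    (hclosed : ∀ f ∈ R, IsClosed {g | f g = 0}) (t : ℕ → G → L) (ht : ∀ j, t j ∈ R)
    (rk : G → ℕ) (hrk : ∀ s g, s ≤ rk g ↔ ∀ j < s, t j g = 0) (B : Set G)
    (hB : ∀ g ∈ B, ∀ U : Subgroup G, U.FiniteIndex → ∃ u ∈ U, rk (u * g) < rk g)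
    (N : ℕ → Subgroup G) (hanti : Antitone N) (hopen : ∀ k, IsOpen (N k : Set G))
    (hN : ∀ x, (∀ k, x ∈ N k) → ∀ f ∈ R, ∀ g, f (g * x) = f g) {ε : ℝ} (hε : 0 < ε) :
    ∀ᶠ k in atTop, (((QuotientGroup.mk : G → G ⧸ N k) '' B).ncard : ℝ) ≤ ε * (N k).index := by
  borelize G
  let μ : Measure G := Measure.haar
  have : NeZero μ := ⟨by
    intro h
    have := isOpen_univ.measure_pos μ ⟨1, trivial⟩
    rw [h] at this
    simp at this⟩
  obtain ⟨𝒴, hfin, hcov, h𝒴⟩ := exists_irreducible_cover μ R htrans hclosed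
  have hmin : ∀ Y : Set G, ∃ s, (∃ y ∈ Y, rk y = s) ∧ (∀ y ∈ Y, s ≤ rk y) ∨ Y = ∅ := by
    intro Y
    rcases Y.eq_empty_or_nonempty with h | ⟨y, hy⟩
    · exact ⟨0, Or.inr h⟩
    · classical
      have hex : ∃ s, ∃ y ∈ Y, rk y = s := ⟨_, y, hy, rfl⟩
      exact ⟨Nat.find hex, Or.inl ⟨Nat.find_spec hex, fun z hz => Nat.find_min' hex ⟨z, hz, rfl⟩⟩⟩
  choose s hs using hmin
  let C : Set G := ⋃ Y ∈ 𝒴, Y ∩ {g | t (s Y) g = 0}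
  have hCc : IsClosed C := hfin.isClosed_biUnion fun Y hY => (h𝒴 Y hY).1.inter (hclosed _ (ht _))
  have hC0 : μ C = 0 := by
    rw [measure_biUnion_null_iff hfin.countable]
    intro Y hY
    rcases hs Y with ⟨⟨y, hy, hys⟩, -⟩ | h
    · rcases (h𝒴 Y hY).2.1 _ (ht (s Y)) with h | h
      · exfalso
        have h1 : s Y + 1 ≤ rk y := by
          rw [hrk]
          intro j hj
          rcases Nat.lt_succ_iff_lt_or_eq.mp hj with hj | rfl
          · exact (hrk (s Y) y).mp hys.ge j hj
          · exact h y hy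
        omega
      · exact h
    · have : Y ∩ {g | t (s Y) g = 0} ⊆ ∅ := by
        intro g hg
        rw [← h]
        exact hg.1
      exact measure_mono_null this measure_empty
  have hBC : B ⊆ C := by
    intro g hg
    obtain ⟨Y, hY, hgY⟩ := hcov g
    obtain ⟨U, hU, hUY⟩ := (h𝒴 Y hY).2.2.2
    obtain ⟨u, hu, hlt⟩ := hB g hg U hU
    rcases hs Y with ⟨-, h⟩ | h
    · have := h _ (hUY u hu g hgY)
      exact Set.mem_biUnion hY ⟨hgY, (hrk (s Y + 1) g).mp (by omega) (s Y) (Nat.lt_succ_self _)⟩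
    · rw [h] at hgY
      exact hgY.elim
  have hinv : ∀ g ∈ C, ∀ x, (∀ k, x ∈ N k) → g * x ∈ C := by
    intro g hg x hx
    obtain ⟨Y, hY, hgY, h0⟩ := Set.mem_iUnion₂.mp hg
    refine Set.mem_biUnion hY ⟨(h𝒴 Y hY).2.2.1 x (hN x hx) g hgY, ?_⟩
    change t (s Y) (g * x) = 0
    rw [hN x hx _ (ht _)]
    exact h0
  filter_upwards [eventually_ncard_image_le μ hCc hC0 N hanti hopen hinv hε] with k hk
  have := finite_quotient_of_isOpen _ (hopen k)
  refine le_trans ?_ hk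
  exact_mod_cast Set.ncard_le_ncard (Set.image_mono hBC) (Set.toFinite _)

end ZariskiMeasure

namespace ZariskiMeasure

section ZeroLocus

variable {G 𝒪 𝒦 L : Type*} [TopologicalSpace G] [CommRing 𝒪] [IsDomain 𝒪] [TopologicalSpace 𝒪]
  [IsTopologicalRing 𝒪] [T1Space 𝒪] [Field 𝒦] [Algebra 𝒪 𝒦] [IsFractionRing 𝒪 𝒦] [Field L]
  [Algebra 𝒦 L]

/-- The functions to an extension of the fraction field that come from continuous functions. -/
def contFun (G : Type*) [TopologicalSpace G] (f : 𝒪 →+* L) : Submonoid (G → L) where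
  carrier := {h | ∃ φ : G → 𝒪, Continuous φ ∧ ∀ g, h g = f (φ g)}
  one_mem' := ⟨fun _ => 1, continuous_const, fun _ => by simp⟩
  mul_mem' := by
    rintro _ _ ⟨φ, hφ, h⟩ ⟨ψ, hψ, h'⟩
    exact ⟨_, hφ.mul hψ, fun g => by simp [h, h']⟩

omit [T1Space 𝒪] in
lemma exists_smul_continuous {h : G → 𝒦}
    (hh : h ∈ Submodule.span 𝒦 (contFun G (algebraMap 𝒪 𝒦) : Set (G → 𝒦))) :
    ∃ d : 𝒪, d ≠ 0 ∧ ∃ φ : G → 𝒪, Continuous φ ∧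
      ∀ g, algebraMap 𝒪 𝒦 d * h g = algebraMap 𝒪 𝒦 (φ g) := by
  induction hh using Submodule.span_induction with
  | mem h hh =>
    obtain ⟨φ, hφ, h⟩ := hh
    exact ⟨1, one_ne_zero, φ, hφ, fun g => by rw [h, map_one, one_mul]⟩
  | zero => exact ⟨1, one_ne_zero, fun _ => 0, continuous_const, fun g => by simp⟩
  | add a b _ _ ha hb =>
    obtain ⟨d, hd, φ, hφ, h⟩ := ha
    obtain ⟨e, he, ψ, hψ, h'⟩ := hb
    refine ⟨d * e, mul_ne_zero hd he, fun g => e * φ g + d * ψ g, by fun_prop, fun g => ?_⟩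
    rw [map_add, map_mul, map_mul, map_mul, ← h, ← h', Pi.add_apply]
    ring
  | smul c a _ ha =>
    obtain ⟨d, hd, φ, hφ, h⟩ := ha
    obtain ⟨x, y, hy, rfl⟩ := IsFractionRing.div_surjective (A := 𝒪) c
    have hy0 : y ≠ 0 := nonZeroDivisors.ne_zero hy
    have hy1 : algebraMap 𝒪 𝒦 y ≠ 0 := by
      rwa [Ne, FaithfulSMul.algebraMap_eq_zero_iff]
    refine ⟨y * d, mul_ne_zero hy0 hd, fun g => x * φ g, by fun_prop, fun g => ?_⟩
    rw [map_mul, map_mul, ← h, Pi.smul_apply, smul_eq_mul]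
    field_simp

lemma isClosed_zero_of_mem_span {h : G → L}
    (hh : h ∈ Submodule.span L (contFun G ((algebraMap 𝒦 L).comp (algebraMap 𝒪 𝒦)) : Set (G → L))) :
    IsClosed {g | h g = 0} := by
  have hl : ∀ l : L →ₗ[𝒦] 𝒦, (fun g => l (h g)) ∈
      Submodule.span 𝒦 (contFun G (algebraMap 𝒪 𝒦) : Set (G → 𝒦)) := by
    intro l
    induction hh using Submodule.span_induction generalizing l with
    | mem a ha =>
      obtain ⟨φ, hφ, h⟩ := ha
      have : (fun g => l (a g)) = l 1 • fun g => algebraMap 𝒪 𝒦 (φ g) := by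
        funext g
        rw [h, RingHom.comp_apply, Algebra.algebraMap_eq_smul_one, map_smul, Pi.smul_apply,
          smul_eq_mul, smul_eq_mul, mul_comm]
      rw [this]
      exact Submodule.smul_mem _ _ (Submodule.subset_span ⟨φ, hφ, fun _ => rfl⟩)
    | zero =>
      simp only [Pi.zero_apply, map_zero]
      exact Submodule.zero_mem _
    | add a b _ _ ha hb =>
      simp only [Pi.add_apply, map_add]
      exact Submodule.add_mem _ (ha l) (hb l)
    | smul c a _ ha =>
      exact ha (l.comp (LinearMap.mulLeft 𝒦 c))
  have heq : {g | h g = 0} = ⋂ l : L →ₗ[𝒦] 𝒦, {g | l (h g) = 0} := by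
    ext g
    rw [Set.mem_iInter]
    exact (Module.forall_dual_apply_eq_zero_iff 𝒦 (h g)).symm
  rw [heq]
  refine isClosed_iInter fun l => ?_
  obtain ⟨d, hd, φ, hφ, hdφ⟩ := exists_smul_continuous (hl l)
  have : {g | l (h g) = 0} = φ ⁻¹' {0} := by
    ext g
    have hd1 : algebraMap 𝒪 𝒦 d ≠ 0 := by
      rwa [Ne, FaithfulSMul.algebraMap_eq_zero_iff]
    change l (h g) = 0 ↔ φ g = 0
    rw [← FaithfulSMul.algebraMap_eq_zero_iff 𝒪 𝒦, ← hdφ, mul_eq_zero, or_iff_right hd1]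
  rw [this]
  exact isClosed_singleton.preimage hφ

end ZeroLocus

section Regular

variable {G 𝒪 L : Type*} [Group G] [CommRing 𝒪] [Field L] (f : 𝒪 →+* L) {n : ℕ}
  (ρ : G →* Matrix.GeneralLinearGroup (Fin n) 𝒪) (χ : G →* 𝒪ˣ)

/-- The generators of the algebra of regular functions attached to `ρ` and `χ`. -/
def regularGen : Fin n × Fin n ⊕ Fin n × Fin n ⊕ Unit → G → L
  | .inl p => fun g => f ((ρ g : Matrix (Fin n) (Fin n) 𝒪) p.1 p.2)
  | .inr (.inl p) => fun g => f ((ρ g⁻¹ : Matrix (Fin n) (Fin n) 𝒪) p.1 p.2)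
  | .inr (.inr _) => fun g => f (χ g⁻¹ : 𝒪ˣ)

/-- The algebra of regular functions attached to `ρ` and `χ`. -/
def regularAlg : Subalgebra L (G → L) := Algebra.adjoin L (Set.range (regularGen f ρ χ))

instance : Algebra.FiniteType L (regularAlg f ρ χ) :=
  Algebra.FiniteType.adjoin_of_finite (Set.finite_range _)

instance : IsNoetherianRing (regularAlg f ρ χ) :=
  Algebra.FiniteType.isNoetherianRing L _

lemma regularGen_mem (i) : regularGen f ρ χ i ∈ regularAlg f ρ χ :=
  Algebra.subset_adjoin ⟨i, rfl⟩

lemma regularAlg_translate {h : G → L} (hh : h ∈ regularAlg f ρ χ) (γ : G) :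
    (fun g => h (γ * g)) ∈ regularAlg f ρ χ := by
  induction hh using Algebra.adjoin_induction with
  | mem h hh =>
    obtain ⟨i, rfl⟩ := hh
    rcases i with p | p | _
    · have : (fun g => regularGen f ρ χ (.inl p) (γ * g)) = ∑ k,
          f ((ρ γ : Matrix (Fin n) (Fin n) 𝒪) p.1 k) • regularGen f ρ χ (.inl (k, p.2)) := by
        funext g
        simp [regularGen, Matrix.mul_apply]
      rw [this]
      exact Subalgebra.sum_mem _ fun k _ => Subalgebra.smul_mem _ (regularGen_mem _ _ _ _) _
    · have : (fun g => regularGen f ρ χ (.inr (.inl p)) (γ * g)) = ∑ k,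
          f ((ρ γ⁻¹ : Matrix (Fin n) (Fin n) 𝒪) k p.2) •
            regularGen f ρ χ (.inr (.inl (p.1, k))) := by
        funext g
        simp only [regularGen, mul_inv_rev, map_mul, Units.val_mul, Matrix.mul_apply, map_sum,
          Finset.sum_apply, Pi.smul_apply, smul_eq_mul]
        exact Finset.sum_congr rfl fun _ _ => mul_comm _ _
      rw [this]
      exact Subalgebra.sum_mem _ fun k _ => Subalgebra.smul_mem _ (regularGen_mem _ _ _ _) _
    · have : (fun g => regularGen f ρ χ (.inr (.inr ())) (γ * g)) =
          f (χ γ⁻¹ : 𝒪ˣ) • regularGen f ρ χ (.inr (.inr ())) := by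
        funext g
        simp only [regularGen, mul_inv_rev, map_mul, Units.val_mul, Pi.smul_apply, smul_eq_mul]
        exact mul_comm _ _
      rw [this]
      exact Subalgebra.smul_mem _ (regularGen_mem _ _ _ _) _
  | algebraMap r => exact Subalgebra.algebraMap_mem _ r
  | add a b _ _ ha hb => exact Subalgebra.add_mem _ ha hb
  | mul a b _ _ ha hb => exact Subalgebra.mul_mem _ ha hb

lemma regularAlg_mul_right {h : G → L} (hh : h ∈ regularAlg f ρ χ) {x : G} (hx : ρ x = 1)
    (hx' : χ x = 1) (g : G) : h (g * x) = h g := by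
  induction hh using Algebra.adjoin_induction with
  | mem h hh =>
    obtain ⟨i, rfl⟩ := hh
    rcases i with p | p | _ <;> simp [regularGen, hx, hx']
  | algebraMap r => rfl
  | add a b _ _ ha hb => rw [Pi.add_apply, Pi.add_apply, ha, hb]
  | mul a b _ _ ha hb => rw [Pi.mul_apply, Pi.mul_apply, ha, hb]

lemma isClosed_zero_of_mem_regularAlg {𝒦 : Type*} [IsDomain 𝒪] [TopologicalSpace 𝒪]
    [TopologicalSpace G] [IsTopologicalGroup G] [IsTopologicalRing 𝒪] [T1Space 𝒪] [Field 𝒦]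
    [Algebra 𝒪 𝒦] [IsFractionRing 𝒪 𝒦] [Algebra 𝒦 L]
    (hρ : ∀ i j, Continuous fun g => (ρ g : Matrix (Fin n) (Fin n) 𝒪) i j)
    (hχ : Continuous fun g => (χ g : 𝒪)) {h : G → L}
    (hh : h ∈ regularAlg ((algebraMap 𝒦 L).comp (algebraMap 𝒪 𝒦)) ρ χ) :
    IsClosed {g | h g = 0} := by
  refine isClosed_zero_of_mem_span (𝒪 := 𝒪) (𝒦 := 𝒦) ?_
  have h1 : h ∈ Subalgebra.toSubmodule (regularAlg ((algebraMap 𝒦 L).comp (algebraMap 𝒪 𝒦)) ρ χ) :=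
    hh
  rw [regularAlg, Algebra.adjoin_eq_span] at h1
  refine Submodule.span_mono ?_ h1
  rw [SetLike.coe_subset_coe, Submonoid.closure_le]
  rintro _ ⟨i, rfl⟩
  rcases i with p | p | _
  · exact ⟨_, hρ p.1 p.2, fun _ => rfl⟩
  · exact ⟨_, (hρ p.1 p.2).comp continuous_inv, fun _ => rfl⟩
  · exact ⟨_, hχ.comp continuous_inv, fun _ => rfl⟩

omit [Group G] in
lemma aeval_mem_of_forall_mem {R : Subalgebra L (G → L)} {ι : Type*} (M : G → ι → L)
    (hM : ∀ i, (fun g => M g i) ∈ R) (P : MvPolynomial ι L) :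
    (fun g => MvPolynomial.aeval (M g) P) ∈ R := by
  induction P using MvPolynomial.induction_on with
  | C a =>
    simp only [MvPolynomial.algHom_C]
    exact Subalgebra.algebraMap_mem R a
  | add p q hp hq => 
    simp only [map_add]
    exact Subalgebra.add_mem _ hp hq
  | mul_X p i hp => 
    simp only [map_mul, MvPolynomial.aeval_X]
    exact Subalgebra.mul_mem _ hp (hM i)

lemma matrixRep_eq_sum (g : G) : matrixRep f ρ g = ∑ p : Fin n × Fin n,
    f ((ρ g : Matrix (Fin n) (Fin n) 𝒪) p.1 p.2) •
      Matrix.toLin' (Matrix.single p.1 p.2 (1 : L)) := by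
  have h1 : matrixRep f ρ g = Matrix.toLin' ((ρ g : Matrix (Fin n) (Fin n) 𝒪).map f) := rfl
  rw [h1]
  conv_lhs => rw [Matrix.matrix_eq_sum_single ((ρ g : Matrix (Fin n) (Fin n) 𝒪).map f)]
  rw [Fintype.sum_prod_type]
  simp only [map_sum]
  refine Finset.sum_congr rfl fun i _ => Finset.sum_congr rfl fun j _ => ?_
  rw [← map_smul, Matrix.smul_single, smul_eq_mul, mul_one, Matrix.map_apply]

lemma conj_mem_regularAlg (l : Module.End L (Fin n → L) →ₗ[L] L) (x : Module.End L (Fin n → L)) :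
    (fun g => l (matrixRep f ρ g * x * matrixRep f ρ g⁻¹)) ∈ regularAlg f ρ χ := by
  let e : Fin n × Fin n → Module.End L (Fin n → L) :=
    fun p => Matrix.toLin' (Matrix.single p.1 p.2 (1 : L))
  have : (fun g => l (matrixRep f ρ g * x * matrixRep f ρ g⁻¹)) = ∑ p, ∑ q,
      l (e p * x * e q) • (regularGen f ρ χ (.inl p) * regularGen f ρ χ (.inr (.inl q))) := by
    funext g
    rw [matrixRep_eq_sum f ρ g, matrixRep_eq_sum f ρ g⁻¹, Finset.sum_mul, Finset.sum_mul_sum,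
      map_sum, Finset.sum_apply]
    refine Finset.sum_congr rfl fun p _ => ?_
    rw [map_sum, Finset.sum_apply]
    refine Finset.sum_congr rfl fun q _ => ?_
    simp only [smul_mul_assoc, mul_smul_comm, map_smul, smul_eq_mul, regularGen, Pi.smul_apply,
      Pi.mul_apply, e]
    ring
  rw [this]
  exact Subalgebra.sum_mem _ fun p _ => Subalgebra.sum_mem _ fun q _ => Subalgebra.smul_mem _
    (Subalgebra.mul_mem _ (regularGen_mem _ _ _ _) (regularGen_mem _ _ _ _)) _

end Regular

section Bad

open LieAux

variable {G L V : Type*} [Group G] [Field L] [CharZero L] [AddCommGroup V] [Module L V]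
  [Algebra ℚ (Module.End L V)]

/-- The elements which act on some nonzero nilpotent element of the span of the logarithms through
the character `χ`. -/
def badSet (r : G →* Module.End L V) (χ : G →* Lˣ) : Set G :=
  {g | ∃ N ∈ logSpan r χ.ker, N ≠ 0 ∧ IsNilpotent N ∧ r g * N * r g⁻¹ = (χ g : L) • N}

variable {r : G →* Module.End L V} {χ : G →* Lˣ} {R : Subalgebra L (G → L)}

lemma twist_mem_of_conj_mem (H : Subgroup G) [H.Normal]
    (hr : ∀ (l : Module.End L V →ₗ[L] L) x, (fun g => l (r g * x * r g⁻¹)) ∈ R)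
    (hχ : (fun g => ((χ g)⁻¹ : Lˣ).val) ∈ R)
    (l : logSpan r H →ₗ[L] L) (x : logSpan r H) : (fun g => l (twist r H χ g x)) ∈ R := by
  obtain ⟨l', hl'⟩ := l.exists_extend
  have : (fun g => l (twist r H χ g x)) =
      (fun g => ((χ g)⁻¹ : Lˣ).val) * fun g => l' (r g * x * r g⁻¹) := by
    funext g
    rw [← hl', LinearMap.comp_apply, Submodule.subtype_apply, twist_apply, Units.smul_def,
      map_smul, smul_eq_mul, Pi.mul_apply]
  rw [this]
  exact Subalgebra.mul_mem _ hχ (hr _ _)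

theorem eventually_ncard_image_badSet_le [FiniteDimensional L V] [IsNoetherianRing R]
    [TopologicalSpace G] [IsTopologicalGroup G] [CompactSpace G] [T2Space G]
    (htrans : ∀ f ∈ R, ∀ γ, (fun g => f (γ * g)) ∈ R)
    (hclosed : ∀ f ∈ R, IsClosed {g | f g = 0})
    (hr : ∀ (l : Module.End L V →ₗ[L] L) x, (fun g => l (r g * x * r g⁻¹)) ∈ R)
    (hχ : (fun g => ((χ g)⁻¹ : Lˣ).val) ∈ R) (hss : HasStableComplements r)
    (N : ℕ → Subgroup G) (hanti : Antitone N) (hopen : ∀ k, IsOpen (N k : Set G))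
    (hN : ∀ x, (∀ k, x ∈ N k) → ∀ f ∈ R, ∀ g, f (g * x) = f g) {ε : ℝ} (hε : 0 < ε) :
    ∀ᶠ k in Filter.atTop, (((QuotientGroup.mk : G → G ⧸ N k) '' badSet r χ).ncard : ℝ) ≤
      ε * (N k).index := by
  let T := twist r χ.ker χ
  let B := Module.finBasis L (logSpan r χ.ker)
  let ι := Fin (Module.finrank L (logSpan r χ.ker))
  let M : G → Matrix ι ι L := fun g => LinearMap.toMatrix B B (T g)
  have hch : ∀ g, (M g).charpoly = (T g).charpoly := fun g => LinearMap.charpoly_toMatrix _ B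
  refine eventually_ncard_image_le_of_rank_drop R htrans hclosed
    (fun j g => matEval (M g) (charpolyTaylor (L := L) ι 1 j)) (fun j => ?_)
    (fun g => (T g).charpoly.rootMultiplicity 1) (fun s g => ?_) _ ?_ N hanti hopen hN hε
  · refine aeval_mem_of_forall_mem (R := R) (fun g (p : ι × ι) => M g p.1 p.2) (fun p => ?_) _
    simp only [M, LinearMap.toMatrix_apply]
    exact twist_mem_of_conj_mem _ hr hχ (B.coord p.1) (B p.2)
  · rw [Polynomial.le_rootMultiplicity_iff (LinearMap.charpoly_monic _).ne_zero,
      X_sub_C_pow_dvd_iff_taylor]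
    simp only [matEval_charpolyTaylor, hch, map_one]
  · rintro g ⟨N, hN, hN0, hnil, hg⟩ U hU
    refine exists_twist_rootMultiplicity_lt hss U (N := ⟨N, hN⟩)
      (fun h => hN0 (congrArg Subtype.val h)) hnil (Subtype.ext ?_)
    rw [twist_apply, hg, Units.smul_def, smul_smul, Units.inv_mul, one_smul]

end Bad

section Semisimple

variable {G L : Type*} [Group G] [Field L] {n : ℕ} (r : Representation L G (Fin n → L))

lemma hasStableComplements_of_isSemisimpleModule
    (h : IsSemisimpleModule (MonoidAlgebra L G) r.asModule) :
    LieAux.HasStableComplements (L := L) (V := Fin n → L) r := by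
  intro V₀ hV₀
  have : Representation.IsSemisimpleRepresentation r :=
    (Representation.isSemisimpleRepresentation_iff_isSemisimpleModule_asModule r).mpr h
  obtain ⟨W, hW⟩ := exists_isCompl (⟨V₀, hV₀⟩ : Subrepresentation r)
  refine ⟨W.toSubmodule, fun g v hv => W.apply_mem_toSubmodule g hv, ?_⟩
  rw [isCompl_iff, disjoint_iff, codisjoint_iff] at hW ⊢
  exact ⟨congrArg Subrepresentation.toSubmodule hW.1, congrArg Subrepresentation.toSubmodule hW.2⟩

end Semisimple

/-- The bad set of `ρ` and `χ` has small image in the finite quotients. -/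
theorem eventually_ncard_image_badSet_matrixRep_le {G 𝒪 𝒦 L : Type*} [Group G] [CommRing 𝒪]
    [Field L] [CharZero L] {f : 𝒪 →+* L} {n : ℕ}
    {ρ : G →* Matrix.GeneralLinearGroup (Fin n) 𝒪} {χ : G →* 𝒪ˣ}
    [Algebra ℚ (Module.End L (Fin n → L))] [IsDomain 𝒪] [TopologicalSpace 𝒪]
    [TopologicalSpace G] [IsTopologicalGroup G] [CompactSpace G] [T2Space G] [IsTopologicalRing 𝒪]
    [T1Space 𝒪] [Field 𝒦] [Algebra 𝒪 𝒦] [IsFractionRing 𝒪 𝒦] [Algebra 𝒦 L]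
    (hf : f = (algebraMap 𝒦 L).comp (algebraMap 𝒪 𝒦))
    (hρ : ∀ i j, Continuous fun g => (ρ g : Matrix (Fin n) (Fin n) 𝒪) i j)
    (hχ : Continuous fun g => (χ g : 𝒪))
    (hss : IsSemisimpleModule (MonoidAlgebra L G) (matrixRep f ρ).asModule)
    (N : ℕ → Subgroup G) (hanti : Antitone N) (hopen : ∀ k, IsOpen (N k : Set G))
    (hN : ∀ x, (∀ k, x ∈ N k) → ρ x = 1 ∧ χ x = 1) {ε : ℝ} (hε : 0 < ε) :
    ∀ᶠ k in Filter.atTop, (((QuotientGroup.mk : G → G ⧸ N k) ''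
      badSet (matrixRep f ρ) ((Units.map (f : 𝒪 →* L)).comp χ)).ncard : ℝ) ≤
        ε * (N k).index := by
  refine eventually_ncard_image_badSet_le (R := regularAlg f ρ χ)
    (fun h hh γ => regularAlg_translate f ρ χ hh γ) (fun h hh => ?_)
    (conj_mem_regularAlg f ρ χ) ?_ (hasStableComplements_of_isSemisimpleModule _ hss) N hanti hopen
    (fun x hx h hh g => regularAlg_mul_right f ρ χ hh (hN x hx).1 (hN x hx).2 g) hε
  · subst hf
    exact isClosed_zero_of_mem_regularAlg ρ χ hρ hχ hh
  · have := regularGen_mem f ρ χ (.inr (.inr ()))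
    convert this using 2 with g
    rw [← map_inv]
    rfl

end ZariskiMeasure

namespace Quasiunipotent

open UnipotentLog

variable {L V : Type*} [Field L] [CharZero L] [IsAlgClosed L] [AddCommGroup V] [Module L V]
  [FiniteDimensional L V]

omit [CharZero L] in
lemma trace_eq_sum_roots (x : Module.End L V) :
    LinearMap.trace L V x = x.charpoly.roots.sum :=
  Module.End.trace_eq_sum_roots_charpoly_of_splits (IsAlgClosed.splits _)

lemma isNilpotent_of_spectrum {x : Module.End L V} (h : ∀ a ∈ spectrum L x, a = 0) :
    IsNilpotent x := by
  refine isNilpotent_of_trace_pow_eq_zero x fun k => ?_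
  rw [trace_eq_sum_roots]
  refine Multiset.sum_eq_zero fun a ha => ?_
  have h1 : a ∈ spectrum L (x ^ (k + 1)) :=
    (Module.End.mem_spectrum_iff_isRoot_charpoly _ _).mpr (Polynomial.isRoot_of_mem_roots ha)
  rw [spectrum.map_pow_of_pos x k.succ_pos] at h1
  obtain ⟨b, hb, rfl⟩ := h1
  simp [h b hb]

/-- An invertible operator conjugate to a proper power of itself is quasi-unipotent. -/
lemma exists_pow_sub_one_isNilpotent {x : Module.End L V} (hx : IsUnit x) (g : (Module.End L V)ˣ)
    {q : ℕ} (hq : 2 ≤ q) (h : g * x * (g⁻¹ : (Module.End L V)ˣ) = x ^ q) :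
    ∃ M : ℕ, 0 < M ∧ IsNilpotent (x ^ M - 1) := by
  have hsp : spectrum L x = (fun a => a ^ q) '' spectrum L x := by
    rw [← spectrum.map_pow_of_pos x (by omega : 0 < q), ← h]
    exact (spectrum.units_conjugate (u := g)).symm
  have hfin : (spectrum L x).Finite := Module.End.finite_spectrum x
  have hmaps : Set.MapsTo (fun a => a ^ q) (spectrum L x) (spectrum L x) := fun a ha => by
    rw [hsp]
    exact ⟨a, ha, rfl⟩
  have hsurj : Set.SurjOn (fun a => a ^ q) (spectrum L x) (spectrum L x) := hsp.subset
  let φ : spectrum L x → spectrum L x := hmaps.restrict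
  have : Finite (spectrum L x) := hfin
  have hbij : Function.Bijective φ :=
    Finite.surjective_iff_bijective.mp ((Set.MapsTo.restrict_surjective_iff hmaps).mpr hsurj)
  let e : Equiv.Perm (spectrum L x) := Equiv.ofBijective φ hbij
  obtain ⟨k, hk, hek⟩ := isOfFinOrder_iff_pow_eq_one.mp (isOfFinOrder_of_finite e)
  have hiter : ∀ (j : ℕ) (a : spectrum L x), (((e ^ j) a : spectrum L x) : L) = (a : L) ^ q ^ j := by
    intro j
    induction j with
    | zero => intro a; simp
    | succ j ih =>
      intro a
      rw [pow_succ', Equiv.Perm.mul_apply]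
      change (((e ^ j) a : spectrum L x) : L) ^ q = _
      rw [ih, ← pow_mul, pow_succ]
  have hqk : 2 ≤ q ^ k := hq.trans (Nat.le_self_pow hk.ne' q)
  refine ⟨q ^ k - 1, by omega, isNilpotent_of_spectrum fun a ha => ?_⟩
  have h1 : a + 1 ∈ spectrum L (x ^ (q ^ k - 1)) := by
    have h2 := (spectrum.add_mem_iff (R := L) (a := x ^ (q ^ k - 1)) (s := 1) (r := a)).mpr (by
      rw [map_one, neg_add_eq_sub]
      exact ha)
    exact h2
  rw [spectrum.map_pow_of_pos x (by omega)] at h1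
  obtain ⟨b, hb, hba⟩ := h1
  have hb0 : b ≠ 0 := by
    rintro rfl
    exact (spectrum.zero_notMem_iff L).mpr hx hb
  have h3 := hiter k ⟨b, hb⟩
  rw [hek] at h3
  have h4 : b ^ (q ^ k - 1) * b = 1 * b := by
    rw [← pow_succ, Nat.sub_add_cancel (by omega), one_mul]
    exact h3.symm
  have h5 := mul_right_cancel₀ hb0 h4
  have hba' : b ^ (q ^ k - 1) = a + 1 := hba
  rw [h5] at hba'
  simpa using hba'.symm

omit [CharZero L] [IsAlgClosed L] [FiniteDimensional L V] in
lemma trace_mul_of_isNilpotent_sub_one {x w : Module.End L V} (h : Commute x w)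
    (hw : IsNilpotent (w - 1)) : LinearMap.trace L V (x * w) = LinearMap.trace L V x := by
  have : x * w = x + x * (w - 1) := by noncomm_ring
  rw [this, map_add, trace_eq_zero_of_isNilpotent
    (Commute.isNilpotent_mul_left (h.sub_right (Commute.one_right x)) hw), add_zero]

omit [CharZero L] [IsAlgClosed L] [AddCommGroup V] [Module L V] [FiniteDimensional L V] [Field L] in
lemma isNilpotent_pow_sub_one {A : Type*} [Ring A] {w : A} (hw : IsNilpotent (w - 1)) (k : ℕ) :
    IsNilpotent (w ^ k - 1) := by
  rw [← mul_geom_sum]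
  refine Commute.isNilpotent_mul_right ?_ hw
  exact Commute.sum_right _ _ _ fun i _ => ((Commute.refl w).sub_left (Commute.one_left w)).pow_right i

/-- An operator all of whose positive powers have the trace of the identity is unipotent. -/
lemma isNilpotent_sub_one_of_trace_pow {x : Module.End L V}
    (h : ∀ k : ℕ, LinearMap.trace L V (x ^ k) = LinearMap.trace L V 1) : IsNilpotent (x - 1) := by
  refine isNilpotent_of_trace_pow_eq_zero _ fun k => ?_
  have hc : Commute x (-1 : Module.End L V) := (Commute.one_right x).neg_right
  rw [sub_eq_add_neg, hc.add_pow, map_sum]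
  have : ∀ i ∈ Finset.range (k + 1 + 1), LinearMap.trace L V
      (x ^ i * (-1) ^ (k + 1 - i) * ((k + 1).choose i : Module.End L V)) =
      ((1 : L) ^ i * (-1) ^ (k + 1 - i) * (k + 1).choose i) * LinearMap.trace L V 1 := by
    intro i _
    have : x ^ i * (-1) ^ (k + 1 - i) * ((k + 1).choose i : Module.End L V) =
        ((1 : L) ^ i * (-1) ^ (k + 1 - i) * (k + 1).choose i) • x ^ i := by
      rw [one_pow, one_mul, Algebra.smul_def, map_mul, map_pow, map_neg, map_one, map_natCast,
        mul_assoc]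
      exact (((Commute.one_left _).neg_left.pow_left _).mul_left (Nat.cast_commute _ _)).eq.symm
    rw [this, map_smul, h, smul_eq_mul]
  rw [Finset.sum_congr rfl this, ← Finset.sum_mul, ← (Commute.all (1 : L) (-1)).add_pow]
  simp

omit [CharZero L] in
/-- The traces of the operators whose `p`-th power is unipotent form a finite set. -/
lemma finite_trace_of_pow (p : ℕ) (hp : 0 < p) :
    {t : L | ∃ x : Module.End L V, IsNilpotent (x ^ p - 1) ∧ LinearMap.trace L V x = t}.Finite := by
  classical
  let R : Finset L := Polynomial.nthRootsFinset p (1 : L)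
  let d := Module.finrank L V
  have hfin : (Set.range fun v : Fin d → R => ∑ i, (v i : L)).Finite := Set.finite_range _
  refine hfin.subset ?_
  rintro _ ⟨x, hx, rfl⟩
  rw [trace_eq_sum_roots]
  have hcard : Multiset.card x.charpoly.roots = d := by
    rw [← (IsAlgClosed.splits x.charpoly).natDegree_eq_card_roots, LinearMap.charpoly_natDegree]
  have hroots : ∀ a ∈ x.charpoly.roots, a ∈ R := by
    intro a ha
    have h1 : a ∈ spectrum L x :=
      (Module.End.mem_spectrum_iff_isRoot_charpoly _ _).mpr (Polynomial.isRoot_of_mem_roots ha)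
    obtain ⟨v, hv⟩ := (Module.End.hasEigenvalue_iff_mem_spectrum.mpr h1).exists_hasEigenvector
    have h2 : (x ^ p - 1) v = (a ^ p - 1) • v := by
      rw [LinearMap.sub_apply, hv.pow_apply, sub_smul, one_smul]; rfl
    obtain ⟨k, hk⟩ := hx
    have h3 : ∀ j, ((x ^ p - 1) ^ j) v = (a ^ p - 1) ^ j • v := by
      intro j
      induction j with
      | zero => simp
      | succ j ih => rw [pow_succ', Module.End.mul_apply, ih, map_smul, h2, smul_smul, pow_succ]
    have h4 := h3 k
    rw [hk, LinearMap.zero_apply] at h4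
    have h5 := (smul_eq_zero.mp h4.symm).resolve_right hv.2
    rw [Polynomial.mem_nthRootsFinset hp]
    exact sub_eq_zero.mp (eq_zero_of_pow_eq_zero h5)
  obtain ⟨l, hl⟩ := Quot.exists_rep x.charpoly.roots
  have hl' : (l : Multiset L) = x.charpoly.roots := hl
  rw [← hl'] at hcard hroots ⊢
  rw [Multiset.coe_card] at hcard
  refine ⟨fun i => ⟨l.get (i.cast hcard.symm), hroots _ (by simp)⟩, ?_⟩
  rw [Multiset.sum_coe]
  change ∑ i : Fin d, l.get (i.cast hcard.symm) = _
  rw [← List.sum_ofFn]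
  congr 1
  rw [← List.ofFn_congr hcard, List.ofFn_get]

end Quasiunipotent

namespace Quasiunipotent

variable {R : Type*} [CommRing R] {d : ℕ} (I : Ideal R)

local notation "Mat" => Matrix (Fin d) (Fin d) R

/-- Congruence of a matrix to the identity modulo an ideal. -/
def CongrOne (J : Ideal R) (u : Matrix (Fin d) (Fin d) R) : Prop :=
  (Ideal.Quotient.mk J).mapMatrix u = 1

variable {I}

lemma mapMatrix_eq_zero {J : Ideal R} {u : Matrix (Fin d) (Fin d) R} :
    (Ideal.Quotient.mk J).mapMatrix u = 0 ↔ ∀ i j, u i j ∈ J := by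
  simp [← Matrix.ext_iff, Ideal.Quotient.eq_zero_iff_mem]

lemma CongrOne.mono {J J' : Ideal R} (h : J ≤ J') {u : Matrix (Fin d) (Fin d) R}
    (hu : CongrOne J u) : CongrOne J' u := by
  have h1 : (Ideal.Quotient.mk J).mapMatrix (u - 1) = 0 := by rw [map_sub, map_one, hu, sub_self]
  have h2 : (Ideal.Quotient.mk J').mapMatrix (u - 1) = 0 :=
    mapMatrix_eq_zero.mpr fun i j => h (mapMatrix_eq_zero.mp h1 i j)
  rw [map_sub, map_one] at h2
  exact sub_eq_zero.mp h2

lemma CongrOne.pow {J : Ideal R} {u : Matrix (Fin d) (Fin d) R} (hu : CongrOne J u) (k : ℕ) :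
    CongrOne J (u ^ k) := by
  rw [CongrOne, map_pow, hu, one_pow]

lemma CongrOne.trace_sub_mem {J : Ideal R} {u : Matrix (Fin d) (Fin d) R} (hu : CongrOne J u) :
    u.trace - d ∈ J := by
  have h1 : (Ideal.Quotient.mk J).mapMatrix (u - 1) = 0 := by rw [map_sub, map_one, hu, sub_self]
  have h2 : u.trace - d = (u - 1).trace := by simp
  rw [h2]
  exact Ideal.sum_mem _ fun i _ => mapMatrix_eq_zero.mp h1 i i

lemma CongrOne.pow_prime {p k : ℕ} (hp : (p : R) ∈ I) (hk : 1 ≤ k)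
    {u : Matrix (Fin d) (Fin d) R} (hu : CongrOne (I ^ k) u) : CongrOne (I ^ (k + 1)) (u ^ p) := by
  have h1 : (Ideal.Quotient.mk (I ^ k)).mapMatrix (u - 1) = 0 := by
    rw [map_sub, map_one, hu, sub_self]
  have hu1 : CongrOne I u := hu.mono (Ideal.pow_le_self (by omega))
  have h2 : (Ideal.Quotient.mk I).mapMatrix (∑ i ∈ Finset.range p, u ^ i) = 0 := by
    rw [map_sum, Finset.sum_congr rfl fun i _ => hu1.pow i, Finset.sum_const, Finset.card_range,
      nsmul_eq_mul, mul_one]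
    have : (Ideal.Quotient.mk I).mapMatrix ((p : Matrix (Fin d) (Fin d) R)) = 0 := by
      rw [mapMatrix_eq_zero]
      intro i j
      rw [Matrix.natCast_apply]
      split_ifs
      · exact hp
      · simp
    rwa [map_natCast] at this
  have h3 : (Ideal.Quotient.mk (I ^ (k + 1))).mapMatrix (u ^ p - 1) = 0 := by
    rw [mapMatrix_eq_zero, ← mul_geom_sum]
    intro i j
    rw [Matrix.mul_apply, pow_succ]
    exact Ideal.sum_mem _ fun l _ =>
      Ideal.mul_mem_mul (mapMatrix_eq_zero.mp h1 i l) (mapMatrix_eq_zero.mp h2 l j)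
  rw [map_sub, map_one] at h3
  exact sub_eq_zero.mp h3

lemma CongrOne.pow_prime_pow {p k : ℕ} (hp : (p : R) ∈ I) (hk : 1 ≤ k)
    {u : Matrix (Fin d) (Fin d) R} (hu : CongrOne (I ^ k) u) (s : ℕ) :
    CongrOne (I ^ (k + s)) (u ^ p ^ s) := by
  induction s with
  | zero => simpa using hu
  | succ s ih =>
    rw [pow_succ, pow_mul]
    exact ih.pow_prime hp (by omega)

variable {L : Type*} [Field L] [CharZero L] [IsAlgClosed L]

/-- The operator on `Lᵈ` given by a matrix over `R` through a ring homomorphism `R → L`. -/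
noncomputable def matEnd (d : ℕ) (f : R →+* L) :
    Matrix (Fin d) (Fin d) R →+* Module.End L (Fin d → L) :=
  ((Matrix.toLinAlgEquiv' (R := L) (n := Fin d)).toAlgHom.toRingHom).comp f.mapMatrix

omit [CharZero L] [IsAlgClosed L] in
lemma trace_matEnd (f : R →+* L) (u : Matrix (Fin d) (Fin d) R) :
    LinearMap.trace L (Fin d → L) (matEnd d f u) = f u.trace := by
  change LinearMap.trace L (Fin d → L) (Matrix.toLin' (f.mapMatrix u)) = _
  rw [Matrix.trace_toLin'_eq]
  exact (AddMonoidHom.map_trace f u).symm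

omit [CharZero L] [IsAlgClosed L] in
lemma matEnd_injective {f : R →+* L} (hf : Function.Injective f) :
    Function.Injective (matEnd d f) := by
  intro a b h
  have h1 : f.mapMatrix a = f.mapMatrix b := (Matrix.toLinAlgEquiv' (R := L)).injective h
  exact Matrix.map_injective hf h1

lemma isNilpotent_pow_prime_pow {p : ℕ} [Fact p.Prime] (hp : (p : R) ∈ I)
    (hI : ∀ x : R, (∀ k, x ∈ I ^ k) → x = 0) {f : R →+* L} (hf : Function.Injective f)
    {u : Matrix (Fin d) (Fin d) R} (hu : CongrOne I u) {M : ℕ} (hM : 0 < M)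
    (h : IsNilpotent (matEnd d f u ^ M - 1)) : ∃ a, IsNilpotent (matEnd d f (u ^ p ^ a) - 1) := by
  have hpp : p.Prime := Fact.out
  obtain ⟨a, M', hM', rfl⟩ := Nat.exists_eq_pow_mul_and_not_dvd hM.ne' p hpp.ne_one
  refine ⟨a, ?_⟩
  set w := u ^ p ^ a with hw
  have hwI : CongrOne I w := hu.pow _
  have hM'0 : 0 < M' := Nat.pos_of_ne_zero fun h0 => hM' (h0 ▸ dvd_zero p)
  have hwM : IsNilpotent (matEnd d f w ^ M' - 1) := by
    rw [hw, map_pow, ← pow_mul]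
    exact h
  have hcop : p.Coprime M' := (Nat.Prime.coprime_iff_not_dvd hpp).mpr hM'
  have hb : 0 < M'.totient := Nat.totient_pos.mpr hM'0
  refine isNilpotent_sub_one_of_trace_pow fun j => ?_
  rw [← map_pow, trace_matEnd, ← map_one (matEnd d f), trace_matEnd]
  congr 1
  rw [Matrix.trace_one, Fintype.card_fin, ← sub_eq_zero]
  refine hI _ fun s => ?_
  have hmod : p ^ (M'.totient * s) ≡ 1 [MOD M'] := by
    rw [pow_mul]
    simpa using (Nat.ModEq.pow_totient hcop).pow s
  obtain ⟨c, hc⟩ := (Nat.modEq_iff_dvd' (Nat.one_le_pow _ _ hpp.pos)).mp hmod.symm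
  have hc' : p ^ (M'.totient * s) = 1 + M' * c := by
    have := Nat.one_le_pow (M'.totient * s) _ hpp.pos
    omega
  have htr : (w ^ j).trace = ((w ^ j) ^ p ^ (M'.totient * s)).trace := by
    apply hf
    rw [← trace_matEnd, ← trace_matEnd, hc', pow_add, pow_one, map_mul]
    symm
    apply trace_mul_of_isNilpotent_sub_one
    · exact ((Commute.refl (w ^ j)).pow_right (M' * c)).map (matEnd d f)
    · have : matEnd d f ((w ^ j) ^ (M' * c)) = (matEnd d f w ^ M') ^ (j * c) := by
        rw [map_pow, map_pow, ← pow_mul, ← pow_mul]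
        congr 1
        ring
      rw [this]
      exact isNilpotent_pow_sub_one hwM _
  rw [htr]
  have h1 : CongrOne (I ^ 1) (w ^ j) := by
    rw [pow_one]
    exact hwI.pow j
  have h2 := (h1.pow_prime_pow hp le_rfl (M'.totient * s)).trace_sub_mem
  refine Ideal.pow_le_pow_right ?_ h2
  have := Nat.le_mul_of_pos_left s hb
  omega

/-- A quasi-unipotent matrix sufficiently congruent to the identity is unipotent. -/
theorem exists_congrOne_isNilpotent {p : ℕ} [Fact p.Prime] (hp : (p : R) ∈ I)
    (hI : ∀ x : R, (∀ k, x ∈ I ^ k) → x = 0) {f : R →+* L} (hf : Function.Injective f) :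
    ∃ k₀ : ℕ, 1 ≤ k₀ ∧ ∀ u : Matrix (Fin d) (Fin d) R, CongrOne (I ^ k₀) u → ∀ M, 0 < M →
      IsNilpotent (matEnd d f u ^ M - 1) → IsNilpotent (matEnd d f u - 1) := by
  have hpp : p.Prime := Fact.out
  have hT := (finite_trace_of_pow (L := L) (V := Fin d → L) p hpp.pos).preimage
    (f := f) hf.injOn
  have : ∀ t : R, ∃ k, t ≠ d → t - d ∉ I ^ k := by
    intro t
    by_contra! h
    exact (h 0).1 (sub_eq_zero.mp (hI _ fun k => (h k).2))
  choose κ hκ using this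
  obtain ⟨B, hB⟩ := (hT.image κ).bddAbove
  refine ⟨max B 1, le_max_right _ _, fun u hu M hM h => ?_⟩
  have hex := isNilpotent_pow_prime_pow hp hI hf
    (hu.mono (Ideal.pow_le_self (by have := le_max_right B 1; omega))) hM h
  classical
  rcases hfa : Nat.find hex with _ | a
  · have := Nat.find_spec hex
    rw [hfa] at this
    simpa using this
  have h1 := Nat.find_spec hex
  rw [hfa] at h1
  have h2 := Nat.find_min hex (m := a) (by omega)
  refine absurd ?_ h2
  refine isNilpotent_sub_one_of_trace_pow fun j => ?_
  rw [← map_pow, trace_matEnd, ← map_one (matEnd d f), trace_matEnd]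
  congr 1
  rw [Matrix.trace_one, Fintype.card_fin]
  set y := (u ^ p ^ a) ^ j with hy
  by_contra hne
  have hmem : y.trace ∈ f ⁻¹' {t : L | ∃ x : Module.End L (Fin d → L),
      IsNilpotent (x ^ p - 1) ∧ LinearMap.trace L (Fin d → L) x = t} := by
    refine ⟨matEnd d f y, ?_, trace_matEnd f y⟩
    have : matEnd d f y ^ p = matEnd d f (u ^ p ^ (a + 1)) ^ j := by
      rw [hy, ← map_pow, ← map_pow]
      congr 1
      rw [← pow_mul, ← pow_mul, ← pow_mul]
      congr 1
      ring
    rw [this]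
    exact isNilpotent_pow_sub_one h1 j
  refine hκ _ hne (Ideal.pow_le_pow_right ?_ ((hu.pow _).pow _).trace_sub_mem)
  exact (hB ⟨_, hmem, rfl⟩).trans (le_max_left _ _)

end Quasiunipotent

namespace Quasiunipotent

open LieAux ZariskiMeasure UnipotentLog

variable {R : Type*} [CommRing R] {d : ℕ} {I : Ideal R} {L : Type*} [Field L] [CharZero L]
  {G : Type*} [Group G]

lemma exp_zero_of_algebra {A : Type*} [Ring A] [Algebra ℚ A] : IsNilpotent.exp (0 : A) = 1 :=
  IsNilpotent.exp_zero

/-- A Frobenius-type element normalising a quasi-unipotent element congruent to the identity is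
bad. -/
theorem mem_badSet [IsAlgClosed L] [Algebra ℚ (Module.End L (Fin d → L))] {f : R →+* L}
    (hf : Function.Injective f)
    {ρ : G →* Matrix.GeneralLinearGroup (Fin d) R} {χ : G →* Rˣ} {Φ τ : G} {q : ℕ} (hq : 2 ≤ q)
    (hτ : ∀ M, 0 < M → IsNilpotent (matEnd d f (ρ τ : Matrix (Fin d) (Fin d) R) ^ M - 1) →
      IsNilpotent (matEnd d f (ρ τ : Matrix (Fin d) (Fin d) R) - 1))
    (hχτ : χ τ = 1) (hχΦ : (χ Φ : R) = q) (hconj : ρ (Φ * τ * Φ⁻¹) = ρ (τ ^ q)) (hne : ρ τ ≠ 1) :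
    Φ ∈ badSet (matrixRep f ρ) ((Units.map (f : R →* L)).comp χ) := by
  let r : G →* Module.End L (Fin d → L) := matrixRep f ρ
  have hr : ∀ g, r g = matEnd d f (ρ g : Matrix (Fin d) (Fin d) R) := fun g => rfl
  let U : (Module.End L (Fin d → L))ˣ := r.toHomUnits Φ
  have hU : (U : Module.End L (Fin d → L)) = r Φ := rfl
  have hU' : ((U⁻¹ : (Module.End L (Fin d → L))ˣ) : Module.End L (Fin d → L)) = r Φ⁻¹ := by
    rw [← map_inv]
    rfl
  have h1 : U * r τ * (U⁻¹ : (Module.End L (Fin d → L))ˣ) = r τ ^ q := by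
    rw [hU, hU', ← map_mul, ← map_mul, ← map_pow, hr, hr, hconj]
  have hunit : IsUnit (r τ) := ⟨r.toHomUnits τ, rfl⟩
  obtain ⟨M, hM, hnil⟩ := exists_pow_sub_one_isNilpotent hunit U hq h1
  have hu : IsNilpotent (r τ - 1) := hτ M hM hnil
  obtain ⟨N, hN, hexp, hqN⟩ := exists_log_conj hu U q h1
  refine ⟨N, Submodule.subset_span ⟨hN, τ, ?_, hexp⟩, ?_, hN, ?_⟩
  · rw [MonoidHom.mem_ker, MonoidHom.comp_apply, hχτ, map_one]
  · rintro rfl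
    rw [exp_zero_of_algebra, hr, eq_comm, ← map_one (matEnd d f)] at hexp
    exact hne (Units.ext (matEnd_injective hf hexp))
  · change r Φ * N * r Φ⁻¹ = f (χ Φ : R) • N
    rw [hχΦ, map_natCast, ← hU, ← hU', hqN, Nat.cast_smul_eq_nsmul]

omit [CharZero L] in
lemma pow_mem_badSet {V : Type*} [AddCommGroup V] [Module L V]
    [Algebra ℚ (Module.End L V)] {r : G →* Module.End L V} {χ : G →* Lˣ} {g : G}
    (hg : g ∈ badSet r χ) (k : ℕ) : g ^ k ∈ badSet r χ := by
  obtain ⟨N, hN, hN0, hnil, h⟩ := hg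
  refine ⟨N, hN, hN0, hnil, ?_⟩
  induction k with
  | zero => simp
  | succ k ih =>
    have : r (g ^ (k + 1)) * N * r (g ^ (k + 1))⁻¹ = r g * (r (g ^ k) * N * r (g ^ k)⁻¹) * r g⁻¹ := by
      rw [pow_succ', mul_inv_rev, map_mul, map_mul]
      simp only [mul_assoc]
    rw [this, ih, mul_smul_comm, smul_mul_assoc, h, smul_smul, pow_succ, map_mul, Units.val_mul]

/-- The congruence subgroups of a representation and a character. -/
def levelSubgroup (I : Ideal R) (ρ : G →* Matrix.GeneralLinearGroup (Fin d) R) (χ : G →* Rˣ)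
    (k : ℕ) : Subgroup G :=
  ((Matrix.GeneralLinearGroup.map (Ideal.Quotient.mk (I ^ k))).comp ρ).ker ⊓
    ((Units.map (Ideal.Quotient.mk (I ^ k) : R →* R ⧸ I ^ k)).comp χ).ker

instance (ρ : G →* Matrix.GeneralLinearGroup (Fin d) R) (χ : G →* Rˣ) (k : ℕ) :
    (levelSubgroup I ρ χ k).Normal := by
  unfold levelSubgroup
  infer_instance

variable {ρ : G →* Matrix.GeneralLinearGroup (Fin d) R} {χ : G →* Rˣ}

lemma mem_levelSubgroup {k : ℕ} {g : G} : g ∈ levelSubgroup I ρ χ k ↔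
    CongrOne (I ^ k) (ρ g : Matrix (Fin d) (Fin d) R) ∧ (χ g : R) - 1 ∈ I ^ k := by
  rw [levelSubgroup, Subgroup.mem_inf, MonoidHom.mem_ker, MonoidHom.mem_ker, Units.ext_iff,
    Units.ext_iff, ← Ideal.Quotient.eq_zero_iff_mem, map_sub, map_one, sub_eq_zero]
  rfl

lemma levelSubgroup_antitone : Antitone (levelSubgroup I ρ χ) := by
  intro k l h g hg
  rw [mem_levelSubgroup] at hg ⊢
  exact ⟨hg.1.mono (Ideal.pow_le_pow_right h), Ideal.pow_le_pow_right h hg.2⟩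

lemma eq_one_of_forall_mem_levelSubgroup (hI : ∀ x : R, (∀ k, x ∈ I ^ k) → x = 0) {g : G}
    (hg : ∀ k, g ∈ levelSubgroup I ρ χ k) : ρ g = 1 ∧ χ g = 1 := by
  simp only [mem_levelSubgroup] at hg
  constructor
  · ext i j
    rw [← sub_eq_zero]
    refine hI _ fun k => ?_
    have h1 : (Ideal.Quotient.mk (I ^ k)).mapMatrix ((ρ g : Matrix (Fin d) (Fin d) R) - 1) = 0 := by
      rw [map_sub, map_one, (hg k).1, sub_self]
    exact mapMatrix_eq_zero.mp h1 i j
  · ext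
    rw [← sub_eq_zero]
    exact hI _ fun k => (hg k).2

lemma pow_prime_mem_levelSubgroup {p k : ℕ} (hp : (p : R) ∈ I) (hk : 1 ≤ k) {g : G}
    (hg : g ∈ levelSubgroup I ρ χ k) : g ^ p ∈ levelSubgroup I ρ χ (k + 1) := by
  rw [mem_levelSubgroup] at hg ⊢
  constructor
  · rw [map_pow, Units.val_pow_eq_pow_val]
    exact hg.1.pow_prime hp hk
  · have h1 : (χ g : R) - 1 ∈ I := Ideal.pow_le_self (n := k) (by omega) hg.2
    have h2 : ∑ i ∈ Finset.range p, (χ g : R) ^ i ∈ I := by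
      rw [← Ideal.Quotient.eq_zero_iff_mem, map_sub, map_one, sub_eq_zero] at h1
      rw [← Ideal.Quotient.eq_zero_iff_mem, map_sum]
      simp only [map_pow, h1, one_pow, Finset.sum_const, Finset.card_range, nsmul_eq_mul, mul_one]
      rwa [← map_natCast (Ideal.Quotient.mk I), Ideal.Quotient.eq_zero_iff_mem]
    rw [map_pow, Units.val_pow_eq_pow_val, ← mul_geom_sum, pow_succ]
    exact Ideal.mul_mem_mul hg.2 h2

lemma pow_prime_pow_mem_levelSubgroup {p k : ℕ} (hp : (p : R) ∈ I) (hk : 1 ≤ k) {g : G}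
    (hg : g ∈ levelSubgroup I ρ χ k) (s : ℕ) : g ^ p ^ s ∈ levelSubgroup I ρ χ (k + s) := by
  induction s with
  | zero => simpa using hg
  | succ s ih =>
    rw [pow_succ, pow_mul]
    exact pow_prime_mem_levelSubgroup (k := k + s) hp (by omega) ih

lemma orderOf_mk_dvd {p : ℕ} (hp : (p : R) ∈ I) (k : ℕ) (g : G) :
    orderOf (QuotientGroup.mk g : G ⧸ levelSubgroup I ρ χ k) ∣
      (levelSubgroup I ρ χ 1).index * p ^ k := by
  apply orderOf_dvd_of_pow_eq_one
  rw [← QuotientGroup.mk_pow, QuotientGroup.eq_one_iff, pow_mul]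
  exact levelSubgroup_antitone (Nat.le_add_left k 1)
    (pow_prime_pow_mem_levelSubgroup hp le_rfl (Subgroup.pow_index_mem _ g) k)

lemma _root_.Nat.le_mul_totient_of_dvd_mul_prime_pow {p : ℕ} (hp : p.Prime) {e k n : ℕ} (he : 0 < e)
    (h : n ∣ e * p ^ k) : n ≤ e * p * n.totient := by
  have hn : n ≠ 0 := by
    rintro rfl
    exact absurd (zero_dvd_iff.mp h) (by have := hp.pos; positivity)
  obtain ⟨j, n', hn', rfl⟩ := Nat.exists_eq_pow_mul_and_not_dvd hn p hp.ne_one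
  have hcop : p.Coprime n' := (Nat.Prime.coprime_iff_not_dvd hp).mpr hn'
  have h1 : n' ∣ e := (Nat.Coprime.pow_right k hcop.symm).dvd_of_dvd_mul_right
    ((dvd_mul_left _ _).trans h)
  have hn'0 : 0 < n' := Nat.pos_of_ne_zero fun h0 => hn (by rw [h0, mul_zero])
  have h2 : 1 ≤ n'.totient := Nat.totient_pos.mpr hn'0
  have h3 : p ^ j ≤ p * (p ^ j).totient := by
    rcases Nat.eq_zero_or_pos j with rfl | hj
    · simpa using hp.one_le
    · rw [Nat.totient_prime_pow hp hj, ← mul_assoc, ← pow_succ', Nat.sub_add_cancel hj]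
      exact Nat.le_mul_of_pos_right _ (Nat.sub_pos_of_lt hp.one_lt)
  rw [Nat.totient_mul (Nat.Coprime.pow_left j hcop)]
  calc p ^ j * n' ≤ (p * (p ^ j).totient) * e := Nat.mul_le_mul h3 (Nat.le_of_dvd he h1)
    _ = e * p * ((p ^ j).totient * 1) := by ring
    _ ≤ e * p * ((p ^ j).totient * n'.totient) := by gcongr

end Quasiunipotent

namespace TameInertia

variable {A H : Type*} [CommRing A] [Group H] [MulSemiringAction H A] {P : Ideal A}

lemma smul_sub_mem_pow {κ : H} (h0 : ∀ x : A, κ • x - x ∈ P)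
    (h1 : ∀ x ∈ P, κ • x - x ∈ P ^ 2) (i : ℕ) : ∀ x ∈ P ^ i, κ • x - x ∈ P ^ (i + 1) := by
  induction i with
  | zero => simpa using h0
  | succ i ih =>
    intro x hx
    rw [pow_succ] at hx
    refine Submodule.mul_induction_on hx (fun a ha b hb => ?_) fun a b ha hb => ?_
    · have hκb : κ • b ∈ P := by
        have := P.add_mem (h0 b) hb
        rwa [sub_add_cancel] at this
      have : κ • (a * b) - a * b = (κ • a - a) * (κ • b) + a * (κ • b - b) := by
        rw [smul_mul']
        ring
      rw [this]
      refine Ideal.add_mem _ ?_ ?_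
      · rw [pow_succ]
        exact Ideal.mul_mem_mul (ih a ha) hκb
      · have : P ^ (i + 1 + 1) = P ^ i * P ^ 2 := by rw [← pow_add]
        rw [this]
        exact Ideal.mul_mem_mul ha (h1 b hb)
    · have : κ • (a + b) - (a + b) = (κ • a - a) + (κ • b - b) := by
        rw [smul_add]
        ring
      rw [this]
      exact Ideal.add_mem _ ha hb

/-- An automorphism of order prime to the residue characteristic which acts trivially on `A / P` and
`P / P²` is trivial. -/
lemma smul_eq_of_pow_smul_eq [IsNoetherianRing A] [IsDomain A] [P.IsMaximal] {κ : H}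
    (h0 : ∀ x : A, κ • x - x ∈ P) (h1 : ∀ x ∈ P, κ • x - x ∈ P ^ 2) {n : ℕ} (hn : (n : A) ∉ P)
    (hκ : ∀ x : A, κ ^ n • x = x) (x : A) : κ • x = x := by
  have hstep : ∀ i, ∀ y ∈ P ^ i, ∀ j : ℕ, κ ^ j • y - y ∈ P ^ (i + 1) := by
    intro i y hy j
    induction j with
    | zero => simp
    | succ j ih =>
      have hy' : κ ^ j • y ∈ P ^ i := by
        have := (P ^ i).add_mem (Ideal.pow_le_pow_right (Nat.le_succ i) ih) hy
        rwa [sub_add_cancel] at this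
      have := (P ^ (i + 1)).add_mem (smul_sub_mem_pow h0 h1 i _ hy') ih
      rwa [smul_smul, ← pow_succ', sub_add_sub_cancel] at this
  have key : ∀ i, ∀ y : A, κ • y - y ∈ P ^ i := by
    intro i
    induction i with
    | zero => simp
    | succ i ih =>
      intro y
      have hsum : ∑ j ∈ Finset.range n, κ ^ j • (κ • y - y) = 0 := by
        have : ∀ j ∈ Finset.range n, κ ^ j • (κ • y - y) = κ ^ (j + 1) • y - κ ^ j • y := by
          intro j _
          rw [smul_sub, smul_smul, pow_succ]
        rw [Finset.sum_congr rfl this, Finset.sum_range_sub (fun j => κ ^ j • y), pow_zero, one_smul, hκ, sub_self]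
      have hdiff : (n : A) * (κ • y - y) ∈ P ^ (i + 1) := by
        have h2 : (n : A) * (κ • y - y) =
            -∑ j ∈ Finset.range n, (κ ^ j • (κ • y - y) - (κ • y - y)) := by
          rw [Finset.sum_sub_distrib, hsum, Finset.sum_const, Finset.card_range, nsmul_eq_mul]
          ring
        rw [h2]
        exact neg_mem (Ideal.sum_mem _ fun j _ => hstep i _ (ih y) j)
      have hprim := (Ideal.IsMaximal.isPrime inferInstance : P.IsPrime)
      have hpr : (P ^ (i + 1)).IsPrimary :=
        Ideal.isPrimary_of_isMaximal_radical (by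
          rw [Ideal.radical_pow _ (Nat.succ_ne_zero i), hprim.radical]
          infer_instance)
      rw [mul_comm] at hdiff
      rcases (Ideal.isPrimary_iff.mp hpr).2 hdiff with h | h
      · exact h
      · rw [Ideal.radical_pow _ (Nat.succ_ne_zero i), hprim.radical] at h
        exact absurd h hn
  have hbot : (⨅ i : ℕ, P ^ i) = ⊥ :=
    Ideal.iInf_pow_eq_bot_of_isDomain P (Ideal.IsMaximal.ne_top inferInstance)
  have : κ • x - x ∈ (⨅ i : ℕ, P ^ i) := Ideal.mem_iInf.mpr fun i => key i x
  rw [hbot, Ideal.mem_bot] at this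
  exact sub_eq_zero.mp this

omit [MulSemiringAction H A] [Group H] in
lemma mem_iff_of_sub_mem {x y : A} (h : x - y ∈ P) : x ∈ P ↔ y ∈ P :=
  ⟨fun hx => by simpa using sub_mem hx h, fun hy => by simpa using add_mem h hy⟩

/-- The tame relation between a Frobenius and an inertia element. -/
theorem frobenius_conj_smul_eq [IsDedekindDomain A] [P.IsPrime] (hP : P ≠ ⊥) {Φ τ : H} {q : ℕ}
    (hq : 0 < q) (hτ : ∀ x : A, τ • x - x ∈ P) (hΦ : ∀ x : A, Φ • x - x ^ q ∈ P) {n : ℕ}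
    (hn : (n : A) ∉ P) (hκ : ∀ x : A, ((Φ * τ * Φ⁻¹) * (τ ^ q)⁻¹) ^ n • x = x) (x : A) :
    ((Φ * τ * Φ⁻¹) * (τ ^ q)⁻¹) • x = x := by
  have hprime : P.IsPrime := inferInstance
  have : P.IsMaximal := Ring.DimensionLEOne.maximalOfPrime hP hprime
  have hΦP : ∀ x, x ∈ P ↔ Φ • x ∈ P := by
    intro x
    rw [mem_iff_of_sub_mem (hΦ x)]
    exact ⟨fun h => Ideal.pow_mem_of_mem P h q hq, fun h => hprime.mem_of_pow_mem q h⟩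
  have hΦP' : ∀ x, x ∈ P ↔ Φ⁻¹ • x ∈ P := by
    intro x
    rw [hΦP (Φ⁻¹ • x), smul_inv_smul]
  have hτP : ∀ x, x ∈ P ↔ τ • x ∈ P := by
    intro x
    exact (mem_iff_of_sub_mem (hτ x)).symm
  have hΦ2 : ∀ x ∈ P ^ 2, Φ • x ∈ P ^ 2 := by
    intro x hx
    rw [sq] at hx ⊢
    refine Submodule.mul_induction_on hx (fun a ha b hb => ?_) fun a b ha hb => ?_
    · rw [smul_mul']
      exact Ideal.mul_mem_mul ((hΦP a).mp ha) ((hΦP b).mp hb)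
    · rw [smul_add]
      exact add_mem ha hb
  have hτ2 : ∀ x ∈ P ^ 2, τ • x ∈ P ^ 2 := by
    intro x hx
    rw [sq] at hx ⊢
    refine Submodule.mul_induction_on hx (fun a ha b hb => ?_) fun a b ha hb => ?_
    · rw [smul_mul']
      exact Ideal.mul_mem_mul ((hτP a).mp ha) ((hτP b).mp hb)
    · rw [smul_add]
      exact add_mem ha hb
  obtain ⟨π, hπ, hπ2⟩ : ∃ π ∈ P, π ∉ P ^ 2 := by
    obtain ⟨π, hπ, hπ2⟩ := Ideal.exists_mem_pow_notMem_pow_succ P hP hprime.ne_top 1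
    exact ⟨π, by simpa using hπ, by simpa using hπ2⟩
  obtain ⟨u, e, he, hu⟩ := Ideal.exists_mul_add_mem_pow_succ (i := 1) (P := P) hP
    (a := π) (c := τ • π) (by simpa using hπ) (by simpa using hπ2)
    (by simpa using (hτP π).mp hπ)
  have hu' : ∀ x ∈ P, τ • x - u * x ∈ P ^ 2 := by
    intro x hx
    obtain ⟨c, e', he', hc⟩ := Ideal.exists_mul_add_mem_pow_succ (i := 1) (P := P) hP
      (a := π) (c := x) (by simpa using hπ) (by simpa using hπ2) (by simpa using hx)
    have : τ • x - u * x = (τ • c - c) * (τ • π) + c * e + (τ • e' - u * e') := by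
      rw [← hc, smul_add, smul_mul', ← hu]
      ring
    rw [this]
    refine add_mem (add_mem ?_ (Ideal.mul_mem_left _ _ he))
      (sub_mem (hτ2 _ he') (Ideal.mul_mem_left _ _ he'))
    rw [sq]
    exact Ideal.mul_mem_mul (hτ c) ((hτP π).mp hπ)
  have hpow : ∀ k : ℕ, ∀ x ∈ P, τ ^ k • x - u ^ k * x ∈ P ^ 2 := by
    intro k
    induction k with
    | zero => simp
    | succ k ih =>
      intro x hx
      have h3 := ih (τ • x) ((hτP x).mp hx)
      have h4 := Ideal.mul_mem_left (P ^ 2) (u ^ k) (hu' x hx)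
      have := add_mem h3 h4
      rw [smul_smul, ← pow_succ] at this
      convert this using 1
      ring
  have hconj : ∀ x ∈ P, (Φ * τ * Φ⁻¹) • x - u ^ q * x ∈ P ^ 2 := by
    intro x hx
    have h3 := hΦ2 _ (hu' (Φ⁻¹ • x) ((hΦP' x).mp hx))
    rw [smul_sub, smul_mul', smul_inv_smul, smul_smul, smul_smul] at h3
    have h4 : (Φ • u - u ^ q) * x ∈ P ^ 2 := by
      rw [sq]
      exact Ideal.mul_mem_mul (hΦ u) hx
    have := add_mem h3 h4
    convert this using 1
    ring
  have hτinv : ∀ k : ℕ, ∀ x : A, (τ ^ k) • x - x ∈ P := by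
    intro k
    induction k with
    | zero => simp
    | succ k ih =>
      intro x
      have := add_mem (ih (τ • x)) (hτ x)
      rwa [smul_smul, ← pow_succ, sub_add_sub_cancel] at this
  have hmemτ : ∀ y : A, y ∈ P → (τ ^ q)⁻¹ • y ∈ P := by
    intro y hy
    have := sub_mem hy (hτinv q ((τ ^ q)⁻¹ • y))
    rwa [smul_inv_smul, sub_sub_cancel] at this
  refine smul_eq_of_pow_smul_eq (P := P) (fun y => ?_) (fun y hy => ?_) hn hκ x
  · have h3 : (Φ * τ * Φ⁻¹) • ((τ ^ q)⁻¹ • y) - (τ ^ q)⁻¹ • y ∈ P := by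
      have h4 := (hΦP _).mp (hτ (Φ⁻¹ • ((τ ^ q)⁻¹ • y)))
      rwa [smul_sub, smul_inv_smul, smul_smul, smul_smul] at h4
    have h5 := hτinv q ((τ ^ q)⁻¹ • y)
    rw [smul_inv_smul] at h5
    have := sub_mem h3 h5
    rwa [smul_smul, sub_sub_sub_cancel_right] at this
  · have h3 := hconj _ (hmemτ y hy)
    have h4 := hpow q _ (hmemτ y hy)
    rw [smul_inv_smul] at h4
    have := sub_mem h3 h4
    rwa [smul_smul, sub_sub_sub_cancel_right] at this

end TameInertia

namespace AbsoluteGalois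

open NumberField IsDedekindDomain IdealCount
open scoped Pointwise

/-- The absolute Galois group of a number field. -/
abbrev AbsGal (F : Type) [Field F] : Type := AlgebraicClosure F ≃ₐ[F] AlgebraicClosure F

/-- The integral closure of `𝓞 F` in an algebraic closure of `F`. -/
abbrev AbsInt (F : Type) [Field F] [NumberField F] : Type :=
  integralClosure (𝓞 F) (AlgebraicClosure F)

variable {F : Type} [Field F] [NumberField F]

lemma isOpen_stabilizer (x : AbsInt F) : IsOpen (MulAction.stabilizer (AbsGal F) x : Set (AbsGal F)) := by
  convert stabilizer_isOpen_of_isIntegral (K := F) (x : AlgebraicClosure F) using 1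
  ext g
  simp only [SetLike.mem_coe, MulAction.mem_stabilizer_iff]
  exact Subtype.ext_iff

instance isInvariant_absInt : Algebra.IsInvariant (𝓞 F) (AbsInt F) (AbsGal F) where
  isInvariant b hb := by
    have h1 : (b : AlgebraicClosure F) ∈ Set.range (algebraMap F (AlgebraicClosure F)) :=
      (InfiniteGalois.mem_range_algebraMap_iff_fixed _).mpr fun g => congrArg Subtype.val (hb g)
    obtain ⟨c, hc⟩ := h1
    have h2 : IsIntegral (𝓞 F) c := by
      have h3 : IsIntegral (𝓞 F) (b : AlgebraicClosure F) := b.2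
      rw [← hc] at h3
      exact (isIntegral_algebraMap_iff (algebraMap F (AlgebraicClosure F)).injective).mp h3
    obtain ⟨a, ha⟩ := IsIntegrallyClosed.isIntegral_iff.mp h2
    refine ⟨a, Subtype.ext ?_⟩
    rw [← hc, ← ha]
    exact (IsScalarTower.algebraMap_apply (𝓞 F) F (AlgebraicClosure F) a)

/-- A closed subgroup acts transitively on the primes with given intersection with its ring of
invariants. -/
lemma exists_smul_eq_of_isClosed {H : Subgroup (AbsGal F)} (hH : IsClosed (H : Set (AbsGal F)))
    (Q Q' : Ideal (AbsInt F)) [Q.IsPrime] [Q'.IsPrime]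
    (h : ∀ b : AbsInt F, (∀ g ∈ H, g • b = b) → (b ∈ Q ↔ b ∈ Q')) : ∃ g ∈ H, Q' = g • Q := by
  let : TopologicalSpace (AbsInt F) := ⊥
  have : DiscreteTopology (AbsInt F) := ⟨rfl⟩
  have : CompactSpace H := isCompact_iff_compactSpace.mp hH.isCompact
  have : ContinuousSMul H (AbsInt F) := by
    rw [continuousSMul_iff_stabilizer_isOpen]
    intro x
    exact (isOpen_stabilizer x).preimage continuous_subtype_val
  let A := FixedPoints.subalgebra (𝓞 F) (AbsInt F) H
  have : SMulCommClass H A (AbsInt F) := ⟨fun g a b => by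
    rw [Subalgebra.smul_def, Subalgebra.smul_def, smul_eq_mul, smul_eq_mul, smul_mul', a.2 g]⟩
  have : Algebra.IsInvariant A (AbsInt F) H := ⟨fun b hb => ⟨⟨b, hb⟩, rfl⟩⟩
  obtain ⟨g, hg⟩ := Algebra.IsInvariant.exists_smul_of_under_eq_of_profinite (A := A) (G := H) Q Q'
    (by
      ext a
      exact h a fun g hg => a.2 ⟨g, hg⟩)
  exact ⟨g, g.2, hg⟩

lemma pow_card_eq_algEquiv {k R : Type*} [Field k] [Finite k] [Field R] [Algebra k R]
    [Algebra.IsAlgebraic k R] (g : R ≃ₐ[k] R) (β : R) : ∃ j, g β = β ^ Nat.card k ^ j := by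
  have := Fintype.ofFinite k
  let E := IntermediateField.adjoin k {β}
  have : FiniteDimensional k E :=
    IntermediateField.adjoin.finiteDimensional (Algebra.IsIntegral.isIntegral β)
  have : Finite E := Module.finite_of_finite k
  have : IsGalois k E := inferInstance
  obtain ⟨j, hj⟩ := (FiniteField.bijective_frobeniusAlgEquivOfAlgebraic_pow k E).2
    (g.restrictNormal E)
  refine ⟨j, ?_⟩
  let b : E := ⟨β, IntermediateField.mem_adjoin_simple_self k β⟩
  have h1 : algebraMap E R (g.restrictNormal E b) = g (algebraMap E R b) :=
    AlgEquiv.restrictNormal_commutes g E b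
  have h2 : ∀ i : ℕ, ((FiniteField.frobeniusAlgEquivOfAlgebraic k E) ^ i) b =
      b ^ Nat.card k ^ i := by
    intro i
    induction i with
    | zero => simp
    | succ i ih =>
      rw [pow_succ', AlgEquiv.mul_apply, ih, pow_succ, pow_mul, Nat.card_eq_fintype_card]
      rfl
  have h3 := h2 j
  rw [show ((FiniteField.frobeniusAlgEquivOfAlgebraic k E) ^ (j : ℕ)) = g.restrictNormal E from hj]
    at h3
  rw [h3, map_pow] at h1
  exact h1.symm

variable {v : HeightOneSpectrum (𝓞 F)} {Q : Ideal (AbsInt F)}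

lemma finite_quotient_asIdeal (v : HeightOneSpectrum (𝓞 F)) : Finite (𝓞 F ⧸ v.asIdeal) :=
  Ideal.finiteQuotientOfFreeOfNeBot v.asIdeal v.ne_bot

lemma primeNorm_eq_card (v : HeightOneSpectrum (𝓞 F)) :
    primeNorm F v = Nat.card (𝓞 F ⧸ v.asIdeal) := by
  rw [primeNorm, Ideal.absNorm_apply, Submodule.cardQuot_apply]

attribute [local instance] Ideal.Quotient.field

lemma isMaximal_of_comap_eq [Q.IsPrime] (hQ : Q.comap (algebraMap (𝓞 F) (AbsInt F)) = v.asIdeal) :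
    Q.IsMaximal := by
  refine Ideal.isMaximal_of_isIntegral_of_isMaximal_comap (R := 𝓞 F) Q ?_
  rw [hQ]
  exact v.isMaximal

/-- Frobenius elements exist. -/
lemma exists_frobenius [Q.IsPrime] (hQ : Q.comap (algebraMap (𝓞 F) (AbsInt F)) = v.asIdeal) :
    ∃ Φ : AbsGal F, ∀ x : AbsInt F, Φ • x - x ^ primeNorm F v ∈ Q := by
  let : TopologicalSpace (AbsInt F) := ⊥
  have : DiscreteTopology (AbsInt F) := ⟨rfl⟩
  have : ContinuousSMul (AbsGal F) (AbsInt F) := by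
    rw [continuousSMul_iff_stabilizer_isOpen]
    exact isOpen_stabilizer
  have : Q.LiesOver v.asIdeal := ⟨hQ.symm⟩
  have := isMaximal_of_comap_eq hQ
  have := v.isMaximal
  have := finite_quotient_asIdeal v
  have := Fintype.ofFinite (𝓞 F ⧸ v.asIdeal)
  have : Algebra.IsAlgebraic (𝓞 F ⧸ v.asIdeal) (AbsInt F ⧸ Q) :=
    Algebra.IsIntegral.isAlgebraic
  obtain ⟨σ, hσ⟩ := Ideal.Quotient.stabilizerHom_surjective_of_profinite (G := AbsGal F) v.asIdeal Q
    (FiniteField.frobeniusAlgEquivOfAlgebraic (𝓞 F ⧸ v.asIdeal) (AbsInt F ⧸ Q))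
  refine ⟨σ, fun x => ?_⟩
  rw [← Ideal.Quotient.eq_zero_iff_mem, map_sub, sub_eq_zero, map_pow, primeNorm_eq_card,
    Nat.card_eq_fintype_card]
  exact congrArg (fun e => e (Ideal.Quotient.mk Q x)) hσ

/-- An element of the decomposition group acts on a residue class as a Frobenius power. -/
lemma exists_smul_sub_pow_mem [Q.IsPrime]
    (hQ : Q.comap (algebraMap (𝓞 F) (AbsInt F)) = v.asIdeal) {g : AbsGal F} (hg : g • Q = Q)
    (x : AbsInt F) : ∃ j, g • x - x ^ primeNorm F v ^ j ∈ Q := by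
  have : Q.LiesOver v.asIdeal := ⟨hQ.symm⟩
  have := isMaximal_of_comap_eq hQ
  have := v.isMaximal
  have := finite_quotient_asIdeal v
  have : Algebra.IsAlgebraic (𝓞 F ⧸ v.asIdeal) (AbsInt F ⧸ Q) :=
    Algebra.IsIntegral.isAlgebraic
  obtain ⟨j, hj⟩ := pow_card_eq_algEquiv
    (Ideal.Quotient.stabilizerHom Q v.asIdeal (AbsGal F) ⟨g, hg⟩) (Ideal.Quotient.mk Q x)
  refine ⟨j, ?_⟩
  rw [← Ideal.Quotient.eq_zero_iff_mem, map_sub, sub_eq_zero, map_pow, primeNorm_eq_card]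
  exact hj

end AbsoluteGalois

namespace AbsoluteGalois

open NumberField IsDedekindDomain IdealCount IntermediateField
open scoped Pointwise

variable {F : Type} [Field F] [NumberField F]

/-- The inclusion of the ring of integers of an intermediate field. -/
noncomputable def ofRingOfIntegers (M : IntermediateField F (AlgebraicClosure F)) :
    𝓞 M →+* AbsInt F where
  toFun x := ⟨((x : M) : AlgebraicClosure F),
    ((x.isIntegral_coe).map (IsScalarTower.toAlgHom ℤ M (AlgebraicClosure F))).tower_top⟩
  map_one' := by ext; simp
  map_mul' _ _ := by ext; simp
  map_zero' := by ext; simp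
  map_add' _ _ := by ext; simp

variable (M : IntermediateField F (AlgebraicClosure F))

lemma ofRingOfIntegers_injective : Function.Injective (ofRingOfIntegers M) := by
  intro x y h
  have h1 : ((x : M) : AlgebraicClosure F) = ((y : M) : AlgebraicClosure F) :=
    congrArg (fun z : AbsInt F => (z : AlgebraicClosure F)) h
  exact RingOfIntegers.ext (Subtype.ext h1)

variable {M}

lemma exists_ofRingOfIntegers_eq {b : AbsInt F} (hb : (b : AlgebraicClosure F) ∈ M) :
    ∃ x, ofRingOfIntegers M x = b := by
  have h1 : IsIntegral ℤ (b : AlgebraicClosure F) := isIntegral_trans (A := 𝓞 F) _ b.2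
  have h2 : IsIntegral ℤ (⟨b, hb⟩ : M) :=
    (isIntegral_algebraMap_iff (B := AlgebraicClosure F) (algebraMap M _).injective).mp h1
  exact ⟨⟨⟨b, hb⟩, h2⟩, rfl⟩

lemma fixingSubgroup_fixedField_of_isOpen {N : Subgroup (AbsGal F)}
    (hN : IsOpen (N : Set (AbsGal F))) : (fixedField N).fixingSubgroup = N :=
  InfiniteGalois.fixingSubgroup_fixedField ⟨N, N.isClosed_of_isOpen hN⟩

lemma finiteDimensional_fixedField {N : Subgroup (AbsGal F)} (hN : IsOpen (N : Set (AbsGal F))) :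
    FiniteDimensional F (fixedField N) := by
  rw [← InfiniteGalois.isOpen_iff_finite]
  change IsOpen ((fixedField N).fixingSubgroup : Set (AbsGal F))
  rwa [fixingSubgroup_fixedField_of_isOpen hN]

lemma numberField_fixedField {N : Subgroup (AbsGal F)} (hN : IsOpen (N : Set (AbsGal F))) :
    NumberField (fixedField N) := by
  have := finiteDimensional_fixedField hN
  exact NumberField.of_module_finite F _

lemma isGalois_fixedField {N : Subgroup (AbsGal F)} [hn : N.Normal]
    (hN : IsOpen (N : Set (AbsGal F))) : IsGalois F (fixedField N) := by
  rw [← InfiniteGalois.normal_iff_isGalois, fixingSubgroup_fixedField_of_isOpen hN]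
  exact hn

/-- Every open subgroup is the stabilizer of an integral element. -/
lemma exists_stabilizer_eq {N : Subgroup (AbsGal F)} (hN : IsOpen (N : Set (AbsGal F))) :
    ∃ α : AbsInt F, ∀ g : AbsGal F, g • α = α ↔ g ∈ N := by
  have := finiteDimensional_fixedField hN
  obtain ⟨a, ha⟩ := Field.exists_primitive_element F (fixedField N)
  have hgen : F⟮(a : AlgebraicClosure F)⟯ = fixedField N := by
    rw [← IntermediateField.lift_adjoin_simple, ha, IntermediateField.lift_top]
  obtain ⟨d, hd, hint⟩ := IsAlgebraic.exists_integral_multiple (R := 𝓞 F)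
    ((IsFractionRing.isAlgebraic_iff (𝓞 F) F (AlgebraicClosure F)).mpr
      (Algebra.IsAlgebraic.isAlgebraic (R := F) (a : AlgebraicClosure F)))
  refine ⟨⟨_, hint⟩, fun g => ?_⟩
  have h1 : g • (⟨_, hint⟩ : AbsInt F) = ⟨_, hint⟩ ↔
      g • (a : AlgebraicClosure F) = (a : AlgebraicClosure F) := by
    rw [Subtype.ext_iff, integralClosure.coe_smul, smul_comm]
    exact smul_right_injective _ hd |>.eq_iff
  have hN' : F⟮(a : AlgebraicClosure F)⟯.fixingSubgroup = N := by
    rw [hgen, fixingSubgroup_fixedField_of_isOpen hN]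
  rw [h1]
  constructor
  · intro h
    have h2 : Subgroup.zpowers g ≤ F⟮(a : AlgebraicClosure F)⟯.fixingSubgroup := by
      rw [← IntermediateField.le_iff_le, adjoin_simple_le_iff]
      have h3 : Subgroup.zpowers g ≤ MulAction.stabilizer (AbsGal F) (a : AlgebraicClosure F) :=
        Subgroup.zpowers_le.mpr h
      rintro ⟨x, hx⟩
      exact h3 hx
    rw [← hN']
    exact h2 (Subgroup.mem_zpowers g)
  · intro h
    rw [← hN'] at h
    exact (mem_fixingSubgroup_iff _ _).mp h _ (mem_adjoin_simple_self F _)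

/-- For all but finitely many primes, distinct conjugates of an integral element are incongruent. -/
lemma finite_exceptional (α : AbsInt F) :
    {v : HeightOneSpectrum (𝓞 F) | ∃ Q : Ideal (AbsInt F),
      Q.comap (algebraMap (𝓞 F) (AbsInt F)) = v.asIdeal ∧
        ∃ g : AbsGal F, g • α ≠ α ∧ g • α - α ∈ Q}.Finite := by
  have hfin : Finite (AbsGal F ⧸ MulAction.stabilizer (AbsGal F) α) :=
    Subgroup.quotient_finite_of_isOpen _ (isOpen_stabilizer α)
  have horb : (MulAction.orbit (AbsGal F) α).Finite :=
    have := Finite.of_equiv _ (MulAction.orbitEquivQuotientStabilizer (AbsGal F) α).symm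
    Set.toFinite _
  have key : ∀ β : AbsInt F, β ≠ α → {v : HeightOneSpectrum (𝓞 F) | ∃ Q : Ideal (AbsInt F),
      Q.comap (algebraMap (𝓞 F) (AbsInt F)) = v.asIdeal ∧ β - α ∈ Q}.Finite := by
    intro β hβ
    have hJ : (Ideal.span {β - α}).comap (algebraMap (𝓞 F) (AbsInt F)) ≠ ⊥ :=
      Ideal.comap_ne_bot_of_integral_mem (sub_ne_zero.mpr hβ) (Ideal.mem_span_singleton_self _)
        (Algebra.IsIntegral.isIntegral (R := 𝓞 F) _)
    refine (Ideal.finite_factors hJ).subset ?_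
    rintro v ⟨Q, hQ, hmem⟩
    rw [Set.mem_ofPred_eq, Ideal.dvd_iff_le, ← hQ]
    exact Ideal.comap_mono ((Ideal.span_singleton_le_iff_mem _).mpr hmem)
  have hdiff : (MulAction.orbit (AbsGal F) α \ {α}).Finite := horb.subset Set.sdiff_subset
  refine (hdiff.biUnion fun β hβ => key β hβ.2).subset ?_
  rintro v ⟨Q, hQ, g, hg, hmem⟩
  have hmem' : g • α ∈ MulAction.orbit (AbsGal F) α \ {α} := ⟨⟨g, rfl⟩, hg⟩
  exact Set.mem_biUnion hmem' ⟨Q, hQ, hmem⟩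

variable {v : HeightOneSpectrum (𝓞 F)} {Q : Ideal (AbsInt F)}

lemma primeNorm_pos (v : HeightOneSpectrum (𝓞 F)) : 0 < primeNorm F v :=
  lt_of_lt_of_le two_pos (two_le_primeNorm v)

/-- The tame relation in the absolute Galois group, modulo an open normal subgroup. -/
lemma tame_mem [Q.IsPrime] (hQ : Q.comap (algebraMap (𝓞 F) (AbsInt F)) = v.asIdeal)
    {N : Subgroup (AbsGal F)} [N.Normal] (hN : IsOpen (N : Set (AbsGal F))) {Φ τ : AbsGal F}
    (hτ : ∀ x : AbsInt F, τ • x - x ∈ Q) (hΦ : ∀ x : AbsInt F, Φ • x - x ^ primeNorm F v ∈ Q)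
    {n : ℕ} (hn : (n : 𝓞 F) ∉ v.asIdeal)
    (hκ : ((Φ * τ * Φ⁻¹) * (τ ^ primeNorm F v)⁻¹) ^ n ∈ N) :
    (Φ * τ * Φ⁻¹) * (τ ^ primeNorm F v)⁻¹ ∈ N := by
  have := numberField_fixedField hN
  have := isGalois_fixedField hN
  let E := fixedField N
  let j := ofRingOfIntegers E
  let : MulSemiringAction (AbsGal F) (𝓞 E) :=
    MulSemiringAction.compHom (𝓞 E) (AlgEquiv.restrictNormalHom (F := F) (K₁ := AlgebraicClosure F) E)
  have hj : ∀ (g : AbsGal F) (x : 𝓞 E), j (g • x) = g • j x := fun g x =>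
    Subtype.ext (AlgEquiv.restrictNormal_commutes g E x)
  have hfix : ∀ g ∈ N, ∀ x : 𝓞 E, g • x = x := by
    intro g hg x
    apply ofRingOfIntegers_injective
    change j (g • x) = j x
    rw [hj]
    exact Subtype.ext ((x : E).2 ⟨g, hg⟩)
  let P : Ideal (𝓞 E) := Q.comap j
  have hP : P ≠ ⊥ := by
    obtain ⟨a, ha, ha0⟩ := Submodule.exists_mem_ne_zero_of_ne_bot v.ne_bot
    refine (Submodule.ne_bot_iff _).mpr ⟨algebraMap (𝓞 F) (𝓞 E) a, ?_, ?_⟩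
    · change j _ ∈ Q
      rw [← hQ] at ha
      exact ha
    · rwa [Ne, FaithfulSMul.algebraMap_eq_zero_iff]
  have hPp : P.IsPrime := Ideal.comap_isPrime j Q
  obtain ⟨α, hα⟩ := exists_stabilizer_eq hN
  have hαE : (α : AlgebraicClosure F) ∈ E := fun g => congrArg Subtype.val ((hα g).mpr g.2)
  obtain ⟨a, ha⟩ := exists_ofRingOfIntegers_eq hαE
  rw [← hα, ← ha]
  change _ • j a = j a
  rw [← hj]
  congr 1
  refine TameInertia.frobenius_conj_smul_eq (P := P) hP (primeNorm_pos v) (fun x => ?_) (fun x => ?_)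
    (n := n) (fun h => hn ?_) (fun x => hfix _ hκ x) a
  · change j _ ∈ Q
    rw [map_sub, hj]
    exact hτ _
  · change j _ ∈ Q
    rw [map_sub, hj, map_pow]
    exact hΦ _
  · rw [← hQ]
    change algebraMap (𝓞 F) (AbsInt F) n ∈ Q
    have h2 : j n ∈ Q := h
    rwa [map_natCast] at h2 ⊢

end AbsoluteGalois

namespace AbsoluteGalois

open NumberField IsDedekindDomain IdealCount IntermediateField
open scoped Pointwise

variable {F : Type} [Field F] [NumberField F] {v : HeightOneSpectrum (𝓞 F)} {Q : Ideal (AbsInt F)}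

lemma comap_smul (g : AbsGal F) (Q : Ideal (AbsInt F)) :
    (g • Q).comap (algebraMap (𝓞 F) (AbsInt F)) = Q.comap (algebraMap (𝓞 F) (AbsInt F)) := by
  ext a
  rw [Ideal.mem_comap, Ideal.mem_comap, Ideal.mem_pointwise_smul_iff_inv_smul_mem,
    smul_algebraMap]

lemma smul_frobenius {Φ : AbsGal F} {q : ℕ} (hΦ : ∀ x : AbsInt F, Φ • x - x ^ q ∈ Q)
    (g : AbsGal F) (x : AbsInt F) : (g * Φ * g⁻¹) • x - x ^ q ∈ g • Q := by
  rw [Ideal.mem_pointwise_smul_iff_inv_smul_mem, smul_sub, smul_pow', ← mul_smul]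
  have h := hΦ (g⁻¹ • x)
  rwa [← mul_smul, ← inv_mul_cancel_left g (Φ * g⁻¹), ← mul_assoc g] at h

lemma isPrime_smul [Q.IsPrime] (g : AbsGal F) : (g • Q).IsPrime := by
  have h : g • Q = Q.comap (MulSemiringAction.toRingHom (AbsGal F) (AbsInt F) g⁻¹) := by
    ext x
    exact Ideal.mem_pointwise_smul_iff_inv_smul_mem
  rw [h]
  exact Ideal.comap_isPrime _ _

lemma frobenius_pow_smul_sub_mem [Q.IsPrime] {Φ : AbsGal F} {q : ℕ}
    (hΦ : ∀ x : AbsInt F, Φ • x - x ^ q ∈ Q) (j : ℕ) (x : AbsInt F) :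
    Φ ^ j • x - x ^ q ^ j ∈ Q := by
  induction j generalizing x with
  | zero => simp
  | succ j ih =>
    have h1 := ih (Φ • x)
    have h2 : (Φ • x) ^ q ^ j - (x ^ q) ^ q ^ j ∈ Q :=
      Ideal.mem_of_dvd _ (sub_dvd_pow_sub_pow _ _ _) (hΦ x)
    have h3 := add_mem h1 h2
    rw [sub_add_sub_cancel, ← mul_smul, ← pow_succ, ← pow_mul, ← pow_succ'] at h3
    exact h3

/-- `Φ` is a Frobenius element at the prime `Q` above `v`, which generates the decomposition group
modulo the subgroup `N`. -/
structure IsFrobeniusMod (N : Subgroup (AbsGal F)) (v : HeightOneSpectrum (𝓞 F))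
    (Q : Ideal (AbsInt F)) (Φ : AbsGal F) : Prop where
  isPrime : Q.IsPrime
  comap_eq : Q.comap (algebraMap (𝓞 F) (AbsInt F)) = v.asIdeal
  smul_sub_mem : ∀ x : AbsInt F, Φ • x - x ^ primeNorm F v ∈ Q
  exists_pow : ∀ g : AbsGal F, g • Q = Q → ∃ j : ℕ, (Φ ^ j)⁻¹ * g ∈ N

/-- Frobenius powers exhaust the decomposition group modulo the stabilizer of `α`, provided `α` has
incongruent conjugates. -/
lemma isFrobeniusMod_of_incongruent {N : Subgroup (AbsGal F)} {α : AbsInt F}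
    (hα : ∀ g : AbsGal F, g • α = α ↔ g ∈ N) [Q.IsPrime]
    (hQ : Q.comap (algebraMap (𝓞 F) (AbsInt F)) = v.asIdeal)
    (hinc : ∀ Q' : Ideal (AbsInt F), Q'.comap (algebraMap (𝓞 F) (AbsInt F)) = v.asIdeal →
      ∀ g : AbsGal F, g • α - α ∈ Q' → g • α = α) {Φ : AbsGal F}
    (hΦ : ∀ x : AbsInt F, Φ • x - x ^ primeNorm F v ∈ Q) : IsFrobeniusMod N v Q Φ where
  isPrime := inferInstance
  comap_eq := hQ
  smul_sub_mem := hΦ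
  exists_pow g hg := by
    obtain ⟨j, hj⟩ := exists_smul_sub_pow_mem hQ hg α
    refine ⟨j, (hα _).mp (hinc ((Φ ^ j)⁻¹ • Q) (by rw [comap_smul, hQ]) _ ?_)⟩
    rw [Ideal.mem_pointwise_smul_iff_inv_smul_mem, inv_inv, smul_sub, ← mul_smul,
      mul_inv_cancel_left]
    have h := sub_mem hj (frobenius_pow_smul_sub_mem hΦ j α)
    rwa [sub_sub_sub_cancel_right] at h

lemma card_le_of_pow_eq_self {k : Type*} [Field k] [Finite k] {q : ℕ} (hq : 2 ≤ q)
    (h : ∀ x : k, x ^ q = x) : Nat.card k ≤ q := by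
  have := Fintype.ofFinite k
  rw [Nat.card_eq_fintype_card]
  have hne : (Polynomial.X ^ q - Polynomial.X : Polynomial k) ≠ 0 :=
    FiniteField.X_pow_card_sub_X_ne_zero k hq
  have h1 : (Finset.univ : Finset k).val ⊆ (Polynomial.X ^ q - Polynomial.X : Polynomial k).roots := by
    intro x _
    rw [Polynomial.mem_roots hne]
    simp [h x]
  have h2 := Polynomial.card_le_degree_of_subset_roots h1
  rwa [FiniteField.X_pow_card_sub_X_natDegree_eq k hq] at h2

attribute [local instance] Ideal.Quotient.field

/-- If some Frobenius element at `Q` fixes an intermediate field, then the prime below `Q` of this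
field has norm at most that of the prime of `F` below `Q`. -/
lemma exists_below (M : IntermediateField F (AlgebraicClosure F)) [NumberField M] [Q.IsPrime]
    (hQ : Q.comap (algebraMap (𝓞 F) (AbsInt F)) = v.asIdeal) {Φ : AbsGal F}
    (hΦ : ∀ x : AbsInt F, Φ • x - x ^ primeNorm F v ∈ Q)
    (hfix : ∀ x : 𝓞 M, Φ • ofRingOfIntegers M x = ofRingOfIntegers M x) :
    ∃ w : HeightOneSpectrum (𝓞 M), w.asIdeal = Q.comap (ofRingOfIntegers M) ∧
      primeNorm M w ≤ primeNorm F v := by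
  have hP : Q.comap (ofRingOfIntegers M) ≠ ⊥ := by
    obtain ⟨a, ha, ha0⟩ := Submodule.exists_mem_ne_zero_of_ne_bot v.ne_bot
    refine (Submodule.ne_bot_iff _).mpr ⟨algebraMap (𝓞 F) (𝓞 M) a, ?_, ?_⟩
    · rw [← hQ] at ha
      exact ha
    · rwa [Ne, FaithfulSMul.algebraMap_eq_zero_iff]
  let w : HeightOneSpectrum (𝓞 M) := ⟨Q.comap (ofRingOfIntegers M), Ideal.comap_isPrime _ _, hP⟩
  refine ⟨w, rfl, ?_⟩
  have := w.isMaximal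
  have := finite_quotient_asIdeal w
  rw [primeNorm_eq_card w]
  refine card_le_of_pow_eq_self (two_le_primeNorm v) fun x => ?_
  obtain ⟨y, rfl⟩ := Ideal.Quotient.mk_surjective x
  rw [← map_pow, eq_comm, ← sub_eq_zero, ← map_sub, Ideal.Quotient.eq_zero_iff_mem]
  change ofRingOfIntegers M _ ∈ Q
  rw [map_sub, map_pow]
  have h := hΦ (ofRingOfIntegers M y)
  rwa [hfix y] at h

/-- The primes of `F` whose Frobenius elements are conjugate to a generator of the cyclic subgroup
`D` of a finite Galois group lie below primes of the fixed field of `D` of no larger norm; this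
counts them with multiplicity. -/
lemma card_le_card_mul_ncard {N : Subgroup (AbsGal F)} [N.Normal]
    (hN : IsOpen (N : Set (AbsGal F))) (D : Subgroup (AbsGal F ⧸ N))
    [NumberField (fixedField (D.comap (QuotientGroup.mk' N)))]
    (Q : HeightOneSpectrum (𝓞 F) → Ideal (AbsInt F)) (Φ : HeightOneSpectrum (𝓞 F) → AbsGal F)
    (X : ℝ) (A : Finset ((AbsGal F ⧸ N) × HeightOneSpectrum (𝓞 F)))
    (hA : ∀ x ∈ A, IsFrobeniusMod N x.2 (Q x.2) (Φ x.2) ∧ (primeNorm F x.2 : ℝ) ≤ X ∧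
      Subgroup.zpowers (x.1 * (Φ x.2 : AbsGal F ⧸ N) * x.1⁻¹) = D)
    (hfin : {w : HeightOneSpectrum (𝓞 (fixedField (D.comap (QuotientGroup.mk' N)))) |
      (primeNorm _ w : ℝ) ≤ X}.Finite) :
    A.card ≤ Nat.card D * {w : HeightOneSpectrum (𝓞 (fixedField (D.comap (QuotientGroup.mk' N)))) |
      (primeNorm _ w : ℝ) ≤ X}.ncard := by
  classical
  set H := D.comap (QuotientGroup.mk' N) with hH
  set M := fixedField H with hM
  rcases A.eq_empty_or_nonempty with rfl | ⟨x₀, hx₀⟩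
  · simp
  have hfinG : Finite (AbsGal F ⧸ N) := Subgroup.quotient_finite_of_isOpen _ hN
  have hHopen : IsOpen (H : Set (AbsGal F)) := by
    refine Subgroup.isOpen_mono (H₁ := N) ?_ hN
    intro g hg
    rw [hH, Subgroup.mem_comap, QuotientGroup.mk'_apply, (QuotientGroup.eq_one_iff g).mpr hg]
    exact one_mem D
  have hHclosed := H.isClosed_of_isOpen hHopen
  have hw : ∀ x ∈ A, ∃ w : HeightOneSpectrum (𝓞 M),
      w.asIdeal = (x.1.out • Q x.2).comap (ofRingOfIntegers M) ∧
      primeNorm M w ≤ primeNorm F x.2 := by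
    intro x hx
    obtain ⟨hF, -, hD⟩ := hA x hx
    have := hF.isPrime
    have := isPrime_smul (Q := Q x.2) x.1.out
    refine exists_below M (by rw [comap_smul, hF.comap_eq])
      (smul_frobenius hF.smul_sub_mem x.1.out) fun y => Subtype.ext ?_
    refine (y : M).2 ⟨x.1.out * Φ x.2 * x.1.out⁻¹, ?_⟩
    rw [hH, Subgroup.mem_comap, QuotientGroup.mk'_apply, QuotientGroup.mk_mul,
      QuotientGroup.mk_mul, QuotientGroup.mk_inv, QuotientGroup.out_eq', ← hD]
    exact Subgroup.mem_zpowers _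
  have : Nonempty (HeightOneSpectrum (𝓞 M)) := ⟨(hw x₀ hx₀).choose⟩
  choose! w hw using hw
  have himage : (A.image w).card ≤
      {w : HeightOneSpectrum (𝓞 M) | (primeNorm _ w : ℝ) ≤ X}.ncard := by
    rw [← Set.ncard_coe_finset]
    refine Set.ncard_le_ncard ?_ hfin
    intro u hu
    obtain ⟨x, hx, rfl⟩ := Finset.mem_image.mp hu
    exact le_trans (Nat.cast_le.mpr (hw x hx).2) (hA x hx).2.1
  refine le_trans (Finset.card_le_mul_card_image (f := w) A (Nat.card D) ?_)
    (Nat.mul_le_mul_left _ himage)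
  intro u hu
  obtain ⟨x, hx, rfl⟩ := Finset.mem_image.mp hu
  obtain ⟨hF, -, hD⟩ := hA x hx
  have := hF.isPrime
  have := isPrime_smul (Q := Q x.2) x.1.out
  have key : ∀ x' ∈ A, w x' = w x → x'.2 = x.2 ∧ x'.1 * x.1⁻¹ ∈ D := by
    intro x' hx' hwx
    have hF' := (hA x' hx').1
    have := hF'.isPrime
    have := isPrime_smul (Q := Q x'.2) x'.1.out
    have hcomap : (x'.1.out • Q x'.2).comap (ofRingOfIntegers M) =
        (x.1.out • Q x.2).comap (ofRingOfIntegers M) := by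
      rw [← (hw x hx).1, ← (hw x' hx').1, hwx]
    have hv : x'.2 = x.2 := by
      apply HeightOneSpectrum.ext
      rw [← hF.comap_eq, ← hF'.comap_eq, ← comap_smul x.1.out (Q x.2), ← comap_smul x'.1.out (Q x'.2)]
      ext a
      have h := Ideal.ext_iff.mp hcomap (algebraMap (𝓞 F) (𝓞 M) a)
      exact h
    refine ⟨hv, ?_⟩
    obtain ⟨h, hh, hhQ⟩ := exists_smul_eq_of_isClosed hHclosed (x.1.out • Q x.2)
      (x'.1.out • Q x'.2) fun b hb => by
        obtain ⟨y, rfl⟩ := exists_ofRingOfIntegers_eq (M := M) (b := b) fun g =>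
          congrArg (fun z : AbsInt F => (z : AlgebraicClosure F)) (hb g g.2)
        exact (Ideal.ext_iff.mp hcomap y).symm
    rw [hv] at hhQ
    obtain ⟨j, hj⟩ := hF.exists_pow (x'.1.out⁻¹ * (h * x.1.out)) (by
      rw [mul_smul, mul_smul, ← hhQ]
      exact inv_smul_smul _ _)
    have h1 := (QuotientGroup.eq_one_iff _).mpr hj
    simp only [QuotientGroup.mk_mul, QuotientGroup.mk_inv, QuotientGroup.out_eq',
      QuotientGroup.mk_pow] at h1
    have h2 : (h : AbsGal F ⧸ N) ∈ D := hh
    have h3 : (x.1 * (Φ x.2 : AbsGal F ⧸ N) * x.1⁻¹) ^ j ∈ D := by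
      rw [← hD]
      exact Subgroup.npow_mem_zpowers _ _
    rw [conj_pow] at h3
    have h4 : x'.1 * x.1⁻¹ = (h : AbsGal F ⧸ N) * (x.1 * (Φ x.2 : AbsGal F ⧸ N) ^ j * x.1⁻¹)⁻¹ := by
      have h5 : x'.1⁻¹ * ((h : AbsGal F ⧸ N) * x.1) = (Φ x.2 : AbsGal F ⧸ N) ^ j :=
        (inv_mul_eq_one.mp h1).symm
      rw [← h5]
      group
    rw [h4]
    exact mul_mem h2 (inv_mem h3)
  have : Fintype D := Fintype.ofFinite D
  have hcard : Nat.card D = ((Finset.univ : Finset D).image fun d : D =>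
      ((d : AbsGal F ⧸ N) * x.1, x.2)).card := by
    rw [Finset.card_image_of_injective, Finset.card_univ, Nat.card_eq_fintype_card]
    intro d d' hdd
    exact Subtype.ext (mul_right_cancel (Prod.ext_iff.mp hdd).1)
  rw [hcard]
  refine Finset.card_le_card fun x' hx' => ?_
  rw [Finset.mem_filter] at hx'
  obtain ⟨h1, h2⟩ := key x' hx'.1 hx'.2
  exact Finset.mem_image.mpr ⟨⟨_, h2⟩, Finset.mem_univ _, Prod.ext (by simp) h1.symm⟩

end AbsoluteGalois

namespace AbsoluteGalois

open NumberField IsDedekindDomain IdealCount IntermediateField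
open scoped Pointwise

lemma finite_primeNorm_le (E : Type*) [Field E] [NumberField E] (X : ℝ) :
    {v : HeightOneSpectrum (𝓞 E) | (primeNorm E v : ℝ) ≤ X}.Finite := by
  have h := (Ideal.finite_setOfPred_absNorm_le (S := 𝓞 E) ⌊X⌋₊).preimage
    (f := fun v : HeightOneSpectrum (𝓞 E) => v.asIdeal)
    (fun _ _ _ _ h => HeightOneSpectrum.ext h)
  exact h.subset fun v hv => Nat.le_floor hv

lemma totient_orderOf_le_ncard {G : Type*} [Group G] [Finite G] (b : G) :
    (orderOf b).totient ≤ {x : G | Subgroup.zpowers x = Subgroup.zpowers b}.ncard := by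
  classical
  have h1 : Set.InjOn (fun k => b ^ k)
      ((Finset.range (orderOf b)).filter (orderOf b).Coprime : Set ℕ) := by
    refine (pow_injOn_Iio_orderOf (x := b)).mono fun k hk => ?_
    exact Finset.mem_range.mp (Finset.mem_filter.mp hk).1
  rw [Nat.totient_eq_card_coprime, ← Finset.card_image_of_injOn h1, ← Set.ncard_coe_finset]
  refine Set.ncard_le_ncard ?_ (Set.toFinite _)
  intro x hx
  obtain ⟨k, hk, rfl⟩ := Finset.mem_image.mp (Finset.mem_coe.mp hx)
  have hco := (Finset.mem_filter.mp hk).2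
  refine Subgroup.eq_of_le_of_card_ge ?_ ?_
  · rw [Subgroup.zpowers_le]
    exact Subgroup.npow_mem_zpowers _ _
  · rw [Nat.card_zpowers, Nat.card_zpowers, Nat.Coprime.orderOf_pow hco]

/-- The cyclic subgroups generated by elements of a set closed under powers. -/
lemma sum_card_zpowers_le {G : Type*} [Group G] [Finite G] {B : Set G}
    (hB : ∀ b ∈ B, ∀ k : ℕ, b ^ k ∈ B) {C : ℕ}
    (hC : ∀ g : G, orderOf g ≤ C * (orderOf g).totient) (𝒟 : Finset (Subgroup G))
    (h𝒟 : ∀ D ∈ 𝒟, ∃ b ∈ B, Subgroup.zpowers b = D) :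
    ∑ D ∈ 𝒟, Nat.card D ≤ C * B.ncard := by
  classical
  have := Fintype.ofFinite G
  let gen : Subgroup G → Finset G := fun D => Finset.univ.filter fun x => Subgroup.zpowers x = D
  have h1 : ∀ D ∈ 𝒟, Nat.card D ≤ C * (gen D).card := by
    intro D hD
    obtain ⟨b, -, rfl⟩ := h𝒟 D hD
    rw [Nat.card_zpowers]
    refine (hC b).trans (Nat.mul_le_mul_left _ ((totient_orderOf_le_ncard b).trans_eq ?_))
    rw [← Set.ncard_coe_finset]
    congr 1
    ext x
    simp [gen]
  refine (Finset.sum_le_sum h1).trans ?_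
  rw [← Finset.mul_sum, ← Finset.card_biUnion, ← Set.ncard_coe_finset]
  · refine Nat.mul_le_mul_left _ (Set.ncard_le_ncard ?_ (Set.toFinite _))
    intro x hx
    obtain ⟨D, hD, hx⟩ := Finset.mem_biUnion.mp (Finset.mem_coe.mp hx)
    obtain ⟨b, hb, rfl⟩ := h𝒟 D hD
    have h2 : x ∈ Subgroup.zpowers b := by
      rw [← (Finset.mem_filter.mp hx).2]
      exact Subgroup.mem_zpowers x
    obtain ⟨k, rfl⟩ := mem_powers_iff_mem_zpowers.mpr h2
    exact hB b hb k
  · intro D _ D' _ hne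
    refine Finset.disjoint_left.mpr fun x hx hx' => hne ?_
    rw [← (Finset.mem_filter.mp hx).2, ← (Finset.mem_filter.mp hx').2]

variable {F : Type} [Field F] [NumberField F]

lemma isOpen_comap_mk' {N : Subgroup (AbsGal F)} [N.Normal] (hN : IsOpen (N : Set (AbsGal F)))
    (D : Subgroup (AbsGal F ⧸ N)) :
    IsOpen ((D.comap (QuotientGroup.mk' N) : Subgroup (AbsGal F)) : Set (AbsGal F)) := by
  refine Subgroup.isOpen_mono (H₁ := N) ?_ hN
  intro g hg
  rw [Subgroup.mem_comap, QuotientGroup.mk'_apply, (QuotientGroup.eq_one_iff g).mpr hg]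
  exact one_mem D

lemma index_mul_ncard_le {N : Subgroup (AbsGal F)} [N.Normal] (hN : IsOpen (N : Set (AbsGal F)))
    {B : Set (AbsGal F)} (hconj : ∀ b ∈ B, ∀ g, g * b * g⁻¹ ∈ B)
    {S : Set (HeightOneSpectrum (𝓞 F))}
    (hS : ∀ v ∈ S, ∃ Q Φ, Φ ∈ B ∧ IsFrobeniusMod N v Q Φ) :
    ∃ 𝒟 : Finset (Subgroup (AbsGal F ⧸ N)),
      (∀ D ∈ 𝒟, ∃ b ∈ (QuotientGroup.mk '' B : Set (AbsGal F ⧸ N)), Subgroup.zpowers b = D) ∧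
      ∀ X : ℝ, N.index * {v | v ∈ S ∧ (primeNorm F v : ℝ) ≤ X}.ncard ≤
        ∑ D ∈ 𝒟, Nat.card D * (have := numberField_fixedField (isOpen_comap_mk' hN D)
          {w : HeightOneSpectrum (𝓞 (fixedField (D.comap (QuotientGroup.mk' N)))) |
            (primeNorm _ w : ℝ) ≤ X}.ncard) := by
  classical
  have hfinG : Finite (AbsGal F ⧸ N) := Subgroup.quotient_finite_of_isOpen _ hN
  have := Fintype.ofFinite (AbsGal F ⧸ N)
  have := Fintype.ofFinite (Subgroup (AbsGal F ⧸ N))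
  refine ⟨Finset.univ.filter fun D => ∃ b ∈ (QuotientGroup.mk '' B : Set (AbsGal F ⧸ N)),
    Subgroup.zpowers b = D, fun D hD => (Finset.mem_filter.mp hD).2, fun X => ?_⟩
  choose! Q Φ hΦ hF using hS
  have hT : {v | v ∈ S ∧ (primeNorm F v : ℝ) ≤ X}.Finite :=
    (finite_primeNorm_le F X).subset fun v hv => hv.2
  let T := hT.toFinset
  have h1 : N.index * {v | v ∈ S ∧ (primeNorm F v : ℝ) ≤ X}.ncard =
      ((Finset.univ : Finset (AbsGal F ⧸ N)) ×ˢ T).card := by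
    rw [Finset.card_product, Finset.card_univ, Subgroup.index, Nat.card_eq_fintype_card,
      Set.ncard_eq_toFinset_card _ hT]
  let cyc : (AbsGal F ⧸ N) × HeightOneSpectrum (𝓞 F) → Subgroup (AbsGal F ⧸ N) := fun x =>
    Subgroup.zpowers (x.1 * (Φ x.2 : AbsGal F ⧸ N) * x.1⁻¹)
  rw [h1, Finset.card_eq_sum_card_fiberwise (f := cyc) (t := Finset.univ.filter fun D =>
    ∃ b ∈ (QuotientGroup.mk '' B : Set (AbsGal F ⧸ N)), Subgroup.zpowers b = D)]
  · refine Finset.sum_le_sum fun D _ => ?_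
    have := numberField_fixedField (isOpen_comap_mk' hN D)
    refine card_le_card_mul_ncard hN D Q Φ X _ (fun x hx => ?_) (finite_primeNorm_le _ X)
    obtain ⟨hx1, hx2⟩ := Finset.mem_filter.mp hx
    have hx3 := (hT.mem_toFinset).mp (Finset.mem_product.mp hx1).2
    exact ⟨hF _ hx3.1, hx3.2, hx2⟩
  · intro x hx
    have hx3 := (hT.mem_toFinset).mp (Finset.mem_product.mp (Finset.mem_coe.mp hx)).2
    refine Finset.mem_coe.mpr (Finset.mem_filter.mpr ⟨Finset.mem_univ _, _,
      ⟨_, hconj _ (hΦ _ hx3.1) x.1.out, rfl⟩, ?_⟩)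
    simp only [cyc, QuotientGroup.mk_mul, QuotientGroup.mk_inv, QuotientGroup.out_eq']

end AbsoluteGalois

namespace AbsoluteGalois

open NumberField IsDedekindDomain IdealCount IntermediateField Filter
open scoped Pointwise Topology

variable {F : Type} [Field F] [NumberField F]

/-- An upper bound, with explicit constants, for the number of primes with a Frobenius element in
a given set. -/
lemma eventually_index_mul_ncard_le {N : Subgroup (AbsGal F)} [N.Normal]
    (hN : IsOpen (N : Set (AbsGal F))) {B : Set (AbsGal F)} (hconj : ∀ b ∈ B, ∀ g, g * b * g⁻¹ ∈ B)
    (hpow : ∀ b ∈ B, ∀ k : ℕ, b ^ k ∈ B) {C : ℕ}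
    (hC : ∀ g : AbsGal F ⧸ N, orderOf g ≤ C * (orderOf g).totient)
    {S : Set (HeightOneSpectrum (𝓞 F))}
    (hS : ∀ v ∈ S, ∃ Q Φ, Φ ∈ B ∧ IsFrobeniusMod N v Q Φ) :
    ∀ᶠ X : ℝ in atTop, (N.index : ℝ) *
      ({v | v ∈ S ∧ (primeNorm F v : ℝ) ≤ X}.ncard * Real.log X) ≤
        C * (QuotientGroup.mk '' B : Set (AbsGal F ⧸ N)).ncard * (7 * X) := by
  have hfinG : Finite (AbsGal F ⧸ N) := Subgroup.quotient_finite_of_isOpen _ hN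
  obtain ⟨𝒟, h𝒟, hle⟩ := index_mul_ncard_le hN hconj hS
  have hsum : ∑ D ∈ 𝒟, Nat.card D ≤
      C * (QuotientGroup.mk '' B : Set (AbsGal F ⧸ N)).ncard := by
    refine sum_card_zpowers_le ?_ hC 𝒟 h𝒟
    rintro _ ⟨b, hb, rfl⟩ k
    exact ⟨b ^ k, hpow b hb k, rfl⟩
  have hev : ∀ᶠ X : ℝ in atTop, ∀ D ∈ 𝒟,
      ((have := numberField_fixedField (isOpen_comap_mk' hN D)
        {w : HeightOneSpectrum (𝓞 (fixedField (D.comap (QuotientGroup.mk' N)))) |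
          (primeNorm _ w : ℝ) ≤ X}.ncard : ℕ) : ℝ) * Real.log X ≤ 7 * X := by
    rw [Filter.eventually_all_finset]
    intro D _
    have := numberField_fixedField (isOpen_comap_mk' hN D)
    exact (primes_bounds _).2
  filter_upwards [hev, eventually_ge_atTop 1] with X hX hX1
  have hlog := Real.log_nonneg hX1
  have h1 : ((N.index * {v | v ∈ S ∧ (primeNorm F v : ℝ) ≤ X}.ncard : ℕ) : ℝ) ≤ _ :=
    Nat.cast_le.mpr (hle X)
  rw [← mul_assoc, ← Nat.cast_mul]
  refine (mul_le_mul_of_nonneg_right h1 hlog).trans ?_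
  rw [Nat.cast_sum, Finset.sum_mul]
  trans ∑ D ∈ 𝒟, (Nat.card D : ℝ) * (7 * X)
  · refine Finset.sum_le_sum fun D hD => ?_
    rw [Nat.cast_mul, mul_assoc]
    exact mul_le_mul_of_nonneg_left (hX D hD) (Nat.cast_nonneg _)
  · rw [← Finset.sum_mul, ← Nat.cast_sum, ← Nat.cast_mul]
    exact mul_le_mul_of_nonneg_right (Nat.cast_le.mpr hsum) (by linarith)

/-- A set of primes whose Frobenius elements lie in a set of small measure, closed under powers
and conjugation, has density zero, in a tower of open normal subgroups whose quotients have
elements of order bounded by a multiple of its totient. -/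
theorem tendsto_density_zero {R : Set (HeightOneSpectrum (𝓞 F))} {B : Set (AbsGal F)}
    (hconj : ∀ b ∈ B, ∀ g, g * b * g⁻¹ ∈ B) (hpow : ∀ b ∈ B, ∀ k : ℕ, b ^ k ∈ B)
    (N : ℕ → Subgroup (AbsGal F)) [∀ k, (N k).Normal] (hN : ∀ k, IsOpen (N k : Set (AbsGal F)))
    {C : ℕ} (hC : ∀ k, ∀ g : AbsGal F ⧸ N k, orderOf g ≤ C * (orderOf g).totient)
    (hsmall : ∀ ε : ℝ, 0 < ε → ∀ᶠ k in atTop,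
      ((QuotientGroup.mk '' B : Set (AbsGal F ⧸ N k)).ncard : ℝ) ≤ ε * (N k).index)
    (hR : ∀ᶠ k in atTop, {v | v ∈ R ∧ ¬ ∃ Q Φ, Φ ∈ B ∧ IsFrobeniusMod (N k) v Q Φ}.Finite) :
    Tendsto (fun X : ℕ => ({v : HeightOneSpectrum (𝓞 F) | v ∈ R ∧ primeNorm F v ≤ X}.ncard : ℝ) /
      ({v : HeightOneSpectrum (𝓞 F) | primeNorm F v ≤ X}.ncard : ℝ)) atTop (𝓝 0) := by
  obtain ⟨c, hc, hlow⟩ := (primes_bounds F).1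
  rw [Metric.tendsto_nhds]
  intro ε hε
  let δ : ℝ := ε * c / (4 * 7 * (C + 1))
  have hC0 : (0 : ℝ) < C + 1 := by positivity
  have hδ : 0 < δ := by positivity
  obtain ⟨k, hk, hRk⟩ := ((hsmall δ hδ).and hR).exists
  set E := {v | v ∈ R ∧ ¬ ∃ Q Φ, Φ ∈ B ∧ IsFrobeniusMod (N k) v Q Φ} with hE
  set S := {v | v ∈ R ∧ ∃ Q Φ, Φ ∈ B ∧ IsFrobeniusMod (N k) v Q Φ} with hS
  have hind : (0 : ℝ) < (N k).index := by
    have := Subgroup.quotient_finite_of_isOpen _ (hN k)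
    exact Nat.cast_pos.mpr (Nat.pos_of_ne_zero (Subgroup.finiteIndex_of_finite_quotient.index_ne_zero))
  have hup := eventually_index_mul_ncard_le (hN k) hconj hpow (hC k) (S := S) fun v hv => hv.2
  have hlog : ∀ᶠ X : ℝ in atTop, (E.ncard : ℝ) * Real.log X ≤ ε * c / 4 * X := by
    have h1 := (Real.isLittleO_log_id_atTop.const_mul_left (E.ncard : ℝ)).bound
      (c := ε * c / 4) (by positivity)
    filter_upwards [h1, eventually_ge_atTop 0] with X hX hX0
    rw [Real.norm_eq_abs, id, Real.norm_eq_abs, abs_of_nonneg hX0] at hX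
    exact (le_abs_self _).trans hX
  filter_upwards [tendsto_natCast_atTop_atTop.eventually
    ((hlow.and hup).and (hlog.and (eventually_gt_atTop (1 : ℝ))))] with X hX
  obtain ⟨⟨h1, h2⟩, h3, h4⟩ := hX
  simp only [Nat.cast_le] at h1 h2
  have hl : 0 < Real.log X := Real.log_pos h4
  have hX0 : (0 : ℝ) < X := by linarith
  set π := {v : HeightOneSpectrum (𝓞 F) | primeNorm F v ≤ X}.ncard
  set s := {v | v ∈ S ∧ primeNorm F v ≤ X}.ncard
  have hπ : (0 : ℝ) < π := by
    have h5 : 0 < (π : ℝ) * Real.log X := lt_of_lt_of_le (by positivity) h1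
    exact (pos_iff_pos_of_mul_pos h5).mpr hl
  have hr : {v : HeightOneSpectrum (𝓞 F) | v ∈ R ∧ primeNorm F v ≤ X}.ncard ≤ s + E.ncard := by
    have hfin : {v | v ∈ S ∧ primeNorm F v ≤ X}.Finite :=
      (finite_primeNorm_le F X).subset fun v hv => (Nat.cast_le (α := ℝ)).mpr hv.2
    refine (Set.ncard_le_ncard ?_ (hfin.union hRk)).trans (Set.ncard_union_le _ _)
    intro v hv
    by_cases h : ∃ Q Φ, Φ ∈ B ∧ IsFrobeniusMod (N k) v Q Φ
    · exact Or.inl ⟨⟨hv.1, h⟩, hv.2⟩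
    · exact Or.inr ⟨hv.1, h⟩
  have hs : (s : ℝ) * Real.log X ≤ ε * c / 4 * X := by
    have h5 : (N k).index * ((s : ℝ) * Real.log X) ≤ (N k).index * (ε * c / 4 * X) := by
      refine h2.trans ?_
      calc C * ((QuotientGroup.mk '' B : Set (AbsGal F ⧸ N k)).ncard : ℝ) * (7 * X)
          ≤ (C + 1) * (δ * (N k).index) * (7 * X) := by
            gcongr
            linarith
        _ = (N k).index * (ε * c / 4 * X) := by
            simp only [δ]
            field_simp
    exact le_of_mul_le_mul_left h5 hind
  rw [Real.dist_eq, sub_zero, abs_of_nonneg (by positivity), div_lt_iff₀ hπ]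
  have hr' : (({v : HeightOneSpectrum (𝓞 F) | v ∈ R ∧ primeNorm F v ≤ X}.ncard : ℕ) : ℝ) ≤
      s + E.ncard := by exact_mod_cast hr
  refine lt_of_mul_lt_mul_right ?_ hl.le
  calc _ ≤ ((s : ℝ) + E.ncard) * Real.log X := mul_le_mul_of_nonneg_right hr' hl.le
    _ ≤ ε * c / 2 * X := by linarith
    _ < ε * (c * X) := by nlinarith [mul_pos (mul_pos hε hc) hX0]
    _ ≤ ε * (π * Real.log X) := mul_le_mul_of_nonneg_left h1 hε.le
    _ = _ := by ring

end AbsoluteGalois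

namespace AbsoluteGalois

open NumberField IsDedekindDomain IdealCount IntermediateField Filter
open scoped Pointwise Topology

lemma _root_.Ideal.eq_of_sub_mem_of_pow_eq_one {B : Type*} [CommRing B] [IsDomain B] {Q : Ideal B}
    [Q.IsPrime] {n : ℕ} (hn : (n : B) ∉ Q) {x y : B} (hx : x ^ n = 1) (hy : y ^ n = 1)
    (h : x - y ∈ Q) : x = y := by
  by_contra hne
  have h1 : (∑ i ∈ Finset.range n, x ^ i * y ^ (n - 1 - i)) * (x - y) = 0 := by
    rw [(Commute.all x y).geom_sum₂_mul, hx, hy, sub_self]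
  have h2 := (mul_eq_zero.mp h1).resolve_right (sub_ne_zero.mpr hne)
  have hxy : Ideal.Quotient.mk Q y = Ideal.Quotient.mk Q x := (Ideal.Quotient.eq.mpr h).symm
  have h3 := congrArg (Ideal.Quotient.mk Q) h2
  rw [map_sum, map_zero] at h3
  have h4 : ∀ i ∈ Finset.range n, Ideal.Quotient.mk Q (x ^ i * y ^ (n - 1 - i)) =
      Ideal.Quotient.mk Q x ^ (n - 1) := by
    intro i hi
    rw [map_mul, map_pow, map_pow, hxy, ← pow_add]
    congr 1
    have := Finset.mem_range.mp hi
    omega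
  rw [Finset.sum_congr rfl h4, Finset.sum_const, Finset.card_range, nsmul_eq_mul,
    ← map_natCast (Ideal.Quotient.mk Q), ← map_pow, ← map_mul, Ideal.Quotient.eq_zero_iff_mem] at h3
  refine hn (((inferInstance : Q.IsPrime).mem_or_mem h3).resolve_right fun h5 => ?_)
  have hn0 : n ≠ 0 := by
    rintro rfl
    simp at hn
  refine (inferInstance : Q.IsPrime).ne_top ((Ideal.eq_top_iff_one Q).mpr ?_)
  rw [← hx, ← Nat.sub_one_add_one hn0, pow_succ]
  exact Q.mul_mem_right _ h5

variable {F : Type} [Field F] [NumberField F] {v : HeightOneSpectrum (𝓞 F)} {Q : Ideal (AbsInt F)}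

/-- The cyclotomic character of the absolute Galois group. -/
noncomputable def cyclotomic (F : Type) [Field F] (p : ℕ) [Fact p.Prime] : AbsGal F →* ℤ_[p]ˣ :=
  (cyclotomicCharacter (AlgebraicClosure F) p).comp
    (MulSemiringAction.toRingAut (AbsGal F) (AlgebraicClosure F))

lemma natCast_notMem [Q.IsPrime] (hQ : Q.comap (algebraMap (𝓞 F) (AbsInt F)) = v.asIdeal) {n : ℕ}
    (hn : (n : 𝓞 F) ∉ v.asIdeal) : (n : AbsInt F) ∉ Q := by
  rw [← hQ, Ideal.mem_comap, map_natCast] at hn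
  exact hn

lemma cyclotomic_eq [Q.IsPrime] (hQ : Q.comap (algebraMap (𝓞 F) (AbsInt F)) = v.asIdeal) {p : ℕ}
    [Fact p.Prime] (hp : (p : 𝓞 F) ∉ v.asIdeal) {g : AbsGal F} {q : ℕ}
    (hg : ∀ x : AbsInt F, g • x - x ^ q ∈ Q) : (cyclotomic F p g : ℤ_[p]) = q := by
  refine PadicInt.ext_of_toZModPow.mp fun n => ?_
  rw [cyclotomic, MonoidHom.comp_apply, cyclotomicCharacter.toZModPow, map_natCast, eq_comm]
  apply modularCyclotomicCharacter.unique
  intro t ht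
  have ht1 : (t : AlgebraicClosure F) ^ p ^ n = 1 := by
    rw [← Units.val_pow_eq_pow_val, (mem_rootsOfUnity _ _).mp ht, Units.val_one]
  let z : AbsInt F := ⟨t, IsIntegral.of_pow (pow_pos (Fact.out : p.Prime).pos n)
    (ht1 ▸ isIntegral_one)⟩
  have hz : z ^ p ^ n = 1 := Subtype.ext ht1
  have hpn : ((p ^ n : ℕ) : AbsInt F) ∉ Q := by
    rw [Nat.cast_pow]
    exact fun h => natCast_notMem hQ hp (Ideal.IsPrime.mem_of_pow_mem inferInstance _ h)
  have h1 : g • z = z ^ q := Ideal.eq_of_sub_mem_of_pow_eq_one hpn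
    (by rw [← smul_pow', hz, smul_one]) (by rw [pow_right_comm, hz, one_pow]) (hg z)
  have h2 : g • (t : AlgebraicClosure F) = (t : AlgebraicClosure F) ^ q :=
    congrArg (fun y : AbsInt F => (y : AlgebraicClosure F)) h1
  change g • (t : AlgebraicClosure F) = _
  rw [h2, ZMod.val_natCast]
  conv_lhs => rw [← Nat.mod_add_div q (p ^ n)]
  rw [pow_add, pow_mul, ht1, one_pow, mul_one]

lemma conj_inertia [Q.IsPrime] {Φ : AbsGal F} {q : ℕ} (hq : 0 < q)
    (hΦ : ∀ x : AbsInt F, Φ • x - x ^ q ∈ Q) {τ : AbsGal F} (hτ : ∀ x : AbsInt F, τ • x - x ∈ Q)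
    (x : AbsInt F) : (Φ * τ * Φ⁻¹ * (τ ^ q)⁻¹) • x - x ∈ Q := by
  have h1 : τ ∈ Q.inertia (AbsGal F) := hτ
  have h2 : Φ * τ * Φ⁻¹ ∈ Q.inertia (AbsGal F) := by
    intro y
    have h3 := hτ (Φ⁻¹ • y)
    have h4 := add_mem (hΦ (τ • Φ⁻¹ • y - Φ⁻¹ • y)) (Q.pow_mem_of_mem h3 q hq)
    rw [sub_add_cancel, smul_sub, smul_inv_smul] at h4
    change (Φ * τ * Φ⁻¹) • y - y ∈ Q
    rw [mul_smul, mul_smul]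
    exact h4
  exact mul_mem h2 (inv_mem (pow_mem h1 q)) x

end AbsoluteGalois

namespace AbsoluteGalois

open NumberField IsDedekindDomain IdealCount IntermediateField Filter ZariskiMeasure Quasiunipotent
open LieAux
open scoped Pointwise Topology

lemma conj_mem_badSet {G L V : Type*} [Group G] [Field L] [CharZero L] [AddCommGroup V] [Module L V]
    [Algebra ℚ (Module.End L V)] {r : G →* Module.End L V} {χ : G →* Lˣ} {b : G}
    (hb : b ∈ badSet r χ) (g : G) : g * b * g⁻¹ ∈ badSet r χ := by
  obtain ⟨N, hN, hN0, hnil, h⟩ := hb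
  have hinv : r g⁻¹ * r g = 1 := by rw [← map_mul, inv_mul_cancel, map_one]
  refine ⟨r g * N * r g⁻¹, conjL_mem_logSpan g hN, fun h0 => hN0 ?_, ?_, ?_⟩
  · have h1 : r g⁻¹ * (r g * N * r g⁻¹) * r g = N := by
      rw [← mul_assoc, ← mul_assoc, hinv, one_mul, mul_assoc,
        hinv, mul_one]
    rw [← h1, h0, mul_zero, zero_mul]
  · exact hnil.map (conjHom r g)
  · have h1 : (χ (g * b * g⁻¹) : L) = (χ b : L) := by
      rw [map_mul, map_mul, map_inv, mul_right_comm, mul_inv_cancel, one_mul]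
    rw [h1, ← smul_mul_assoc, ← mul_smul_comm, ← h]
    simp only [map_mul, mul_inv_rev, inv_inv, mul_assoc]
    rw [← mul_assoc (r g⁻¹) (r g), hinv, one_mul, ← mul_assoc (r g⁻¹) (r g),
      hinv, one_mul]

variable {F : Type} [Field F] [NumberField F]

lemma finite_natCast_mem {n : ℕ} (hn : n ≠ 0) :
    {v : HeightOneSpectrum (𝓞 F) | (n : 𝓞 F) ∈ v.asIdeal}.Finite := by
  have h : Ideal.span {(n : 𝓞 F)} ≠ ⊥ := by
    rw [Ne, Ideal.span_singleton_eq_bot]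
    exact Nat.cast_ne_zero.mpr hn
  refine (Ideal.finite_factors h).subset fun v hv => ?_
  rw [Set.mem_ofPred_eq, Ideal.dvd_iff_le]
  exact (Ideal.span_singleton_le_iff_mem _).mpr hv

/-- At almost all ramified primes there is a Frobenius element in the bad set. -/
theorem finite_ramified_not_bad {R : Type*} [CommRing R] {d : ℕ} {I : Ideal R} {L : Type*}
    [Field L] [CharZero L] [IsAlgClosed L] [Algebra ℚ (Module.End L (Fin d → L))] {f : R →+* L}
    (hf : Function.Injective f) {p : ℕ} [Fact p.Prime] (hp : (p : R) ∈ I)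
    (hI : ∀ x : R, (∀ k, x ∈ I ^ k) → x = 0) (ρ : AbsGal F →* Matrix.GeneralLinearGroup (Fin d) R)
    (χ : AbsGal F →* Rˣ) (j : ℤ_[p] →+* R) (hχ : χ = (Units.map (j : ℤ_[p] →* R)).comp (cyclotomic F p))
    (hopen : ∀ k, IsOpen (levelSubgroup I ρ χ k : Set (AbsGal F))) (k : ℕ) :
    {v | IsRamifiedAt F ρ v ∧ ¬ ∃ Q Φ, Φ ∈ badSet (matrixRep f ρ) ((Units.map (f : R →* L)).comp χ) ∧
      IsFrobeniusMod (levelSubgroup I ρ χ k) v Q Φ}.Finite := by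
  obtain ⟨k₀, hk₀, huni⟩ := exists_congrOne_isNilpotent (d := d) hp hI hf
  obtain ⟨α₀, hα₀⟩ := exists_stabilizer_eq (hopen k₀)
  obtain ⟨α, hα⟩ := exists_stabilizer_eq (hopen k)
  have hpp : p.Prime := Fact.out
  refine (((finite_natCast_mem (F := F) hpp.ne_zero).union (finite_exceptional α₀)).union
    (finite_exceptional α)).subset ?_
  rintro v ⟨⟨Q, hQp, hQ, τ, hτ, hne⟩, hbad⟩
  by_contra hv
  simp only [Set.mem_union, not_or] at hv
  obtain ⟨⟨hpv, hv₀⟩, hv₁⟩ := hv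
  have hin : ∀ x : AbsInt F, τ • x - x ∈ Q := by
    intro x
    obtain ⟨y, hy, hxy⟩ := hτ x
    have : y = τ • x - x := Subtype.ext hxy
    rwa [← this]
  obtain ⟨Φ, hΦ⟩ := exists_frobenius hQ
  have hinertia : ∀ σ : AbsGal F, (∀ x : AbsInt F, σ • x - x ∈ Q) → σ ∈ levelSubgroup I ρ χ k₀ := by
    intro σ hσ
    rw [← hα₀]
    by_contra h
    exact hv₀ ⟨Q, hQ, σ, h, hσ α₀⟩
  refine hbad ⟨Q, Φ, ?_, isFrobeniusMod_of_incongruent hα hQ (fun Q' hQ' g hg => ?_) hΦ⟩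
  · have hτ₀ := (mem_levelSubgroup.mp (hinertia τ hin)).1
    have hκ := hinertia _ (conj_inertia (primeNorm_pos v) hΦ hin)
    have hκ' : ρ (Φ * τ * Φ⁻¹ * (τ ^ primeNorm F v)⁻¹) = 1 := by
      refine (eq_one_of_forall_mem_levelSubgroup (χ := χ) hI fun l => ?_).1
      refine tame_mem hQ (hopen l) hin hΦ (n := p ^ l) ?_ ?_
      · rw [Nat.cast_pow]
        have := v.isPrime
        exact fun h => hpv (Ideal.IsPrime.mem_of_pow_mem this _ h)
      · exact levelSubgroup_antitone (Nat.le_add_left l k₀)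
          (pow_prime_pow_mem_levelSubgroup hp hk₀ hκ l)
    refine mem_badSet hf (two_le_primeNorm v) (fun M hM => huni _ hτ₀ M hM) (τ := τ) ?_ ?_ ?_ hne
    · rw [hχ]
      refine Units.ext ?_
      change j (cyclotomic F p τ : ℤ_[p]) = 1
      rw [cyclotomic_eq hQ hpv (q := 1) (by simpa using hin), Nat.cast_one, map_one]
    · rw [hχ]
      change j (cyclotomic F p Φ : ℤ_[p]) = _
      rw [cyclotomic_eq hQ hpv hΦ, map_natCast]
    · rw [map_mul, map_inv] at hκ'
      exact mul_inv_eq_one.mp hκ'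
  · by_contra h
    exact hv₁ ⟨Q', hQ', g, h, hg⟩

end AbsoluteGalois

namespace AdicCoefficients

open scoped NormedField Valued Topology

section UnitBall

variable {p : ℕ} [Fact p.Prime] {K : Type*} [NormedField K] [Algebra ℚ_[p] K]
  [IsUltrametricDist K]

lemma isNoetherianRing_unitBall [FiniteDimensional ℚ_[p] K]
    (hKnorm : ∀ x : ℚ_[p], ‖algebraMap ℚ_[p] K x‖ = ‖x‖) : IsNoetherianRing (unitBall K) := by
  let _ : NontriviallyNormedField K :=
    { ‹NormedField K› with
      non_trivial := by
        obtain ⟨x, hx⟩ := NormedField.exists_one_lt_norm ℚ_[p]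
        exact ⟨algebraMap ℚ_[p] K x, by rw [hKnorm]; exact hx⟩ }
  let _ : NormedSpace ℚ_[p] K :=
    { norm_smul_le := fun a b => by rw [Algebra.smul_def, norm_mul, hKnorm] }
  have : ProperSpace K := FiniteDimensional.proper ℚ_[p] K
  have hball : ((𝒪[K] : Subring K) : Set K) = Metric.closedBall 0 1 := by
    ext x
    rw [mem_closedBall_zero_iff]
    exact Valued.integer.mem_iff
  have : CompactSpace 𝒪[K] := by
    refine isCompact_iff_compactSpace.mp ?_
    rw [hball]
    exact isCompact_closedBall 0 1
  have hpir : IsPrincipalIdealRing 𝒪[K] := Valued.integer.isPrincipalIdealRing_of_compactSpace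
  have heq : (𝒪[K] : Subring K) = unitBall K := by
    ext x
    exact Valued.integer.mem_iff
  rw [← heq]
  infer_instance

/-- The structure map from the `p`-adic integers to the unit ball. -/
noncomputable def padicIntToUnitBall (hKnorm : ∀ x : ℚ_[p], ‖algebraMap ℚ_[p] K x‖ = ‖x‖) :
    ℤ_[p] →+* unitBall K :=
  ((algebraMap ℚ_[p] K).comp PadicInt.Coe.ringHom).codRestrict (unitBall K) fun x => by
    change ‖algebraMap ℚ_[p] K (x : ℚ_[p])‖ ≤ 1
    rw [hKnorm]
    exact x.norm_le_one

lemma not_isUnit_natCast_unitBall (hKnorm : ∀ x : ℚ_[p], ‖algebraMap ℚ_[p] K x‖ = ‖x‖) :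
    ¬ IsUnit (p : unitBall K) := by
  intro h
  obtain ⟨b, hb⟩ := h.exists_right_inv
  have hb' : (p : K) * (b : K) = 1 := by exact_mod_cast congrArg (Subtype.val) hb
  have h1 : ‖(p : K)‖ = (p : ℝ)⁻¹ := by
    rw [← map_natCast (algebraMap ℚ_[p] K), hKnorm, Padic.norm_p]
  have h2 : ‖(b : K)‖ ≤ 1 := b.2
  have h3 : ‖(p : K)‖ * ‖(b : K)‖ = 1 := by rw [← norm_mul, hb', norm_one]
  have h4 : (p : ℝ)⁻¹ < 1 := inv_lt_one_of_one_lt₀ (by exact_mod_cast (Fact.out : p.Prime).one_lt)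
  rw [h1] at h3
  have h5 : (0 : ℝ) < (p : ℝ)⁻¹ := by
    have := (Fact.out : p.Prime).pos
    positivity
  nlinarith

end UnitBall

section Finite

variable {A R σ : Type*} [CommRing A] [CommRing R] [Finite σ] {ι : MvPowerSeries σ A →+* R}

lemma isNoetherianRing_of_finite [IsNoetherianRing A] (hfin : ι.Finite) : IsNoetherianRing R := by
  let _ := ι.toAlgebra
  have : Module.Finite (MvPowerSeries σ A) R := hfin
  exact IsNoetherianRing.of_finite (MvPowerSeries σ A) R

omit [Finite σ] in
lemma natCast_mem_maximalIdeal [IsLocalRing R] (hfin : ι.Finite) (hinj : Function.Injective ι)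
    {p : ℕ} (hp : ¬ IsUnit (p : A)) : (p : R) ∈ IsLocalRing.maximalIdeal R := by
  rw [IsLocalRing.mem_maximalIdeal, mem_nonunits_iff]
  intro h
  have := RingHom.IsIntegral.isLocalHom hfin.to_isIntegral hinj
  have h1 : IsUnit (p : MvPowerSeries σ A) := by
    refine isUnit_of_map_unit ι _ ?_
    rwa [map_natCast]
  have h2 := h1.map (MvPowerSeries.constantCoeff (σ := σ) (R := A))
  rw [map_natCast] at h2
  exact hp h2

end Finite

section Adic

variable {R : Type*} [CommRing R] {I : Ideal R}

lemma isTopologicalRing_adic : @IsTopologicalRing R I.adicTopology _ := by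
  let _ := I.adicTopology
  exact I.nonarchimedean.toIsTopologicalRing

lemma isOpen_pow_adic (k : ℕ) : IsOpen[I.adicTopology] ((I ^ k : Ideal R) : Set R) :=
  let _ := I.adicTopology
  (I.openAddSubgroup k).isOpen'

lemma t1Space_adic (hI : ∀ x, (∀ k, x ∈ I ^ k) → x = 0) : @T1Space R I.adicTopology := by
  let _ := I.adicTopology
  have : IsTopologicalRing R := isTopologicalRing_adic (I := I)
  refine IsTopologicalAddGroup.t1Space R ?_
  have : ({0} : Set R) = ⋂ k, ((I ^ k : Ideal R) : Set R) := by
    ext x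
    simp only [Set.mem_singleton_iff, Set.mem_iInter, SetLike.mem_coe]
    refine ⟨fun h k => h ▸ zero_mem _, hI x⟩
  rw [this]
  exact isClosed_iInter fun k => (I.openAddSubgroup k).isClosed

lemma continuous_padicInt_adic {p : ℕ} [Fact p.Prime] (hp : (p : R) ∈ I) (j : ℤ_[p] →+* R) :
    @Continuous _ _ _ I.adicTopology j := by
  let _ := I.adicTopology
  have : IsTopologicalRing R := isTopologicalRing_adic (I := I)
  refine continuous_of_continuousAt_zero j ?_
  rw [ContinuousAt, map_zero]
  refine I.hasBasis_nhds_zero_adic.tendsto_right_iff.mpr fun k _ => ?_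
  have hpos : (0 : ℝ) < (p : ℝ) ^ (-k : ℤ) :=
    zpow_pos (by exact_mod_cast (Fact.out : p.Prime).pos) _
  filter_upwards [Metric.closedBall_mem_nhds (0 : ℤ_[p]) hpos] with x hx
  rw [mem_closedBall_zero_iff, PadicInt.norm_le_pow_iff_mem_span_pow,
    Ideal.mem_span_singleton'] at hx
  obtain ⟨a, rfl⟩ := hx
  rw [map_mul, map_pow, map_natCast]
  exact Ideal.mul_mem_left _ _ (Ideal.pow_mem_pow hp k)

open Quasiunipotent LieAux in
lemma isOpen_levelSubgroup {G : Type*} [Group G] [TopologicalSpace G] {d : ℕ}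
    {ρ : G →* Matrix.GeneralLinearGroup (Fin d) R} {χ : G →* Rˣ}
    (hρ : ∀ i j, @Continuous _ _ _ I.adicTopology fun g => (ρ g : Matrix (Fin d) (Fin d) R) i j)
    (hχ : @Continuous _ _ _ I.adicTopology fun g => (χ g : R)) (k : ℕ) :
    IsOpen (levelSubgroup I ρ χ k : Set G) := by
  let _ := I.adicTopology
  have : IsTopologicalRing R := isTopologicalRing_adic (I := I)
  have hset : (levelSubgroup I ρ χ k : Set G) =
      (⋂ i, ⋂ j, (fun g => (ρ g : Matrix (Fin d) (Fin d) R) i j -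
        (1 : Matrix (Fin d) (Fin d) R) i j) ⁻¹' ((I ^ k : Ideal R) : Set R)) ∩
      (fun g => (χ g : R) - 1) ⁻¹' ((I ^ k : Ideal R) : Set R) := by
    ext g
    rw [SetLike.mem_coe, mem_levelSubgroup]
    refine and_congr ?_ Iff.rfl
    rw [CongrOne, ← sub_eq_zero, ← map_one (Ideal.Quotient.mk (I ^ k)).mapMatrix, ← map_sub,
      mapMatrix_eq_zero]
    simp
  rw [hset]
  refine IsOpen.inter (isOpen_iInter_of_finite fun i => isOpen_iInter_of_finite fun j => ?_) ?_
  · exact (isOpen_pow_adic k).preimage ((hρ i j).sub continuous_const)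
  · exact (isOpen_pow_adic k).preimage (hχ.sub continuous_const)

end Adic

end AdicCoefficients

/-- Let `K` be a `p`-adic number field with ring of integers `𝒪_K`, and
let `𝒪` be an integral domain of characteristic zero admitting a finite injective ring
homomorphism from `𝒪_K[[X₁,…,X_m]]` (so `𝒪` is local).  Let `F` be a number field and
`ρ : Gal(F̄/F) → GLₙ(𝒪)` a group homomorphism, continuous for the Krull topology on
`Gal(F̄/F)` and the maximal-ideal-adic topology on `𝒪`, such that `ρ ⊗ 𝒦̄` is semisimple,
where `𝒦̄` is an algebraic closure of the fraction field `𝒦` of `𝒪`.  Then the set of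
nonzero primes of `𝒪_F` at which `ρ` is ramified has density zero. -/
theorem density_of_ramified_primes_stmt0
    (p : ℕ) [Fact p.Prime]
    (K : Type) [NormedField K] [Algebra ℚ_[p] K] [FiniteDimensional ℚ_[p] K]
    [IsUltrametricDist K]
    (hKnorm : ∀ x : ℚ_[p], ‖algebraMap ℚ_[p] K x‖ = ‖x‖)
    (m : ℕ) (hm : 1 ≤ m)
    (𝒪 : Type) [CommRing 𝒪] [IsDomain 𝒪] [CharZero 𝒪] [IsLocalRing 𝒪]
    (ι : MvPowerSeries (Fin m) (unitBall K) →+* 𝒪)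
    (hfin : ι.Finite) (hinj : Function.Injective ι)
    (F : Type) [Field F] [NumberField F]
    (n : ℕ) (hn : 1 ≤ n)
    (ρ : (AlgebraicClosure F ≃ₐ[F] AlgebraicClosure F) →*
      Matrix.GeneralLinearGroup (Fin n) 𝒪)
    -- `ρ` is continuous for the maximal-ideal-adic topology on `𝒪`:
    (hcont : @Continuous (AlgebraicClosure F ≃ₐ[F] AlgebraicClosure F)
      (Matrix (Fin n) (Fin n) 𝒪) inferInstance
      (show TopologicalSpace (Matrix (Fin n) (Fin n) 𝒪) from
        @Pi.topologicalSpace (Fin n) _ fun _ =>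
          @Pi.topologicalSpace (Fin n) _ fun _ =>
            (IsLocalRing.maximalIdeal 𝒪).adicTopology)
      (fun σ => (ρ σ : Matrix (Fin n) (Fin n) 𝒪)))
    -- `ρ ⊗ 𝒦̄` is semisimple:
    (hss : IsSemisimpleModule
      (MonoidAlgebra (AlgebraicClosure (FractionRing 𝒪))
        (AlgebraicClosure F ≃ₐ[F] AlgebraicClosure F))
      (matrixRep ((algebraMap (FractionRing 𝒪) (AlgebraicClosure (FractionRing 𝒪))).comp
        (algebraMap 𝒪 (FractionRing 𝒪))) ρ).asModule) :
    -- the set of primes of `𝒪_F` at which `ρ` is ramified has density zero: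
    Filter.Tendsto
      (fun X : ℕ =>
        (({v : IsDedekindDomain.HeightOneSpectrum (NumberField.RingOfIntegers F) |
            IsRamifiedAt F ρ v ∧ Ideal.absNorm v.asIdeal ≤ X}.ncard : ℝ) /
         ({v : IsDedekindDomain.HeightOneSpectrum (NumberField.RingOfIntegers F) |
            Ideal.absNorm v.asIdeal ≤ X}.ncard : ℝ)))
      Filter.atTop (𝓝 0) := by
  classical
  set I := IsLocalRing.maximalIdeal 𝒪
  set f := (algebraMap (FractionRing 𝒪) (AlgebraicClosure (FractionRing 𝒪))).comp
    (algebraMap 𝒪 (FractionRing 𝒪)) with hf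
  have hpunit := AdicCoefficients.not_isUnit_natCast_unitBall hKnorm
  have hpI : (p : 𝒪) ∈ I := AdicCoefficients.natCast_mem_maximalIdeal hfin hinj hpunit
  have : IsNoetherianRing (unitBall K) := AdicCoefficients.isNoetherianRing_unitBall hKnorm
  have : IsNoetherianRing 𝒪 := AdicCoefficients.isNoetherianRing_of_finite hfin
  have hI : ∀ x : 𝒪, (∀ k, x ∈ I ^ k) → x = 0 := fun x hx => by
    have h := Ideal.iInf_pow_eq_bot_of_isLocalRing I (IsLocalRing.maximalIdeal.isMaximal 𝒪).ne_top
    rw [← Ideal.mem_bot, ← h]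
    exact (Submodule.mem_iInf _).mpr hx
  let j : ℤ_[p] →+* 𝒪 :=
    ι.comp (MvPowerSeries.C.comp (AdicCoefficients.padicIntToUnitBall hKnorm))
  let χ : AbsoluteGalois.AbsGal F →* 𝒪ˣ :=
    (Units.map (j : ℤ_[p] →* 𝒪)).comp (AbsoluteGalois.cyclotomic F p)
  let _ : TopologicalSpace 𝒪 := I.adicTopology
  have : IsTopologicalRing 𝒪 := AdicCoefficients.isTopologicalRing_adic (I := I)
  have : T1Space 𝒪 := AdicCoefficients.t1Space_adic hI
  have hρ : ∀ i k, Continuous fun g => (ρ g : Matrix (Fin n) (Fin n) 𝒪) i k := fun i k =>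
    (continuous_apply k).comp ((continuous_apply i).comp hcont)
  have hχ : Continuous fun g => (χ g : 𝒪) :=
    (AdicCoefficients.continuous_padicInt_adic hpI j).comp
      (Units.continuous_val.comp (cyclotomicCharacter.continuous p F (AlgebraicClosure F)))
  have hopen := AdicCoefficients.isOpen_levelSubgroup hρ hχ
  have : CharZero (FractionRing 𝒪) :=
    charZero_of_injective_algebraMap (IsFractionRing.injective 𝒪 (FractionRing 𝒪))
  have : CharZero (AlgebraicClosure (FractionRing 𝒪)) :=
    charZero_of_injective_algebraMap (algebraMap (FractionRing 𝒪) _).injective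
  have hfinj : Function.Injective f :=
    (algebraMap (FractionRing 𝒪) (AlgebraicClosure (FractionRing 𝒪))).injective.comp
      (IsFractionRing.injective 𝒪 (FractionRing 𝒪))
  let _ : Algebra ℚ (Module.End (AlgebraicClosure (FractionRing 𝒪))
    (Fin n → AlgebraicClosure (FractionRing 𝒪))) := Module.End.instAlgebra _ _ _
  have hindex : 0 < (Quasiunipotent.levelSubgroup I ρ χ 1).index := by
    have := Subgroup.quotient_finite_of_isOpen _ (hopen 1)
    exact Nat.pos_of_ne_zero Subgroup.index_ne_zero_of_finite
  exact AbsoluteGalois.tendsto_density_zero (R := {v | IsRamifiedAt F ρ v})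
    (B := ZariskiMeasure.badSet (matrixRep f ρ) ((Units.map (f : 𝒪 →* _)).comp χ))
    (fun b hb g => AbsoluteGalois.conj_mem_badSet hb g)
    (fun b hb k => Quasiunipotent.pow_mem_badSet hb k)
    (Quasiunipotent.levelSubgroup I ρ χ) hopen
    (C := (Quasiunipotent.levelSubgroup I ρ χ 1).index * p)
    (fun k g => by
      obtain ⟨g, rfl⟩ := QuotientGroup.mk_surjective g
      exact Nat.le_mul_totient_of_dvd_mul_prime_pow Fact.out hindex
        (Quasiunipotent.orderOf_mk_dvd hpI k g))
    (fun ε hε => ZariskiMeasure.eventually_ncard_image_badSet_matrixRep_le hf hρ hχ hss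
      (Quasiunipotent.levelSubgroup I ρ χ) Quasiunipotent.levelSubgroup_antitone hopen
      (fun x hx => Quasiunipotent.eq_one_of_forall_mem_levelSubgroup hI hx) hε)
    (Filter.Eventually.of_forall fun k =>
      AbsoluteGalois.finite_ramified_not_bad hfinj hpI hI ρ χ j rfl hopen k)
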